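/- Let Ξ ⊆ Ω be a prediction set satisfying Assumption B with associated function Z̄, let Z : Ω → [1,∞] be defined by Z(ω) := Z̄(ω, ⟨ω⟩), and assume M_Z(Ξ) is nonempty. Define Φ^Z(ξ) := inf{ λ ∈ ℝ : there is c ≥ 0 and sequences (H^n), (G^n) in ℋ such that λ + (H^n·S)_T + (G^n·𝕊)_T ≥ −cZ on Ξ for all n, and λ + liminf_{n→∞}((H^n·S)_T + (G^n·𝕊)_T) ≥ ξ on Ξ }. Then for every function ξ : C[0,T] → (−∞,∞] bounded from below which is of the form ξ(ω) = liminf_{n→∞} ξ̄_n(ω, ⟨ω⟩), where each ξ̄_n : C[0,T]×C[0,T] → ℝ is bounded and upper semicontinuous, one has Φ^Z(ξ) = sup_{Q ∈ M_Z(Ξ)} E_Q[ξ]; moreover, if Φ^Z(ξ) < ∞ then the infimum defining Φ^Z(ξ) is attained. -/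

import Mathlib

open MeasureTheory Filter Set Topology
open scoped ENNReal Classical

noncomputable section

namespace PathwiseSuperhedging

/-- The path space `C[0,T]`: continuous functions on `[0,T]` with the sup-norm. -/
abbrev Path (T : ℝ) := C(Set.Icc (0:ℝ) T, ℝ)

variable (T : ℝ)

instance : MeasurableSpace (Path T) := borel _
instance : BorelSpace (Path T) := ⟨rfl⟩

variable (hT : 0 ≤ T)

/-- time `0` as an element of `[0,T]`. -/
def t0 : Set.Icc (0:ℝ) T := ⟨0, le_refl 0, hT⟩

/-- clamp a real time into `[0,T]`. -/
def clamp (t : ℝ) : Set.Icc (0:ℝ) T := Set.projIcc 0 T hT t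

/-- evaluation of a path at a (clamped) real time. -/
def ev (ω : Path T) (t : ℝ) : ℝ := ω (clamp T hT t)

/-- The stopping times `σ^m_k`:  `σ^m_0 = 0` and
`σ^m_{k+1} = inf { t ≥ σ^m_k : |S_t - S_{σ^m_k}| ≥ 2^{-m} }` (equal to `T+1` if no such
time `t ≤ T` exists). -/
def sig (m : ℕ) : ℕ → Path T → ℝ
  | 0 => fun _ => 0
  | k + 1 => fun ω =>
      sInf ({t : ℝ | sig m k ω ≤ t ∧ t ≤ T ∧
        (2:ℝ) ^ (-(m:ℤ)) ≤ |ev T hT ω t - ev T hT ω (sig m k ω)|} ∪ {T + 1})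

/-- The discretized integral `𝕊^m_t = ∑_k S_{σ^m_k} (S_{σ^m_{k+1} ∧ t} - S_{σ^m_k ∧ t})`. -/
def Sm (m : ℕ) (t : ℝ) (ω : Path T) : ℝ :=
  ∑' k : ℕ, ev T hT ω (sig T hT m k ω) *
    (ev T hT ω (min (sig T hT m (k + 1) ω) t) - ev T hT ω (min (sig T hT m k ω) t))

/-- The pathwise integral `𝕊_t = liminf_m 𝕊^m_t`. -/
def SS (t : ℝ) (ω : Path T) : ℝ := Filter.liminf (fun m => Sm T hT m t ω) Filter.atTop

/-- The candidate quadratic variation `S_t² - S_0² - 2 𝕊_t`. -/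
def qvRaw (ω : Path T) (t : ℝ) : ℝ := (ev T hT ω t) ^ 2 - (ev T hT ω 0) ^ 2 - 2 * SS T hT t ω

/-- The set `Ω` of paths for which `𝕊^m → 𝕊` uniformly and
`t ↦ S_t² - S_0² - 2𝕊_t` is nondecreasing. -/
def BigOmega : Set (Path T) :=
  {ω | TendstoUniformly (fun m (t : Set.Icc (0:ℝ) T) => Sm T hT m (t : ℝ) ω)
        (fun t => SS T hT (t : ℝ) ω) Filter.atTop ∧
      MonotoneOn (qvRaw T hT ω) (Set.Icc (0:ℝ) T)}

/-- The pathwise quadratic variation `⟨ω⟩`, as an element of `C[0,T]`; it equals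
`S² - S_0² - 2𝕊` for `ω ∈ Ω` (this function being continuous there) and `0` otherwise. -/
def qv (ω : Path T) : Path T :=
  if h : ω ∈ BigOmega T hT ∧ Continuous fun t : Set.Icc (0:ℝ) T => qvRaw T hT ω (t : ℝ)
  then ⟨fun t => qvRaw T hT ω (t : ℝ), h.2⟩ else 0

/-- The raw filtration `F_t = σ(S_s : s ≤ t)` generated by the canonical process. -/
def Fraw (t : ℝ) : MeasurableSpace (Path T) :=
  ⨆ (s : Set.Icc (0:ℝ) T) (_ : (s : ℝ) ≤ t),
    MeasurableSpace.comap (fun ω : Path T => ω s) inferInstance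

/-- The right-continuous filtration `F_{t+} = ⋂_{s > t} F_{s ∧ T}`. -/
def Fplus (t : ℝ) : MeasurableSpace (Path T) :=
  ⨅ (s : ℝ) (_ : t < s), Fraw T (min s T)

/-- `τ` is a stopping time for the raw filtration `𝔽`. -/
def IsStopRaw (τ : Path T → ℝ) : Prop :=
  ∀ t ∈ Set.Icc (0:ℝ) T, MeasurableSet[Fraw T t] {ω | τ ω ≤ t}

/-- `τ` is a stopping time for the right-continuous filtration `𝔽₊`. -/
def IsStopPlus (τ : Path T → ℝ) : Prop :=
  ∀ t ∈ Set.Icc (0:ℝ) T, MeasurableSet[Fplus T t] {ω | τ ω ≤ t}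

/-- `f` is measurable with respect to the σ-field `F_{τ+}`. -/
def MeasAtStopPlus (τ f : Path T → ℝ) : Prop :=
  ∀ B : Set ℝ, MeasurableSet B → ∀ t ∈ Set.Icc (0:ℝ) T,
    MeasurableSet[Fplus T t] (f ⁻¹' B ∩ {ω | τ ω ≤ t})

/-- The set `ℋ` of simple trading strategies `H = ∑_{l=1}^L h_l 1_{(τ_l, τ_{l+1}]}`
with `𝔽₊`-stopping times `0 ≤ τ_1 ≤ ⋯ ≤ τ_{L+1} ≤ T` and bounded `F_{τ_l+}`-measurable
coefficients `h_l`. -/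
structure SimpleStrategy where
  L : ℕ
  τ : Fin (L + 1) → Path T → ℝ
  coeff : Fin L → Path T → ℝ
  τ_nonneg : ∀ ω, 0 ≤ τ 0 ω
  τ_mono : ∀ (l : Fin L) (ω), τ l.castSucc ω ≤ τ l.succ ω
  τ_le : ∀ ω, τ (Fin.last L) ω ≤ T
  τ_stop : ∀ l, IsStopPlus T (τ l)
  coeff_bdd : ∀ l, ∃ C : ℝ, ∀ ω, |coeff l ω| ≤ C
  coeff_meas : ∀ l : Fin L, MeasAtStopPlus T (τ l.castSucc) (coeff l)

/-- The pathwise stochastic integral `(H · X)_t(ω)` of a simple strategy against a process. -/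
def integ (H : SimpleStrategy T) (X : ℝ → Path T → ℝ) (t : ℝ) (ω : Path T) : ℝ :=
  ∑ l : Fin H.L, H.coeff l ω *
    (X (min (H.τ l.succ ω) t) ω - X (min (H.τ l.castSucc ω) t) ω)

/-- The canonical process `S_t(ω) = ω(t)`. -/
def Sproc (t : ℝ) (ω : Path T) : ℝ := ev T hT ω t

/-- `X` is a `Q`-`𝔽`-martingale (on the time interval `[0,T]`). -/
def IsMart (Q : Measure (Path T)) (X : ℝ → Path T → ℝ) : Prop :=
  (∀ t ∈ Set.Icc (0:ℝ) T, Integrable (X t) Q) ∧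
  ∀ s t : ℝ, s ∈ Set.Icc (0:ℝ) T → t ∈ Set.Icc (0:ℝ) T → s ≤ t →
    ∀ A : Set (Path T), MeasurableSet[Fraw T s] A →
      ∫ ω in A, X t ω ∂Q = ∫ ω in A, X s ω ∂Q

/-- `X` is a `Q`-`𝔽`-local martingale: there are `𝔽`-stopping times increasing `Q`-a.s.
to `∞` such that each stopped process is a `Q`-`𝔽`-martingale. -/
def IsLocalMart (Q : Measure (Path T)) (X : ℝ → Path T → ℝ) : Prop :=
  ∃ τ : ℕ → Path T → ℝ,
    (∀ m, IsStopRaw T (τ m)) ∧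
    (∀ᵐ ω ∂Q, Monotone (fun m => τ m ω) ∧ Tendsto (fun m => τ m ω) atTop atTop) ∧
    (∀ m, IsMart T Q (fun t ω => X (min (τ m ω) t) ω))

/-- The set `M(Ξ)` of local martingale measures concentrated on `Ξ`. -/
def MSet (Ξ : Set (Path T)) : Set (Measure (Path T)) :=
  {Q | IsProbabilityMeasure Q ∧ IsLocalMart T Q (Sproc T hT) ∧ Q Ξ = 1}

/-- The set `M_Z(Ξ)` of local martingale measures concentrated on `Ξ` with `E_Q[Z] < ∞`. -/
def MZSet (Ξ : Set (Path T)) (Z : Path T → ℝ≥0∞) : Set (Measure (Path T)) :=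
  {Q | IsProbabilityMeasure Q ∧ IsLocalMart T Q (Sproc T hT) ∧ Q Ξ = 1 ∧
       ∫⁻ ω, Z ω ∂Q ≠ ⊤}

/-- The stopped path `ω^t(s) = ω(t ∧ s)`. -/
def stopPath (ω : Path T) (t : Set.Icc (0:ℝ) T) : Path T :=
  ⟨fun s => ω ⟨min t.1 s.1, le_min t.2.1 s.2.1, (min_le_left _ _).trans t.2.2⟩,
    ω.continuous.comp ((continuous_const.min continuous_subtype_val).subtype_mk _)⟩

/-- Assumption A on the prediction set `Ξ` and its lift `Ξ̄`. -/
structure AssumptionA (Ξ : Set (Path T)) (Xibar : Set (Path T × Path T)) : Prop where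
  xi_nonempty : Ξ.Nonempty
  xibar_nonempty : Xibar.Nonempty
  xi_eq : Ξ = {ω ∈ BigOmega T hT | (ω, qv T hT ω) ∈ Xibar}
  A1 : ∃ K : ℕ → Set (Path T × Path T), (∀ n, IsCompact (K n)) ∧ Xibar = ⋃ n, K n
  A2 : ∀ p ∈ Xibar, p.2 (t0 T hT) = 0 ∧ Monotone p.2
  A3 : ∀ p ∈ Xibar, ∀ t : Set.Icc (0:ℝ) T, (stopPath T p.1 t, stopPath T p.2 t) ∈ Xibar

/-! ### The enlarged space -/

/-- The enlarged space `Ω̄ = C[0,T] × C[0,T]`. -/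
abbrev PathPair (T : ℝ) := Path T × Path T

/-- The embedding `ψ(ω) = (ω, ⟨ω⟩)`. -/
def psiMap (ω : Path T) : PathPair T := (ω, qv T hT ω)

/-- The diagonal set `Δ̄ = ψ(Ω)`. -/
def Delta : Set (PathPair T) := psiMap T hT '' BigOmega T hT

/-- The first canonical process `S̄_t(ω,ν) = ω(t)` on the enlarged space. -/
def SbarProc (t : ℝ) (p : PathPair T) : ℝ := ev T hT p.1 t

/-- The second canonical process `V̄_t(ω,ν) = ν(t)` on the enlarged space. -/
def VbarProc (t : ℝ) (p : PathPair T) : ℝ := ev T hT p.2 t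

/-- The process `𝕊̄ = (S̄² - S̄_0² - V̄)/2` on the enlarged space. -/
def SSbarProc (t : ℝ) (p : PathPair T) : ℝ :=
  ((ev T hT p.1 t) ^ 2 - (ev T hT p.1 0) ^ 2 - ev T hT p.2 t) / 2

/-- The raw filtration `F̄_t = σ(S̄_s, V̄_s : s ≤ t)` on the enlarged space. -/
def FbarRaw (t : ℝ) : MeasurableSpace (PathPair T) :=
  ⨆ (s : Set.Icc (0:ℝ) T) (_ : (s : ℝ) ≤ t),
    MeasurableSpace.comap (fun p : PathPair T => (p.1 s, p.2 s)) inferInstance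

/-- The right-continuous filtration `F̄_{t+} = ⋂_{s>t} F̄_{s ∧ T}` on the enlarged space. -/
def FbarPlus (t : ℝ) : MeasurableSpace (PathPair T) :=
  ⨅ (s : ℝ) (_ : t < s), FbarRaw T (min s T)

/-- The σ-field generated by all subsets of `Δ̄ᶜ`. -/
def nullDelta : MeasurableSpace (PathPair T) :=
  MeasurableSpace.generateFrom {N : Set (PathPair T) | N ⊆ (Delta T hT)ᶜ}

/-- The `Δ̄`-augmented raw filtration `F̄^Δ_t`. -/
def FbarDelta (t : ℝ) : MeasurableSpace (PathPair T) := FbarRaw T t ⊔ nullDelta T hT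

/-- The `Δ̄`-augmented right-continuous filtration `F̄^Δ_{t+}`. -/
def FbarDeltaPlus (t : ℝ) : MeasurableSpace (PathPair T) := FbarPlus T t ⊔ nullDelta T hT

/-- `τ` is a stopping time for the raw filtration `𝔽̄` on the enlarged space. -/
def IsStopBarRaw (τ : PathPair T → ℝ) : Prop :=
  ∀ t ∈ Set.Icc (0:ℝ) T, MeasurableSet[FbarRaw T t] {p | τ p ≤ t}

/-- `τ` is a stopping time for the filtration `𝔽̄₊^Δ`. -/
def IsStopBarDeltaPlus (τ : PathPair T → ℝ) : Prop :=
  ∀ t ∈ Set.Icc (0:ℝ) T, MeasurableSet[FbarDeltaPlus T hT t] {p | τ p ≤ t}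

/-- `f` is measurable with respect to `F̄^Δ_{τ+}`. -/
def MeasAtStopBarDeltaPlus (τ f : PathPair T → ℝ) : Prop :=
  ∀ B : Set ℝ, MeasurableSet B → ∀ t ∈ Set.Icc (0:ℝ) T,
    MeasurableSet[FbarDeltaPlus T hT t] (f ⁻¹' B ∩ {p | τ p ≤ t})

/-- The set `ℋ̄` of simple strategies on the enlarged space. -/
structure SimpleStrategyBar where
  L : ℕ
  τ : Fin (L + 1) → PathPair T → ℝ
  coeff : Fin L → PathPair T → ℝ
  τ_nonneg : ∀ p, 0 ≤ τ 0 p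
  τ_mono : ∀ (l : Fin L) (p), τ l.castSucc p ≤ τ l.succ p
  τ_le : ∀ p, τ (Fin.last L) p ≤ T
  τ_stop : ∀ l, IsStopBarDeltaPlus T hT (τ l)
  coeff_bdd : ∀ l, ∃ C : ℝ, ∀ p, |coeff l p| ≤ C
  coeff_meas : ∀ l : Fin L, MeasAtStopBarDeltaPlus T hT (τ l.castSucc) (coeff l)

/-- The pathwise stochastic integral on the enlarged space. -/
def integBar (H : SimpleStrategyBar T hT) (X : ℝ → PathPair T → ℝ) (t : ℝ)
    (p : PathPair T) : ℝ :=
  ∑ l : Fin H.L, H.coeff l p *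
    (X (min (H.τ l.succ p) t) p - X (min (H.τ l.castSucc p) t) p)

/-- `X` is a `Q̄`-`𝔽̄`-martingale on the enlarged space. -/
def IsMartBar (Q : Measure (PathPair T)) (X : ℝ → PathPair T → ℝ) : Prop :=
  (∀ t ∈ Set.Icc (0:ℝ) T, Integrable (X t) Q) ∧
  ∀ s t : ℝ, s ∈ Set.Icc (0:ℝ) T → t ∈ Set.Icc (0:ℝ) T → s ≤ t →
    ∀ A : Set (PathPair T), MeasurableSet[FbarRaw T s] A →
      ∫ p in A, X t p ∂Q = ∫ p in A, X s p ∂Q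

/-- `X` is a `Q̄`-`𝔽̄`-local martingale on the enlarged space. -/
def IsLocalMartBar (Q : Measure (PathPair T)) (X : ℝ → PathPair T → ℝ) : Prop :=
  ∃ τ : ℕ → PathPair T → ℝ,
    (∀ m, IsStopBarRaw T (τ m)) ∧
    (∀ᵐ p ∂Q, Monotone (fun m => τ m p) ∧ Tendsto (fun m => τ m p) atTop atTop) ∧
    (∀ m, IsMartBar T Q (fun t p => X (min (τ m p) t) p))

/-- The set `M̄(Ξ̄)` of measures on the enlarged space under which `S̄` and `𝕊̄` are local
martingales and which are concentrated on `Ξ̄`. -/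
def MbarSet (Xibar : Set (PathPair T)) : Set (Measure (PathPair T)) :=
  {Q | IsProbabilityMeasure Q ∧ IsLocalMartBar T Q (SbarProc T hT) ∧
       IsLocalMartBar T Q (SSbarProc T hT) ∧ Q Xibar = 1}

/-- The set `M̄_{Z̄}(Ξ̄)`. -/
def MbarZSet (Xibar : Set (PathPair T)) (Zbar : PathPair T → ℝ≥0∞) :
    Set (Measure (PathPair T)) :=
  {Q | IsProbabilityMeasure Q ∧ IsLocalMartBar T Q (SbarProc T hT) ∧
       IsLocalMartBar T Q (SSbarProc T hT) ∧ Q Xibar = 1 ∧ ∫⁻ p, Zbar p ∂Q ≠ ⊤}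

/-! ### Expectations and superhedging functionals -/

/-- The positive part of an extended real number, as an element of `[0,∞]`. -/
def erealPos (x : EReal) : ℝ≥0∞ := if x = ⊤ then ⊤ else ENNReal.ofReal x.toReal

/-- The expectation `E_Q[ξ]` of an extended-real-valued random variable, as an
extended real number (positive part minus negative part). -/
def expEReal {α : Type*} [MeasurableSpace α] (Q : Measure α) (ξ : α → EReal) : EReal :=
  ((∫⁻ x, erealPos (ξ x) ∂Q : ℝ≥0∞) : EReal) - ((∫⁻ x, erealPos (-ξ x) ∂Q : ℝ≥0∞) : EReal)

/-- The set of initial capitals `λ` that allow superhedging `ξ` on `Ξ`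
(trading in `S` and `𝕊` with simple strategies, in the liminf sense). -/
def PhiSet (Ξ : Set (Path T)) (ξ : Path T → EReal) : Set ℝ :=
  {lam : ℝ | ∃ H G : ℕ → SimpleStrategy T,
    (∀ n : ℕ, ∀ t ∈ Set.Icc (0:ℝ) T, ∀ ω ∈ Ξ,
      0 ≤ lam + integ T (H n) (Sproc T hT) t ω + integ T (G n) (SS T hT) t ω) ∧
    (∀ ω ∈ Ξ, ξ ω ≤ (lam : EReal) +
      Filter.liminf (fun n =>
        ((integ T (H n) (Sproc T hT) T ω + integ T (G n) (SS T hT) T ω : ℝ) : EReal))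
        Filter.atTop)}

/-- The superhedging price `Φ(ξ)`. -/
def Phi (Ξ : Set (Path T)) (ξ : Path T → EReal) : EReal :=
  sInf ((fun lam : ℝ => (lam : EReal)) '' PhiSet T hT Ξ ξ)

/-- The supremum of the pricing functionals `E_Q[ξ]` over `Q ∈ M(Ξ)`,
for a nonnegative claim `ξ`. -/
def supMart (Ξ : Set (Path T)) (ξ : Path T → ℝ≥0∞) : ℝ≥0∞ :=
  ⨆ Q ∈ MSet T hT Ξ, ∫⁻ ω, ξ ω ∂Q

/-- The liminf-closure `𝒢^Ξ_λ`: the smallest set of functions `C[0,T] → [-∞,∞]`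
containing `λ + (H·S)_T` for admissible simple `H` and closed under countable liminf. -/
inductive GG (Ξ : Set (Path T)) (lam : ℝ) : (Path T → EReal) → Prop
  | base (H : SimpleStrategy T)
      (hadm : ∀ t ∈ Set.Icc (0:ℝ) T, ∀ ω ∈ Ξ, 0 ≤ lam + integ T H (Sproc T hT) t ω) :
      GG Ξ lam (fun ω => ((lam + integ T H (Sproc T hT) T ω : ℝ) : EReal))
  | lim (X : ℕ → Path T → EReal) (h : ∀ n, GG Ξ lam (X n)) :
      GG Ξ lam (fun ω => Filter.liminf (fun n => X n ω) Filter.atTop)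

/-- The superhedging price `Φ^cl(ξ)` defined via the liminf-closure. -/
def PhiCl (Ξ : Set (Path T)) (ξ : Path T → EReal) : EReal :=
  sInf {x : EReal | ∃ lam : ℝ, x = (lam : EReal) ∧
    ∃ Y : Path T → EReal, GG T hT Ξ lam Y ∧ ∀ ω ∈ Ξ, ξ ω ≤ Y ω}


/-- The set of initial capitals allowing superhedging on the enlarged space
(superhedging on `Δ̄ ∩ Ξ̄`). -/
def PhiBarSet (Xibar : Set (PathPair T)) (ξ : PathPair T → EReal) : Set ℝ :=
  {lam : ℝ | ∃ H G : ℕ → SimpleStrategyBar T hT,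
    (∀ n : ℕ, ∀ t ∈ Set.Icc (0:ℝ) T, ∀ p ∈ Delta T hT ∩ Xibar,
      0 ≤ lam + integBar T hT (H n) (SbarProc T hT) t p
            + integBar T hT (G n) (SSbarProc T hT) t p) ∧
    (∀ p ∈ Delta T hT ∩ Xibar, ξ p ≤ (lam : EReal) +
      Filter.liminf (fun n =>
        ((integBar T hT (H n) (SbarProc T hT) T p
          + integBar T hT (G n) (SSbarProc T hT) T p : ℝ) : EReal)) Filter.atTop)}

/-- The superhedging price `Φ̄(ξ̄)` on the enlarged space. -/
def PhiBar (Xibar : Set (PathPair T)) (ξ : PathPair T → EReal) : EReal :=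
  sInf ((fun lam : ℝ => (lam : EReal)) '' PhiBarSet T hT Xibar ξ)

/-- The supremum of pricing functionals over `M̄(Ξ̄)` for a nonnegative claim. -/
def supMartBar (Xibar : Set (PathPair T)) (ξ : PathPair T → ℝ≥0∞) : ℝ≥0∞ :=
  ⨆ Q ∈ MbarSet T hT Xibar, ∫⁻ p, ξ p ∂Q

/-- Assumption B on the prediction set `Ξ`, determined by a growth function `Z̄`
(with values in `[1,∞]`). -/
structure AssumptionB (Ξ : Set (Path T)) (Zbar : PathPair T → ℝ≥0∞) : Prop where
  xi_nonempty : Ξ.Nonempty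
  one_le : ∀ p, 1 ≤ Zbar p
  xi_eq : Ξ = {ω ∈ BigOmega T hT | Zbar (ω, qv T hT ω) ≠ ⊤}
  B1 : ∀ c : ℝ≥0∞, c ≠ ⊤ → IsCompact {p : PathPair T | Zbar p ≤ c}
  B2 : ∀ p : PathPair T, Zbar p ≠ ⊤ → p.2 (t0 T hT) = 0 ∧ Monotone p.2
  B3 : ∀ p : PathPair T, ENNReal.ofReal (‖p.1‖ + ‖p.2‖) ≤ Zbar p

/-- The set of initial capitals allowing `Z`-admissible superhedging of `ξ` on `Ξ`. -/
def PhiZSet (Ξ : Set (Path T)) (Z : Path T → ℝ≥0∞) (ξ : Path T → EReal) : Set ℝ :=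
  {lam : ℝ | ∃ c : ℝ, 0 ≤ c ∧ ∃ H G : ℕ → SimpleStrategy T,
    (∀ n : ℕ, ∀ ω ∈ Ξ,
      -(c * (Z ω).toReal) ≤
        lam + integ T (H n) (Sproc T hT) T ω + integ T (G n) (SS T hT) T ω) ∧
    (∀ ω ∈ Ξ, ξ ω ≤ (lam : EReal) +
      Filter.liminf (fun n =>
        ((integ T (H n) (Sproc T hT) T ω + integ T (G n) (SS T hT) T ω : ℝ) : EReal))
        Filter.atTop)}

/-- The superhedging price `Φ^Z(ξ)`. -/
def PhiZ (Ξ : Set (Path T)) (Z : Path T → ℝ≥0∞) (ξ : Path T → EReal) : EReal :=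
  sInf ((fun lam : ℝ => (lam : EReal)) '' PhiZSet T hT Ξ Z ξ)

/-- The `α`-Hölder norm `‖ω‖_α = |ω(0)| + sup_{s ≠ t} |ω(t) - ω(s)| / |t-s|^α`,
with values in `[0,∞]`. -/
def holderNormE (α : ℝ) (ω : Path T) : ℝ≥0∞ :=
  ENNReal.ofReal |ω (t0 T hT)| +
    ⨆ (s : Set.Icc (0:ℝ) T) (t : Set.Icc (0:ℝ) T) (_ : s ≠ t),
      ENNReal.ofReal (|ω t - ω s| / |t.1 - s.1| ^ α)

/-- The set of Hölder continuous paths `⋃_n { ω : ‖ω‖_{1/n} ≤ n }`. -/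
def CHolder : Set (Path T) :=
  ⋃ n : ℕ, {ω : Path T | 0 < n ∧ holderNormE T hT (1 / n) ω ≤ (n : ℝ≥0∞)}

end PathwiseSuperhedging

namespace PathwiseSuperhedging

set_option linter.unusedSectionVars false
set_option linter.deprecated false
set_option linter.unusedVariables false
set_option linter.style.longLine false

section Minimax

variable {E : Type*} [MetricSpace E] [MeasurableSpace E] [BorelSpace E]

def lscApp (f : E → ℝ≥0∞) (n : ℕ) (x : E) : ℝ≥0∞ := ⨅ y, min (f y) n + n * edist x y

lemma lscApp_cont (f : E → ℝ≥0∞) (n : ℕ) : Continuous (lscApp f n) := by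
  refine continuous_of_le_add_edist n (by simp) fun x y => ?_
  unfold lscApp
  rw [ENNReal.iInf_add]
  refine le_iInf fun z => (iInf_le _ z).trans ?_
  rw [add_assoc, ← mul_add]
  gcongr
  rw [add_comm]; exact edist_triangle _ _ _

lemma lscApp_le (f : E → ℝ≥0∞) (n : ℕ) (x : E) : lscApp f n x ≤ min (f x) n := by
  refine (iInf_le _ x).trans ?_
  simp

lemma lscApp_mono (f : E → ℝ≥0∞) : Monotone (lscApp f) := by
  intro m n hmn x
  refine iInf_mono fun y => ?_
  gcongr

lemma lscApp_sup {f : E → ℝ≥0∞} (hf : LowerSemicontinuous f) (x : E) :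
    ⨆ n, lscApp f n x = f x := by
  apply le_antisymm
  · exact iSup_le fun n => (lscApp_le f n x).trans (min_le_left _ _)
  · refine le_of_forall_lt fun c hc => ?_
    obtain ⟨d, hcd, hd⟩ := exists_between hc
    refine lt_of_lt_of_le hcd ?_
    have hdt : d ≠ ⊤ := (hd.trans_le le_top).ne
    obtain ⟨r, hr, hball⟩ := EMetric.mem_nhds_iff.1 (hf x d hd)
    obtain ⟨n1, hn1⟩ := ENNReal.exists_nat_gt hdt
    obtain ⟨n2, hn2⟩ := ENNReal.exists_nat_mul_gt hr.ne' hdt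
    refine le_iSup_of_le (max n1 n2) (le_iInf fun y => ?_)
    by_cases hy : edist x y < r
    · have : d < f y := hball (by rw [EMetric.mem_ball, edist_comm]; exact hy)
      refine le_add_right (le_min this.le (hn1.le.trans ?_))
      exact_mod_cast le_max_left _ _
    · push Not at hy
      refine le_add_left (hn2.le.trans ?_)
      gcongr
      exact le_max_right _ _

lemma isClosed_lintegral_le {f : E → ℝ≥0∞} (hf : LowerSemicontinuous f) (c : ℝ≥0∞) :
    IsClosed {Q : ProbabilityMeasure E | ∫⁻ x, f x ∂(Q : Measure E) ≤ c} := by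
  have hlt : ∀ n x, lscApp f n x ≠ ⊤ := fun n x =>
    (((lscApp_le f n x).trans (min_le_right _ _)).trans_lt (by simp)).ne
  have hb : ∀ n x, (lscApp f n x).toNNReal ≤ n := fun n x => by
    have := ((lscApp_le f n x).trans (min_le_right _ _))
    have h2 := ENNReal.toNNReal_mono (by simp) this
    simpa using h2
  let g : ℕ → BoundedContinuousFunction E NNReal := fun n =>
    BoundedContinuousFunction.mkOfBound
      ⟨fun x => (lscApp f n x).toNNReal, by
        rw [continuous_iff_continuousAt]
        exact fun x => (ENNReal.tendsto_toNNReal (hlt n x)).comp (lscApp_cont f n).continuousAt⟩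
      (n : ℝ) (fun x y => by
        rw [NNReal.dist_eq, abs_le]
        have h1 : ((lscApp f n x).toNNReal : ℝ) ≤ n := by exact_mod_cast hb n x
        have h2 : ((lscApp f n y).toNNReal : ℝ) ≤ n := by exact_mod_cast hb n y
        have h3 := (lscApp f n x).toNNReal.2
        have h4 := (lscApp f n y).toNNReal.2
        constructor
        · change -(n:ℝ) ≤ ((lscApp f n x).toNNReal : ℝ) - ((lscApp f n y).toNNReal : ℝ)
          linarith
        · change ((lscApp f n x).toNNReal : ℝ) - ((lscApp f n y).toNNReal : ℝ) ≤ n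
          linarith)
  have hg : ∀ n x, (g n x : ℝ≥0∞) = lscApp f n x := fun n x => ENNReal.coe_toNNReal (hlt n x)
  have : {Q : ProbabilityMeasure E | ∫⁻ x, f x ∂(Q : Measure E) ≤ c} =
      ⋂ n, {Q : ProbabilityMeasure E | ∫⁻ x, g n x ∂(Q : Measure E) ≤ c} := by
    ext Q
    simp only [mem_setOf_eq, mem_iInter]
    have h1 : ∫⁻ x, f x ∂(Q : Measure E) = ⨆ n, ∫⁻ x, g n x ∂(Q : Measure E) := by
      rw [← lintegral_iSup]
      · simp_rw [hg, lscApp_sup hf]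
      · intro n; simp_rw [hg]; exact (lscApp_cont f n).measurable
      · intro m n hmn x
        simp only [hg]
        exact lscApp_mono f hmn x
    rw [h1, iSup_le_iff]
  rw [this]
  refine isClosed_iInter fun n => isClosed_le ?_ continuous_const
  rw [continuous_iff_continuousAt]
  intro Q
  exact (ProbabilityMeasure.tendsto_iff_forall_lintegral_tendsto.1 tendsto_id) (g n)

/-- finite-dimensional separation: the convex combination step -/
lemma exists_finite_comb {D ι : Type*} [Nonempty D] [Fintype ι] (φ : ι → D → ℝ)
    (H : ∀ c : ι → ℝ, (∀ i, 0 ≤ c i) → ∑ i, c i = 1 → ∃ p, 0 < ∑ i, c i * φ i p) :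
    ∃ (κ : Type) (_ : Fintype κ) (w : κ → ℝ) (z : κ → D), (∀ k, 0 ≤ w k) ∧ ∑ k, w k = 1 ∧
      ∀ i, 0 ≤ ∑ k, w k * φ i (z k) := by
  let A : Set (ι → ℝ) := range fun p i => φ i p
  let P : Set (ι → ℝ) := {x | ∀ i, 0 < x i}
  have hPo : IsOpen P := by
    have : P = ⋂ i, {x | 0 < x i} := by ext; simp [P]
    rw [this]
    exact isOpen_iInter_of_finite fun i => isOpen_lt continuous_const (continuous_apply i)
  have hPc : Convex ℝ P := by
    intro x hx y hy a b ha hb hab i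
    have h1 := hx i; have h2 := hy i
    simp only [Pi.add_apply, Pi.smul_apply, smul_eq_mul]
    rcases ha.eq_or_lt with h | h
    · subst h; simp at hab; subst hab; simpa using h2
    · have := mul_pos h h1
      have := mul_nonneg hb h2.le
      linarith
  by_cases hd : Disjoint P (convexHull ℝ A)
  · exfalso
    obtain ⟨f, u, hf1, hf2⟩ := geometric_hahn_banach_open hPc hPo (convex_convexHull ℝ A) hd
    have hone : (fun _ => 1 : ι → ℝ) ∈ P := fun i => one_pos
    have hu : 0 ≤ u := by
      by_contra! hu
      have key : ∀ t : ℝ, 0 < t → t * f (fun _ => 1) < u := fun t ht => by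
        have := hf1 (t • (fun _ => 1 : ι → ℝ)) (fun i => by simpa using ht)
        simpa using this
      have h1 := key 1 one_pos
      have hneg : f (fun _ => 1) < 0 := by linarith
      have h2 := key (u / f (fun _ => 1)) (div_pos_of_neg_of_neg hu hneg)
      rw [div_mul_cancel₀ _ hneg.ne] at h2
      exact lt_irrefl _ h2
    have hc : ∀ i, f (Pi.single i 1) ≤ 0 := by
      intro i
      by_contra! hi
      set t := (|u - f (fun _ => 1)| + 1) / f (Pi.single i 1) with ht
      have htp : 0 < t := by positivity
      have := hf1 ((fun _ => 1 : ι → ℝ) + t • Pi.single i 1) (fun j => by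
        by_cases h : j = i
        · subst h; simp; positivity
        · simp [h])
      rw [map_add, map_smul, smul_eq_mul, ht, div_mul_cancel₀ _ hi.ne'] at this
      have := le_abs_self (u - f (fun _ => 1))
      linarith
    have hfx : ∀ x : ι → ℝ, f x = ∑ i, f (Pi.single i 1) * x i := by
      intro x
      conv_lhs => rw [← Finset.univ_sum_single x]
      rw [map_sum]
      refine Finset.sum_congr rfl fun i _ => ?_
      have : (Pi.single i (x i) : ι → ℝ) = x i • Pi.single i 1 := by
        rw [← Pi.single_smul, smul_eq_mul, mul_one]
      rw [this, map_smul, smul_eq_mul, mul_comm]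
    have hA : ∀ p, u ≤ ∑ i, f (Pi.single i 1) * φ i p := fun p => by
      rw [← hfx]
      exact hf2 _ (subset_convexHull ℝ A ⟨p, rfl⟩)
    set s := ∑ i, -f (Pi.single i 1) with hs
    have hs0 : 0 ≤ s := Finset.sum_nonneg fun i _ => by linarith [hc i]
    rcases hs0.eq_or_lt with h0 | hpos
    · have hz : ∀ i, f (Pi.single i 1) = 0 := by
        have := (Finset.sum_eq_zero_iff_of_nonneg (fun i _ => by linarith [hc i])).1 h0.symm
        intro i
        have := this i (Finset.mem_univ i)
        linarith
      have h1 := hf1 _ hone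
      rw [hfx] at h1
      have h2 := hA (Classical.arbitrary D)
      simp [hz] at h1 h2
      linarith
    · obtain ⟨p, hp⟩ := H (fun i => -f (Pi.single i 1) / s)
        (fun i => div_nonneg (by linarith [hc i]) hs0)
        (by rw [← Finset.sum_div, ← hs, div_self hpos.ne'])
      have h2 := hA p
      have : ∑ i, -f (Pi.single i 1) / s * φ i p = -(∑ i, f (Pi.single i 1) * φ i p) / s := by
        rw [← Finset.sum_neg_distrib, Finset.sum_div]
        refine Finset.sum_congr rfl fun i _ => by ring
      rw [this] at hp
      have := (div_pos_iff_of_pos_right hpos).1 hp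
      linarith
  · rw [Set.not_disjoint_iff] at hd
    obtain ⟨x, hx, hxA⟩ := hd
    rw [mem_convexHull_iff_exists_fintype] at hxA
    obtain ⟨κ, hκ, w, z, hw, hw1, hz, hxz⟩ := hxA
    choose q hq using hz
    refine ⟨κ, hκ, w, q, hw, hw1, fun i => ?_⟩
    have := congrFun hxz i
    rw [Finset.sum_apply] at this
    simp only [Pi.smul_apply, smul_eq_mul] at this
    have h3 : ∑ k, w k * φ i (q k) = x i := by
      rw [← this]
      refine Finset.sum_congr rfl fun k _ => ?_
      rw [← hq k]
    rw [h3]; exact (hx i).le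

end Minimax

section Minimax2

variable {E : Type*} [MetricSpace E] [MeasurableSpace E] [BorelSpace E]

lemma lsc_of_compact {Z : E → ℝ≥0∞} (hZc : ∀ c : ℝ≥0∞, c ≠ ⊤ → IsCompact {p | Z p ≤ c}) :
    LowerSemicontinuous Z := by
  rw [lowerSemicontinuous_iff_isClosed_preimage]
  intro c
  by_cases hc : c = ⊤
  · subst hc; simp
  · exact (hZc c hc).isClosed

lemma minimax {Z : E → ℝ≥0∞} (hZc : ∀ c : ℝ≥0∞, c ≠ ⊤ → IsCompact {p | Z p ≤ c})
    {η : E → ℝ} {C : ℝ} (hη : ∀ p, |η p| ≤ C) (husc : UpperSemicontinuous η)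
    (L : Submodule ℝ (BoundedContinuousFunction E ℝ)) {ε : ℝ} (hε : 0 < ε) (a : ℝ)
    (H : ∀ ℓ ∈ L, ∃ p, Z p ≠ ⊤ ∧ a < η p - ε * (Z p).toReal - ℓ p) :
    ∃ Q : Measure E, IsProbabilityMeasure Q ∧ ∫⁻ p, Z p ∂Q ≠ ⊤ ∧
      (∀ ℓ ∈ L, ∫ p, ℓ p ∂Q = 0) ∧ a ≤ ∫ p, η p ∂Q := by
  have hZl : LowerSemicontinuous Z := lsc_of_compact hZc
  let Φ : BoundedContinuousFunction E ℝ → E → ℝ≥0∞ := fun ℓ p =>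
    ENNReal.ofReal ε * Z p + ENNReal.ofReal (C - η p + (ℓ p + ‖ℓ‖))
  have hnn : ∀ (ℓ : BoundedContinuousFunction E ℝ) p, 0 ≤ ℓ p + ‖ℓ‖ := fun ℓ p => by
    have := (abs_le.1 (ℓ.norm_coe_le_norm p)).1; linarith
  have hnC : ∀ p, 0 ≤ C - η p := fun p => by linarith [(abs_le.1 (hη p)).2]
  have hΦ : ∀ ℓ, LowerSemicontinuous (Φ ℓ) := by
    intro ℓ
    refine LowerSemicontinuous.add ?_ ?_
    · exact (ENNReal.continuous_const_mul (by simp)).comp_lowerSemicontinuous hZl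
        (fun x y h => mul_le_mul_right h _)
    · refine ENNReal.continuous_ofReal.comp_lowerSemicontinuous ?_ ENNReal.ofReal_mono
      refine LowerSemicontinuous.add ?_ (ℓ.continuous.add continuous_const).lowerSemicontinuous
      intro x y hy
      have := husc x (C - y) (by linarith)
      filter_upwards [this] with z hz
      linarith
  let K : BoundedContinuousFunction E ℝ → Set (ProbabilityMeasure E) := fun ℓ =>
    {Q | ∫⁻ x, Φ ℓ x ∂(Q : Measure E) ≤ ENNReal.ofReal (C - a + ‖ℓ‖)}
  have hKcl : ∀ ℓ, IsClosed (K ℓ) := fun ℓ => isClosed_lintegral_le (hΦ ℓ) _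
  have hZint : ∀ ℓ, ∀ Q ∈ K ℓ, ∫⁻ p, Z p ∂(Q : Measure E) ≤
      ENNReal.ofReal (C - a + ‖ℓ‖) / ENNReal.ofReal ε := by
    intro ℓ Q hQ
    rw [ENNReal.le_div_iff_mul_le (by simp [hε]) (by simp), mul_comm,
      ← lintegral_const_mul _ hZl.measurable]
    exact (lintegral_mono fun p => le_self_add).trans hQ
  have hK0 : IsCompact (K 0) := by
    set B := ENNReal.ofReal (C - a + ‖(0 : BoundedContinuousFunction E ℝ)‖) / ENNReal.ofReal ε
      with hBdef
    have hB : B ≠ ⊤ := ENNReal.div_ne_top (by simp) (by simp [hε])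
    refine IsCompact.of_isClosed_subset
      (isCompact_setOfPred_probabilityMeasure_mass_eq_compl_isCompact_le (E := E)
        (u := fun n => B.toNNReal * ((n:NNReal) + 1)⁻¹) (K := fun n => {p | Z p ≤ (n:ℝ≥0∞) + 1}) ?_ ?_ ?_) (hKcl 0) ?_
    · have h1 : Tendsto (fun n : ℕ => ((n : NNReal) + 1)⁻¹) atTop (𝓝 0) := by
        rw [← NNReal.tendsto_coe]
        simpa using tendsto_one_div_add_atTop_nhds_zero_nat (𝕜 := ℝ)
      simpa using h1.const_mul B.toNNReal
    · exact fun n => hZc _ (by simp)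
    · left; infer_instance
    · intro Q hQ n
      have h1 := hZint 0 Q hQ
      have h2 := meas_ge_le_lintegral_div (μ := (Q : Measure E)) (f := Z)
        hZl.measurable.aemeasurable (ε := (n:ℝ≥0∞) + 1) (by simp) (by simp)
      have h3 : ((B.toNNReal * ((n:NNReal) + 1)⁻¹ : NNReal) : ℝ≥0∞) = B / ((n:ℝ≥0∞) + 1) := by
        rw [ENNReal.coe_mul, ENNReal.coe_toNNReal hB, ENNReal.coe_inv (by positivity),
          div_eq_mul_inv]
        simp
      rw [← ENNReal.coe_le_coe, h3, ProbabilityMeasure.ennreal_coeFn_eq_coeFn_toMeasure]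
      refine (measure_mono ?_).trans (h2.trans (ENNReal.div_le_div_right h1 _))
      intro p hp
      simp only [mem_compl_iff, mem_setOf_eq, not_le] at hp ⊢
      exact hp.le
  have hfin : (K 0 ∩ ⋂ ℓ : L, K ℓ).Nonempty := by
    refine hK0.inter_iInter_nonempty _ (fun ℓ => hKcl ℓ) fun F => ?_
    obtain ⟨p0, hp0, -⟩ := H 0 L.zero_mem
    let D := {p : E // Z p ≠ ⊤}
    haveI : Nonempty D := ⟨⟨p0, hp0⟩⟩
    let F' : Finset L := insert 0 F
    obtain ⟨κ, hκ, w, z, hw, hw1, hz⟩ := exists_finite_comb (D := D) (ι := F')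
      (fun ℓ p => η p.1 - ε * (Z p.1).toReal - (ℓ.1.1 : BoundedContinuousFunction E ℝ) p.1 - a) (by
        intro c hc hc1
        obtain ⟨p, hp, hap⟩ := H (∑ i : F', c i • (i.1.1 : BoundedContinuousFunction E ℝ))
          (L.sum_mem fun i _ => L.smul_mem _ i.1.2)
        refine ⟨⟨p, hp⟩, ?_⟩
        have h2 : (∑ i : F', c i • (i.1.1 : BoundedContinuousFunction E ℝ)) p
            = ∑ i : F', c i * (i.1.1 : BoundedContinuousFunction E ℝ) p := by
          rw [BoundedContinuousFunction.coe_sum, Finset.sum_apply]; rfl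
        rw [h2] at hap
        have h3 : ∑ i : F', c i * (η p - ε * (Z p).toReal - (i.1.1 : BoundedContinuousFunction E ℝ) p - a)
            = (η p - ε * (Z p).toReal - a) - ∑ i : F', c i * (i.1.1 : BoundedContinuousFunction E ℝ) p := by
          rw [← one_mul (η p - ε * (Z p).toReal - a), ← hc1, Finset.sum_mul, ← Finset.sum_sub_distrib]
          refine Finset.sum_congr rfl fun i _ => by ring
        rw [h3]; linarith)
    let Qm : Measure E := ∑ k, ENNReal.ofReal (w k) • Measure.dirac (z k).1
    have hQm : IsProbabilityMeasure Qm := ⟨by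
      simp only [Qm, Measure.coe_finset_sum, Finset.sum_apply, Measure.smul_apply, smul_eq_mul]
      simp only [measure_univ, mul_one]
      rw [← ENNReal.ofReal_sum_of_nonneg (fun k _ => hw k), hw1, ENNReal.ofReal_one]⟩
    have hmem : ∀ ℓ ∈ F', (⟨Qm, hQm⟩ : ProbabilityMeasure E) ∈ K ℓ.1 := by
      intro ℓ hℓ
      have h1 := hz ⟨ℓ, hℓ⟩
      change ∫⁻ x, Φ ℓ.1 x ∂Qm ≤ _
      rw [lintegral_finset_sum_measure]
      have h2 : ∀ k, ∫⁻ x, Φ ℓ.1 x ∂(ENNReal.ofReal (w k) • Measure.dirac (z k).1) =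
          ENNReal.ofReal (w k * (ε * (Z (z k).1).toReal + (C - η (z k).1 + (ℓ.1 (z k).1 + ‖ℓ.1‖)))) := by
        intro k
        rw [lintegral_smul_measure, lintegral_dirac' _ (hΦ ℓ.1).measurable, smul_eq_mul]
        have hzk := (z k).2
        have e1 := hnn ℓ.1 (z k).1
        have e2 := hnC (z k).1
        rw [ENNReal.ofReal_mul (hw k), ENNReal.ofReal_add (by positivity) (by positivity),
          ENNReal.ofReal_mul hε.le, ENNReal.ofReal_toReal hzk]
      simp_rw [h2]
      rw [← ENNReal.ofReal_sum_of_nonneg (fun k _ => ?_)]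
      · apply ENNReal.ofReal_le_ofReal
        have h3 : ∑ k, w k * (ε * (Z (z k).1).toReal + (C - η (z k).1 + (ℓ.1 (z k).1 + ‖ℓ.1‖)))
          = (C - a + ‖ℓ.1‖) - ∑ k, w k * (η (z k).1 - ε * (Z (z k).1).toReal - ℓ.1 (z k).1 - a) := by
          rw [← one_mul (C - a + ‖ℓ.1‖), ← hw1, Finset.sum_mul, ← Finset.sum_sub_distrib]
          refine Finset.sum_congr rfl fun i _ => by ring
        rw [h3]; linarith
      · have e1 := hnn ℓ.1 (z k).1
        have e2 := hnC (z k).1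
        have e3 := hw k
        positivity
    refine ⟨(⟨Qm, hQm⟩ : ProbabilityMeasure E), ?_, ?_⟩
    · exact hmem 0 (Finset.mem_insert_self _ _)
    · refine mem_iInter₂.2 ?_
      exact fun ℓ hℓ => hmem ℓ (Finset.mem_insert_of_mem hℓ)
  obtain ⟨Q, hQ0, hQ⟩ := hfin
  rw [mem_iInter] at hQ
  have hZt : ∫⁻ p, Z p ∂(Q : Measure E) ≠ ⊤ :=
    ((hZint 0 Q hQ0).trans_lt (ENNReal.div_lt_top (by simp) (by simp [hε]))).ne
  have hZi : Integrable (fun p => (Z p).toReal) (Q : Measure E) :=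
    integrable_toReal_of_lintegral_ne_top hZl.measurable.aemeasurable hZt
  have hZae : ∀ᵐ p ∂(Q : Measure E), Z p ≠ ⊤ :=
    (ae_lt_top hZl.measurable hZt).mono fun p hp => hp.ne
  have hηi : Integrable η (Q : Measure E) :=
    Integrable.of_bound husc.measurable.aestronglyMeasurable C
      (Eventually.of_forall fun p => hη p)
  have hℓi : ∀ ℓ : BoundedContinuousFunction E ℝ, Integrable ℓ (Q : Measure E) := fun ℓ =>
    ℓ.integrable _
  have key : ∀ ℓ ∈ L, ε * ∫ p, (Z p).toReal ∂(Q : Measure E) + a + ∫ p, ℓ p ∂(Q : Measure E)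
      ≤ ∫ p, η p ∂(Q : Measure E) := by
    intro ℓ hℓ
    have h1 : ∫⁻ x, Φ ℓ x ∂(Q : Measure E) ≤ _ := hQ ⟨ℓ, hℓ⟩
    have h2 : ∫⁻ x, Φ ℓ x ∂(Q : Measure E) = ENNReal.ofReal
        (∫ p, (ε * (Z p).toReal + (C - η p + (ℓ p + ‖ℓ‖))) ∂(Q : Measure E)) := by
      rw [ofReal_integral_eq_lintegral_ofReal]
      · refine lintegral_congr_ae (hZae.mono fun p hp => ?_)
        have e1 := hnn ℓ p
        have e2 := hnC p
        simp only [Φ]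
        rw [ENNReal.ofReal_add (p := ε * (Z p).toReal) (by positivity) (by positivity),
          ENNReal.ofReal_mul hε.le, ENNReal.ofReal_toReal hp]
      · exact (hZi.const_mul ε).add (((integrable_const C).sub hηi).add
          ((hℓi ℓ).add (integrable_const _)))
      · refine Eventually.of_forall fun p => ?_
        have e1 := hnn ℓ p
        have e2 := hnC p
        simp only [Pi.zero_apply]
        positivity
    rw [h2] at h1
    have h3 : ∫ p, (ε * (Z p).toReal + (C - η p + (ℓ p + ‖ℓ‖))) ∂(Q : Measure E) =
        ε * ∫ p, (Z p).toReal ∂(Q : Measure E) + (C - ∫ p, η p ∂(Q : Measure E)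
          + (∫ p, ℓ p ∂(Q : Measure E) + ‖ℓ‖)) := by
      have i1 : Integrable (fun p => ℓ p + ‖ℓ‖) (Q : Measure E) := (hℓi ℓ).add (integrable_const _)
      have i2 : Integrable (fun p => C - η p) (Q : Measure E) := (integrable_const C).sub hηi
      have i3 : Integrable (fun p => C - η p + (ℓ p + ‖ℓ‖)) (Q : Measure E) := i2.add i1
      rw [integral_add (hZi.const_mul ε) i3, integral_add i2 i1,
        integral_sub (integrable_const C) hηi,
        integral_add (hℓi ℓ) (integrable_const _), integral_const_mul]
      simp
    rw [h3] at h1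
    by_cases hpos : 0 ≤ C - a + ‖ℓ‖
    · rw [ENNReal.ofReal_le_ofReal_iff hpos] at h1
      linarith
    · exfalso
      obtain ⟨p, hp, hap⟩ := H ℓ hℓ
      have e1 := hnn ℓ p
      have e2 := hnC p
      have e3 : 0 ≤ ε * (Z p).toReal := by positivity
      linarith
  have hZ0 : 0 ≤ ∫ p, (Z p).toReal ∂(Q : Measure E) := integral_nonneg fun p => ENNReal.toReal_nonneg
  refine ⟨Q, inferInstance, hZt, fun ℓ hℓ => ?_, ?_⟩
  · have hs : ∀ t : ℝ, ε * ∫ p, (Z p).toReal ∂(Q : Measure E) + a + t * ∫ p, ℓ p ∂(Q : Measure E)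
      ≤ ∫ p, η p ∂(Q : Measure E) := fun t => by
      have := key (t • ℓ) (L.smul_mem t hℓ)
      simpa [integral_const_mul] using this
    by_contra hne
    set I := ∫ p, ℓ p ∂(Q : Measure E)
    have := hs ((|∫ p, η p ∂(Q : Measure E) - (ε * ∫ p, (Z p).toReal ∂(Q : Measure E) + a)| + 1) / I)
    rw [div_mul_cancel₀ _ hne] at this
    have := le_abs_self (∫ p, η p ∂(Q : Measure E) - (ε * ∫ p, (Z p).toReal ∂(Q : Measure E) + a))
    linarith
  · have := key 0 L.zero_mem
    simp at this
    have h5 : 0 ≤ ε * ∫ p, (Z p).toReal ∂(Q : Measure E) := by positivity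
    linarith

end Minimax2

section PathBasics

variable {T : ℝ} (hT : 0 ≤ T)

lemma clamp_val (t : ℝ) : ((clamp T hT t : Icc (0:ℝ) T) : ℝ) = max 0 (min T t) := rfl

lemma clamp_of_mem {t : ℝ} (h : t ∈ Icc (0:ℝ) T) : clamp T hT t = ⟨t, h⟩ := projIcc_of_mem hT h

lemma clamp_coe (t : Icc (0:ℝ) T) : clamp T hT t = t := projIcc_val hT t

lemma ev_coe (ω : Path T) (t : Icc (0:ℝ) T) : ev T hT ω t = ω t := by
  rw [ev, clamp_coe]

lemma clamp_cont : Continuous (clamp T hT) := continuous_projIcc (h := hT)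

lemma ev_cont : Continuous fun x : Path T × ℝ => ev T hT x.1 x.2 := by
  unfold ev
  exact ContinuousEval.continuous_eval.comp
    (continuous_fst.prodMk ((clamp_cont hT).comp continuous_snd))

lemma ev_cont_t (ω : Path T) : Continuous (ev T hT ω) :=
  (ev_cont hT).comp (Continuous.prodMk_right ω)

lemma ev_cont_p (t : ℝ) : Continuous fun ω : Path T => ev T hT ω t :=
  (ev_cont hT).comp (Continuous.prodMk_left t)

lemma path_ext {ω ω' : Path T} (h : ∀ t ∈ Icc (0:ℝ) T, ev T hT ω t = ev T hT ω' t) : ω = ω' := by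
  ext t
  rw [← ev_coe hT, ← ev_coe hT, h t t.2]

lemma ev_ge (ω : Path T) {t : ℝ} (h : T ≤ t) : ev T hT ω t = ev T hT ω T := by
  unfold ev
  congr 1
  ext
  simp [clamp_val, h]

lemma ev_abs_le (ω : Path T) (t : ℝ) : |ev T hT ω t| ≤ ‖ω‖ := ω.norm_coe_le_norm _

/-- path stopped at a real time -/
def sp (ω : Path T) (t : ℝ) : Path T := stopPath T ω (clamp T hT t)

lemma ev_sp (ω : Path T) (t s : ℝ) : ev T hT (sp hT ω t) s = ev T hT ω (min s t) := by
  unfold ev sp stopPath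
  simp only [ContinuousMap.coe_mk]
  congr 1
  ext
  simp only [clamp_val]
  grind

lemma sp_sp (ω : Path T) (t s : ℝ) : sp hT (sp hT ω t) s = sp hT ω (min s t) := by
  refine path_ext hT fun u _ => ?_
  simp only [ev_sp]
  congr 1
  grind

lemma sp_ge (ω : Path T) {t : ℝ} (h : T ≤ t) : sp hT ω t = ω := by
  refine path_ext hT fun u hu => ?_
  rw [ev_sp, min_eq_left (hu.2.trans h)]

lemma sp_cont : Continuous fun x : Path T × ℝ => sp hT x.1 x.2 := by
  apply ContinuousMap.continuous_of_continuous_uncurry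
  have : (Function.uncurry fun (x : Path T × ℝ) (y : Icc (0:ℝ) T) => (sp hT x.1 x.2) y) =
      fun z : (Path T × ℝ) × Icc (0:ℝ) T => ev T hT z.1.1 (min (z.2 : ℝ) z.1.2) := by
    ext z
    rw [← ev_sp, ev_coe]
    rfl
  rw [this]
  exact (ev_cont hT).comp ((continuous_fst.comp continuous_fst).prodMk
    ((continuous_subtype_val.comp continuous_snd).min (continuous_snd.comp continuous_fst)))

lemma norm_le_iff (ω : Path T) {c : ℝ} (hc : 0 ≤ c) :
    ‖ω‖ ≤ c ↔ ∀ t ∈ Icc (0:ℝ) T, |ev T hT ω t| ≤ c := by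
  rw [ContinuousMap.norm_le _ hc]
  constructor
  · intro h t ht; exact h _
  · intro h t; rw [← ev_coe hT]; exact h t t.2

lemma sp_norm_mono (ω : Path T) {s t : ℝ} (h : s ≤ t) : ‖sp hT ω s‖ ≤ ‖sp hT ω t‖ := by
  rw [norm_le_iff hT _ (norm_nonneg _)]
  intro u _
  have : sp hT ω s = sp hT (sp hT ω t) s := by rw [sp_sp, min_eq_left h]
  rw [this, ev_sp]
  exact ev_abs_le hT _ _

lemma ev_le_sp (ω : Path T) (t : ℝ) : |ev T hT ω t| ≤ ‖sp hT ω t‖ := by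
  have : ev T hT ω t = ev T hT (sp hT ω t) t := by rw [ev_sp, min_self]
  rw [this]; exact ev_abs_le hT _ _

/-- measurability into path space is tested by evaluations -/
lemma measurable_path {α : Type*} {m : MeasurableSpace α} {f : α → Path T}
    (h : ∀ t : Icc (0:ℝ) T, Measurable fun a => f a t) : Measurable f := by
  have hball : ∀ (g : Path T) (q : ℝ), 0 ≤ q → MeasurableSet (f ⁻¹' Metric.closedBall g q) := by
    intro g q hq
    obtain ⟨D, hDc, hDd⟩ := TopologicalSpace.exists_countable_dense (Icc (0:ℝ) T)
    have : f ⁻¹' Metric.closedBall g q = ⋂ t ∈ D, {a | |f a t - g t| ≤ q} := by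
      ext a
      simp only [mem_preimage, Metric.mem_closedBall, mem_iInter, mem_setOf_eq]
      rw [ContinuousMap.dist_le hq]
      constructor
      · intro h t _; exact h t
      · intro h t
        have hcl : IsClosed {t | |f a t - g t| ≤ q} :=
          isClosed_le (by fun_prop) continuous_const
        have := hcl.closure_subset_iff.2 (fun t ht => h t ht : D ⊆ _)
        exact this (hDd t)
    rw [this]
    refine MeasurableSet.biInter hDc fun t _ => ?_
    exact measurableSet_le ((h t).sub_const _).abs measurable_const
  refine measurable_of_isOpen fun W hW => ?_
  let d := TopologicalSpace.denseSeq (Path T)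
  have : f ⁻¹' W = ⋃ (i : ℕ × ℚ) (_ : 0 ≤ (i.2 : ℝ) ∧ Metric.closedBall (d i.1) i.2 ⊆ W),
      f ⁻¹' Metric.closedBall (d i.1) (i.2 : ℝ) := by
    ext a
    simp only [mem_preimage, mem_iUnion, exists_prop]
    constructor
    · intro ha
      obtain ⟨ε, hε, hb⟩ := Metric.isOpen_iff.1 hW _ ha
      obtain ⟨hx, hxd⟩ := (TopologicalSpace.denseRange_denseSeq (Path T)).exists_dist_lt (f a)
        (show 0 < ε / 4 by positivity)
      obtain ⟨q, hq1, hq2⟩ := exists_rat_btwn (show dist (f a) (d hx) < ε / 2 by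
        have : dist (f a) (d hx) < ε / 4 := hxd
        linarith)
      refine ⟨(hx, q), ⟨(dist_nonneg.trans hq1.le), ?_⟩, hq1.le⟩
      intro z hz
      apply hb
      rw [Metric.mem_closedBall] at hz
      rw [Metric.mem_ball]
      calc dist z (f a) ≤ dist z (d hx) + dist (f a) (d hx) := dist_triangle_right _ _ _
        _ < ε := by simp only at hz; linarith
    · rintro ⟨i, ⟨_, hi⟩, ha⟩
      exact hi ha
  rw [this]
  exact MeasurableSet.iUnion fun i => MeasurableSet.iUnion fun hi => hball _ _ hi.1

/-- stopped pair -/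
def stp (p : PathPair T) (t : ℝ) : PathPair T := (sp hT p.1 t, sp hT p.2 t)

lemma stp_cont : Continuous fun x : PathPair T × ℝ => stp hT x.1 x.2 :=
  ((sp_cont hT).comp ((continuous_fst.comp continuous_fst).prodMk continuous_snd)).prodMk
  ((sp_cont hT).comp ((continuous_snd.comp continuous_fst).prodMk continuous_snd))

lemma stp_cont_p (t : ℝ) : Continuous fun p : PathPair T => stp hT p t :=
  (stp_cont hT).comp (Continuous.prodMk_left t)

lemma stp_stp (p : PathPair T) (t s : ℝ) : stp hT (stp hT p t) s = stp hT p (min s t) := by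
  simp [stp, sp_sp]

lemma stp_ge (p : PathPair T) {t : ℝ} (h : T ≤ t) : stp hT p t = p := by
  simp [stp, sp_ge hT _ h]

/-- running size -/
def UU (p : PathPair T) (t : ℝ) : ℝ := ‖sp hT p.1 t‖ + ‖sp hT p.2 t‖

lemma UU_cont : Continuous fun x : PathPair T × ℝ => UU hT x.1 x.2 := by
  unfold UU
  exact ((sp_cont hT).comp ((continuous_fst.comp continuous_fst).prodMk continuous_snd)).norm.add
    ((sp_cont hT).comp ((continuous_snd.comp continuous_fst).prodMk continuous_snd)).norm

lemma UU_cont_t (p : PathPair T) : Continuous (UU hT p) := by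
  have h : Continuous fun t : ℝ => (p, t) := by fun_prop
  have := (UU_cont hT).comp h
  exact this

lemma UU_mono (p : PathPair T) : Monotone (UU hT p) := fun s t h =>
  add_le_add (sp_norm_mono hT _ h) (sp_norm_mono hT _ h)

lemma UU_stp (p : PathPair T) (t s : ℝ) : UU hT (stp hT p t) s = UU hT p (min s t) := by
  simp [UU, stp, sp_sp]

lemma ev1_le_UU (p : PathPair T) (t : ℝ) : |ev T hT p.1 t| ≤ UU hT p t :=
  (ev_le_sp hT _ _).trans (le_add_of_nonneg_right (norm_nonneg _))

lemma ev2_le_UU (p : PathPair T) (t : ℝ) : |ev T hT p.2 t| ≤ UU hT p t :=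
  (ev_le_sp hT _ _).trans (le_add_of_nonneg_left (norm_nonneg _))

lemma UU_le_norm (p : PathPair T) (t : ℝ) : UU hT p t ≤ ‖p.1‖ + ‖p.2‖ := by
  have h := UU_mono hT p (le_max_left t T)
  refine h.trans ?_
  rw [UU, sp_ge hT _ (le_max_right _ _), sp_ge hT _ (le_max_right _ _)]

lemma sp_sub (ω ω' : Path T) (t : ℝ) : sp hT ω t - sp hT ω' t = sp hT (ω - ω') t := by
  ext u; rfl

lemma UU_sub_le (p q : PathPair T) (t : ℝ) : |UU hT p t - UU hT q t| ≤ 2 * dist p q := by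
  have h1 : ∀ ω ω' : Path T, |‖sp hT ω t‖ - ‖sp hT ω' t‖| ≤ dist ω ω' := by
    intro ω ω'
    refine (abs_norm_sub_norm_le _ _).trans ?_
    rw [sp_sub, dist_eq_norm]
    refine (sp_norm_mono hT (ω - ω') (le_max_left t T)).trans ?_
    rw [sp_ge hT _ (le_max_right _ _)]
  have h2 := h1 p.1 q.1
  have h3 := h1 p.2 q.2
  have h4 : dist p.1 q.1 ≤ dist p q := le_max_left _ _
  have h5 : dist p.2 q.2 ≤ dist p q := le_max_right _ _
  unfold UU
  rw [abs_le] at *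
  constructor <;> linarith [h2.1, h2.2, h3.1, h3.2]

end PathBasics

section Sig

variable {T : ℝ} (hT : 0 ≤ T)

lemma dl_pos (m : ℕ) : (0:ℝ) < (2:ℝ) ^ (-(m:ℤ)) := by positivity

/-- the hitting set -/
def hs (m : ℕ) (ω : Path T) (σ : ℝ) : Set ℝ :=
  {t : ℝ | σ ≤ t ∧ t ≤ T ∧ (2:ℝ) ^ (-(m:ℤ)) ≤ |ev T hT ω t - ev T hT ω σ|}

lemma sig_succ (m k : ℕ) (ω : Path T) :
    sig T hT m (k + 1) ω = sInf (hs hT m ω (sig T hT m k ω) ∪ {T + 1}) := rfl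

lemma hs_closed (m : ℕ) (ω : Path T) (σ : ℝ) : IsClosed (hs hT m ω σ ∪ {T + 1}) := by
  refine IsClosed.union ?_ isClosed_singleton
  have : hs hT m ω σ = {t | σ ≤ t} ∩ {t | t ≤ T} ∩
      {t | (2:ℝ) ^ (-(m:ℤ)) ≤ |ev T hT ω t - ev T hT ω σ|} := by
    ext t; simp [hs, and_assoc]
  rw [this]
  have := ev_cont_t hT ω
  exact ((isClosed_le continuous_const continuous_id).inter
    (isClosed_le continuous_id continuous_const)).inter
    (isClosed_le continuous_const (by fun_prop))

lemma hs_bdd (m : ℕ) (ω : Path T) (σ : ℝ) : BddBelow (hs hT m ω σ ∪ {T + 1}) := by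
  refine ⟨min σ (T + 1), ?_⟩
  rintro t (ht | ht)
  · exact (min_le_left _ _).trans ht.1
  · exact (min_le_right _ _).trans (le_of_eq ht.symm)

lemma sig_succ_mem (m k : ℕ) (ω : Path T) :
    sig T hT m (k + 1) ω ∈ hs hT m ω (sig T hT m k ω) ∪ {T + 1} :=
  (hs_closed hT m ω _).csInf_mem ⟨T + 1, Or.inr rfl⟩ (hs_bdd hT m ω _)

lemma sig_succ_le {m k : ℕ} {ω : Path T} {t : ℝ} (h : t ∈ hs hT m ω (sig T hT m k ω)) :
    sig T hT m (k + 1) ω ≤ t := csInf_le (hs_bdd hT m ω _) (Or.inl h)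

lemma sig_le (m k : ℕ) (ω : Path T) : sig T hT m k ω ≤ T + 1 := by
  cases k with
  | zero => simp only [sig]; linarith
  | succ k => exact csInf_le (hs_bdd hT m ω _) (Or.inr rfl)

lemma sig_le_succ (m k : ℕ) (ω : Path T) : sig T hT m k ω ≤ sig T hT m (k + 1) ω := by
  rcases sig_succ_mem hT m k ω with h | h
  · exact h.1
  · rw [mem_singleton_iff.1 h]; exact sig_le hT m k ω

lemma sig_mono (m : ℕ) (ω : Path T) : Monotone fun k => sig T hT m k ω :=
  monotone_nat_of_le_succ fun k => sig_le_succ hT m k ω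

lemma sig_nonneg (m k : ℕ) (ω : Path T) : 0 ≤ sig T hT m k ω :=
  sig_mono hT m ω (Nat.zero_le k)

lemma sig_eq_or_le (m k : ℕ) (ω : Path T) : sig T hT m k ω = T + 1 ∨ sig T hT m k ω ≤ T := by
  cases k with
  | zero => right; simpa only [sig] using hT
  | succ k =>
    rcases sig_succ_mem hT m k ω with h | h
    · exact Or.inr h.2.1
    · exact Or.inl h

lemma sig_osc {m k : ℕ} {ω : Path T} {u : ℝ} (h1 : sig T hT m k ω ≤ u)
    (h2 : u ≤ sig T hT m (k + 1) ω) (h3 : u ≤ T) :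
    |ev T hT ω u - ev T hT ω (sig T hT m k ω)| ≤ (2:ℝ) ^ (-(m:ℤ)) := by
  have hlt : ∀ v, sig T hT m k ω ≤ v → v < sig T hT m (k + 1) ω → v ≤ T →
      |ev T hT ω v - ev T hT ω (sig T hT m k ω)| < (2:ℝ) ^ (-(m:ℤ)) := by
    intro v hv1 hv2 hv3
    by_contra! hc
    exact absurd (sig_succ_le hT ⟨hv1, hv3, hc⟩) (not_le.2 hv2)
  rcases h1.eq_or_lt with h | h
  · rw [← h]; simp [(dl_pos m).le]
  · have hcl : IsClosed {v | |ev T hT ω v - ev T hT ω (sig T hT m k ω)| ≤ (2:ℝ) ^ (-(m:ℤ))} := by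
      have := ev_cont_t hT ω
      exact isClosed_le (by fun_prop) continuous_const
    have hsub : Ioo (sig T hT m k ω) u ⊆
        {v | |ev T hT ω v - ev T hT ω (sig T hT m k ω)| ≤ (2:ℝ) ^ (-(m:ℤ))} := fun v hv =>
      (hlt v hv.1.le (hv.2.trans_le h2) (hv.2.le.trans h3)).le
    have := hcl.closure_subset_iff.2 hsub
    rw [closure_Ioo h.ne] at this
    exact this ⟨h1, le_rfl⟩

lemma sig_eventually (m : ℕ) (ω : Path T) : ∃ N, ∀ k, N ≤ k → sig T hT m k ω = T + 1 := by
  obtain ⟨η, hη, hu⟩ := Metric.uniformContinuous_iff.1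
    (CompactSpace.uniformContinuous_of_continuous ω.continuous) _ (dl_pos m)
  have step : ∀ k, sig T hT m k ω = T + 1 ∨ k * η ≤ sig T hT m k ω := by
    intro k
    induction k with
    | zero => right; simp [sig]
    | succ k ih =>
      rcases sig_succ_mem hT m k ω with h | h
      · right
        have hk : sig T hT m k ω ≤ T := h.1.trans h.2.1
        rcases ih with ih | ih
        · linarith
        · have h0 := sig_nonneg hT m k ω
          have h0' := sig_nonneg hT m (k+1) ω
          by_contra! hc
          push_cast at hc
          have h3 := h.2.2
          rw [ev, ev, clamp_of_mem hT ⟨h0, hk⟩, clamp_of_mem hT ⟨h0', h.2.1⟩] at h3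
          have h4 := hu (a := ⟨_, h0', h.2.1⟩) (b := ⟨_, h0, hk⟩) (by
            rw [Subtype.dist_eq, Real.dist_eq, abs_of_nonneg (by linarith [h.1])]
            simp only
            linarith)
          rw [Real.dist_eq] at h4
          linarith
      · exact Or.inl h
  obtain ⟨N, hN⟩ := exists_nat_gt (T / η)
  refine ⟨N, fun k hk => ?_⟩
  rcases step k with h | h
  · exact h
  · rcases sig_eq_or_le hT m k ω with h' | h'
    · exact h'
    · exfalso
      rw [div_lt_iff₀ hη] at hN
      have : (N:ℝ) * η ≤ k * η := by gcongr
      linarith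

lemma sig_sp (m k : ℕ) (ω : Path T) {s : ℝ} (hs0 : s ∈ Icc (0:ℝ) T) :
    sig T hT m k (sp hT ω s) = if sig T hT m k ω ≤ s then sig T hT m k ω else T + 1 := by
  induction k with
  | zero => simp [sig, hs0.1]
  | succ k ih =>
    have hle := sig_le_succ hT m k ω
    by_cases hk : sig T hT m k ω ≤ s
    · rw [if_pos hk] at ih
      have key : ∀ t, t ∈ hs hT m (sp hT ω s) (sig T hT m k (sp hT ω s)) →
          min t s ∈ hs hT m ω (sig T hT m k ω) := by
        intro t ht
        rw [ih] at ht
        obtain ⟨h1, h2, h3⟩ := ht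
        rw [ev_sp, ev_sp, min_eq_left hk] at h3
        exact ⟨le_min h1 hk, (min_le_left _ _).trans h2, h3⟩
      split_ifs with h
      · apply le_antisymm
        · apply sig_succ_le
          rw [ih]
          rcases sig_succ_mem hT m k ω with h' | h'
          · refine ⟨h'.1, h'.2.1, ?_⟩
            rw [ev_sp, ev_sp, min_eq_left hk, min_eq_left h]
            exact h'.2.2
          · rw [mem_singleton_iff.1 h'] at h; linarith [hs0.2]
        · rcases sig_succ_mem hT m k (sp hT ω s) with h' | h'
          · exact (sig_succ_le hT (key _ h')).trans (min_le_left _ _)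
          · rw [mem_singleton_iff.1 h']; exact sig_le hT _ _ _
      · rcases sig_succ_mem hT m k (sp hT ω s) with h' | h'
        · exact absurd ((sig_succ_le hT (key _ h')).trans (min_le_right _ _)) h
        · exact h'
    · rw [if_neg hk] at ih
      rw [if_neg (fun h => hk (hle.trans h))]
      have h1 := sig_le_succ hT m k (sp hT ω s)
      have h2 := sig_le hT m (k+1) (sp hT ω s)
      linarith

/-- summand of `Sm` -/
def smT (m k : ℕ) (t : ℝ) (ω : Path T) : ℝ := ev T hT ω (sig T hT m k ω) *
    (ev T hT ω (min (sig T hT m (k + 1) ω) t) - ev T hT ω (min (sig T hT m k ω) t))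

lemma smT_zero_of_le {m k : ℕ} {t : ℝ} {ω : Path T} (h : t ≤ sig T hT m k ω) :
    smT hT m k t ω = 0 := by
  unfold smT
  rw [min_eq_right h, min_eq_right (h.trans (sig_le_succ hT m k ω))]; simp

lemma smT_zero_of_eq {m k : ℕ} {t : ℝ} {ω : Path T} (h : sig T hT m k ω = T + 1) :
    smT hT m k t ω = 0 := by
  unfold smT
  have h1 := sig_le_succ hT m k ω
  have h2 := sig_le hT m (k+1) ω
  have : sig T hT m (k+1) ω = T + 1 := by linarith
  rw [this, h]; simp

lemma Sm_eq_sum {m N : ℕ} {ω : Path T} (hN : ∀ k, N ≤ k → sig T hT m k ω = T + 1) (t : ℝ) :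
    Sm T hT m t ω = ∑ k ∈ Finset.range N, smT hT m k t ω := by
  unfold Sm
  refine tsum_eq_sum (s := Finset.range N) fun k hk => ?_
  exact smT_zero_of_eq hT (hN k (by simpa using hk))

lemma Sm_tendsto (m : ℕ) (t : ℝ) (ω : Path T) :
    Tendsto (fun J => ∑ k ∈ Finset.range J, smT hT m k t ω) atTop (𝓝 (Sm T hT m t ω)) := by
  obtain ⟨N, hN⟩ := sig_eventually hT m ω
  refine tendsto_const_nhds.congr' ?_
  filter_upwards [eventually_ge_atTop N] with J hJ
  exact Sm_eq_sum hT (fun k hk => hN k (hJ.trans hk)) t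

lemma Sm_partial (m J : ℕ) (t : ℝ) (ω : Path T) :
    ∑ k ∈ Finset.range J, smT hT m k t ω = Sm T hT m (min t (sig T hT m J ω)) ω := by
  unfold Sm
  symm
  rw [tsum_eq_sum (s := Finset.range J)]
  · refine Finset.sum_congr rfl fun k hk => ?_
    have h1 : sig T hT m (k+1) ω ≤ sig T hT m J ω := sig_mono hT m ω (Finset.mem_range.1 hk)
    have h2 := sig_le_succ hT m k ω
    unfold smT
    congr 3 <;> grind
  · intro k hk
    have h1 : sig T hT m J ω ≤ sig T hT m k ω := sig_mono hT m ω (by simpa using hk)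
    exact smT_zero_of_le hT ((min_le_right _ _).trans h1)

lemma Sm_sp (m : ℕ) (t : ℝ) (ω : Path T) {s : ℝ} (hs0 : s ∈ Icc (0:ℝ) T) :
    Sm T hT m t (sp hT ω s) = Sm T hT m (min t s) ω := by
  unfold Sm
  refine tsum_congr fun k => ?_
  have h2 := sig_le_succ hT m k ω
  simp only [sig_sp hT m _ ω hs0, ev_sp]
  by_cases hk : sig T hT m k ω ≤ s
  · simp only [if_pos hk]
    rw [min_eq_left hk]
    have hs1 := hs0.2
    congr 3
    · split_ifs <;> grind
    · grind
  · have h3 : ¬ sig T hT m (k+1) ω ≤ s := fun h => hk (h2.trans h)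
    simp only [if_neg hk, if_neg h3]
    have e1 : min (sig T hT m (k+1) ω) (min t s) = min t s := by grind
    have e2 : min (sig T hT m k ω) (min t s) = min t s := by grind
    rw [e1, e2]; simp

lemma Sm_cont (m : ℕ) (ω : Path T) : Continuous fun t => Sm T hT m t ω := by
  obtain ⟨N, hN⟩ := sig_eventually hT m ω
  simp_rw [Sm_eq_sum hT hN]
  have := ev_cont_t hT ω
  unfold smT
  fun_prop

lemma Sm_zero (m : ℕ) (ω : Path T) : Sm T hT m 0 ω = 0 := by
  have h : ∀ k, smT hT m k 0 ω = 0 := fun k => smT_zero_of_le hT (sig_nonneg hT m k ω)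
  change ∑' k, smT hT m k 0 ω = 0
  simp [h]

lemma smT_sq (m k : ℕ) (t : ℝ) (ω : Path T) : 2 * smT hT m k t ω =
    ev T hT ω (min (sig T hT m (k + 1) ω) t) ^ 2 - ev T hT ω (min (sig T hT m k ω) t) ^ 2 -
    (ev T hT ω (min (sig T hT m (k + 1) ω) t) - ev T hT ω (min (sig T hT m k ω) t)) ^ 2 := by
  by_cases h : sig T hT m k ω ≤ t
  · unfold smT
    rw [min_eq_left h]; ring
  · push Not at h
    rw [smT_zero_of_le hT h.le, min_eq_right h.le,
      min_eq_right (h.le.trans (sig_le_succ hT m k ω))]; ring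

lemma Sm_sq (m J : ℕ) {t : ℝ} (ht : 0 ≤ t) (ω : Path T) :
    ev T hT ω (min t (sig T hT m J ω)) ^ 2 - ev T hT ω 0 ^ 2
      - 2 * Sm T hT m (min t (sig T hT m J ω)) ω =
    ∑ k ∈ Finset.range J,
      (ev T hT ω (min (sig T hT m (k + 1) ω) t) - ev T hT ω (min (sig T hT m k ω) t)) ^ 2 := by
  rw [← Sm_partial, Finset.mul_sum]
  simp_rw [smT_sq]
  rw [Finset.sum_sub_distrib, Finset.sum_range_sub (fun k => ev T hT ω (min (sig T hT m k ω) t) ^ 2),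
    min_comm t]
  simp only [sig, min_eq_left ht]
  ring

lemma sig_measurable (m k : ℕ) : Measurable (sig T hT m k) := by
  induction k with
  | zero => exact measurable_const
  | succ k ih =>
    let g : Path T × ℝ → ℝ := fun x => sInf ({t : ℝ | t ∈ Icc 0 T ∧ x.2 ≤ t ∧
        (2:ℝ) ^ (-(m:ℤ)) ≤ |ev T hT x.1 t - ev T hT x.1 x.2|} ∪ {T + 1})
    have hbd : ∀ x : Path T × ℝ, BddBelow ({t : ℝ | t ∈ Icc 0 T ∧ x.2 ≤ t ∧
        (2:ℝ) ^ (-(m:ℤ)) ≤ |ev T hT x.1 t - ev T hT x.1 x.2|} ∪ {T + 1}) := fun x => by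
      refine ⟨0, ?_⟩
      rintro t (h | h)
      · exact h.1.1
      · rw [mem_singleton_iff.1 h]; linarith
    have hcl : ∀ x : Path T × ℝ, IsClosed ({t : ℝ | t ∈ Icc 0 T ∧ x.2 ≤ t ∧
        (2:ℝ) ^ (-(m:ℤ)) ≤ |ev T hT x.1 t - ev T hT x.1 x.2|} ∪ {T + 1}) := fun x => by
      refine IsClosed.union ?_ isClosed_singleton
      have h1 := ev_cont_t hT x.1
      have h2 : Continuous fun t => |ev T hT x.1 t - ev T hT x.1 x.2| := (h1.sub continuous_const).abs
      exact IsClosed.and isClosed_Icc (IsClosed.and (isClosed_le continuous_const continuous_id)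
        (isClosed_le continuous_const h2))
    have hg : LowerSemicontinuous g := by
      rw [lowerSemicontinuous_iff_isClosed_preimage]
      intro c
      by_cases hc : T + 1 ≤ c
      · convert isClosed_univ
        ext x
        simp only [mem_preimage, mem_Iic, mem_univ, iff_true]
        exact (csInf_le (hbd x) (Or.inr rfl)).trans hc
      · have : g ⁻¹' Iic c = Prod.snd '' {y : Icc (0:ℝ) T × (Path T × ℝ) | y.2.2 ≤ y.1 ∧
            (2:ℝ) ^ (-(m:ℤ)) ≤ |ev T hT y.2.1 y.1 - ev T hT y.2.1 y.2.2| ∧ (y.1 : ℝ) ≤ c} := by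
          ext x
          simp only [mem_preimage, mem_Iic, mem_image, mem_setOf_eq, Prod.exists,
            exists_eq_right, Prod.mk.eta]
          constructor
          · intro h
            rcases (hcl x).csInf_mem ⟨T + 1, Or.inr rfl⟩ (hbd x) with h' | h'
            · exact ⟨⟨g x, h'.1⟩, h'.2.1, h'.2.2, h⟩
            · exact absurd (le_of_eq_of_le (mem_singleton_iff.1 h').symm h) hc
          · rintro ⟨t, h1, h2, h3⟩
            exact (csInf_le (hbd _) (Or.inl ⟨t.2, h1, h2⟩)).trans h3
        rw [this]
        refine isClosedMap_snd_of_compactSpace _ ?_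
        have e1 : Continuous fun y : Icc (0:ℝ) T × (Path T × ℝ) => ev T hT y.2.1 y.1 :=
          (ev_cont hT).comp ((continuous_fst.comp continuous_snd).prodMk
            (continuous_subtype_val.comp continuous_fst))
        have e2 : Continuous fun y : Icc (0:ℝ) T × (Path T × ℝ) => ev T hT y.2.1 y.2.2 :=
          (ev_cont hT).comp continuous_snd
        have e3 : Continuous fun y : Icc (0:ℝ) T × (Path T × ℝ) => y.2.2 := by fun_prop
        have e4 : Continuous fun y : Icc (0:ℝ) T × (Path T × ℝ) => (y.1 : ℝ) := by fun_prop
        exact IsClosed.and (isClosed_le e3 e4)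
          (IsClosed.and (isClosed_le continuous_const (e1.sub e2).abs)
          (isClosed_le e4 continuous_const))
    have : sig T hT m (k+1) = fun ω => g (ω, sig T hT m k ω) := by
      ext ω
      rw [sig_succ]
      simp only [g]
      congr 2
      ext t
      simp only [hs, mem_setOf_eq, mem_Icc]
      have := sig_nonneg hT m k ω
      constructor
      · rintro ⟨h1, h2, h3⟩; exact ⟨⟨this.trans h1, h2⟩, h1, h3⟩
      · rintro ⟨⟨h0, h2⟩, h1, h3⟩; exact ⟨h1, h2, h3⟩
    rw [this]
    exact hg.measurable.comp (measurable_id.prodMk ih)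

lemma ev_meas {α : Type*} {mα : MeasurableSpace α} {f : α → Path T} {τ : α → ℝ} (hf : Measurable f)
    (hτ : Measurable τ) : Measurable fun a => ev T hT (f a) (τ a) :=
  (ev_cont hT).measurable.comp (hf.prodMk hτ)

lemma Sm_measurable (m : ℕ) (t : ℝ) : Measurable (Sm T hT m t) := by
  refine measurable_of_tendsto_metrizable (f := fun J ω => ∑ k ∈ Finset.range J, smT hT m k t ω) ?_
    (tendsto_pi_nhds.2 fun ω => Sm_tendsto hT m t ω)
  intro J
  refine Finset.measurable_sum _ fun k _ => ?_
  have h1 := sig_measurable hT m k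
  have h2 := sig_measurable hT m (k+1)
  exact (ev_meas hT measurable_id h1).mul ((ev_meas hT measurable_id (h2.min measurable_const)).sub
    (ev_meas hT measurable_id (h1.min measurable_const)))

end Sig

section BO

variable {T : ℝ} (hT : 0 ≤ T)

/-- `Sm` as a path -/
def SmP (m : ℕ) (ω : Path T) : Path T :=
  ⟨fun t => Sm T hT m t ω, (Sm_cont hT m ω).comp continuous_subtype_val⟩

lemma ev_mk {f : Icc (0:ℝ) T → ℝ} (hf : Continuous f) {t : ℝ} (ht : t ∈ Icc (0:ℝ) T) :
    ev T hT (⟨f, hf⟩ : Path T) t = f ⟨t, ht⟩ := by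
  unfold ev; rw [clamp_of_mem hT ht]; rfl

lemma ev_SmP (m : ℕ) (ω : Path T) {t : ℝ} (ht : t ∈ Icc (0:ℝ) T) :
    ev T hT (SmP hT m ω) t = Sm T hT m t ω := by
  unfold SmP; rw [ev_mk hT _ ht]

/-- the candidate integral -/
def half (p : PathPair T) : Path T :=
  ⟨fun t => (p.1 t ^ 2 - p.1 (t0 T hT) ^ 2 - p.2 t) / 2, by fun_prop⟩

lemma ev_half (p : PathPair T) {t : ℝ} (ht : t ∈ Icc (0:ℝ) T) :
    ev T hT (half hT p) t = (ev T hT p.1 t ^ 2 - ev T hT p.1 0 ^ 2 - ev T hT p.2 t) / 2 := by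
  unfold half; rw [ev_mk hT _ ht]
  have : clamp T hT 0 = t0 T hT := clamp_of_mem hT ⟨le_rfl, hT⟩
  unfold ev; rw [clamp_of_mem hT ht, this]

/-- the pair `(ω, V)` is good -/
def BO (p : PathPair T) : Prop :=
  Monotone p.2 ∧ Tendsto (fun m => SmP hT m p.1) atTop (𝓝 (half hT p))

lemma BO.SS {p : PathPair T} (h : BO hT p) {t : ℝ} (ht : t ∈ Icc (0:ℝ) T) :
    SS T hT t p.1 = (ev T hT p.1 t ^ 2 - ev T hT p.1 0 ^ 2 - ev T hT p.2 t) / 2 := by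
  rw [← ev_half hT p ht]
  unfold PathwiseSuperhedging.SS
  refine Tendsto.liminf_eq ?_
  have := ((ev_cont_p hT t).tendsto _).comp h.2
  refine this.congr fun m => ?_
  simp [ev_SmP hT m p.1 ht]

lemma BO.qvRaw {p : PathPair T} (h : BO hT p) {t : ℝ} (ht : t ∈ Icc (0:ℝ) T) :
    qvRaw T hT p.1 t = ev T hT p.2 t := by
  unfold PathwiseSuperhedging.qvRaw
  rw [h.SS hT ht]; ring

lemma BO.mem {p : PathPair T} (h : BO hT p) : p.1 ∈ BigOmega T hT := by
  refine ⟨?_, ?_⟩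
  · have h2 := ContinuousMap.tendsto_iff_tendstoUniformly.1 h.2
    have : (fun t : Icc (0:ℝ) T => PathwiseSuperhedging.SS T hT (t : ℝ) p.1) = half hT p := by
      ext t
      rw [h.SS hT t.2, ← ev_half hT p t.2, ev_coe]
    rw [this]
    exact h2
  · intro s hs t ht hst
    rw [h.qvRaw hT hs, h.qvRaw hT ht]
    unfold ev
    exact h.1 (by rw [clamp_of_mem hT hs, clamp_of_mem hT ht]; exact hst)

lemma BO.qv {p : PathPair T} (h : BO hT p) : qv T hT p.1 = p.2 := by
  have e : (fun t : Icc (0:ℝ) T => PathwiseSuperhedging.qvRaw T hT p.1 (t : ℝ)) = p.2 := by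
    ext t
    rw [h.qvRaw hT t.2, ev_coe]
  have hc : p.1 ∈ BigOmega T hT ∧
      Continuous fun t : Icc (0:ℝ) T => PathwiseSuperhedging.qvRaw T hT p.1 (t : ℝ) :=
    ⟨h.mem hT, by rw [e]; exact p.2.continuous⟩
  unfold PathwiseSuperhedging.qv
  rw [dif_pos hc]
  ext t
  exact congrFun e t

lemma BO_of_mem {ω : Path T} (h : ω ∈ BigOmega T hT) : BO hT (ω, qv T hT ω) := by
  have hc : Continuous fun t : Icc (0:ℝ) T => SS T hT (t : ℝ) ω :=
    h.1.continuous (Frequently.of_forall fun m => (SmP hT m ω).continuous)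
  have hq : Continuous fun t : Icc (0:ℝ) T => qvRaw T hT ω (t : ℝ) := by
    unfold qvRaw
    have := (ev_cont_t hT ω).comp (continuous_subtype_val (p := fun t => t ∈ Icc (0:ℝ) T))
    have h3 : Continuous fun t : Icc (0:ℝ) T => ev T hT ω (t : ℝ) := this
    fun_prop
  have e : qv T hT ω = ⟨fun t => qvRaw T hT ω (t : ℝ), hq⟩ := by
    unfold qv; rw [dif_pos ⟨h, hq⟩]
  rw [e]
  refine ⟨fun s t hst => h.2 s.2 t.2 hst, ?_⟩
  rw [ContinuousMap.tendsto_iff_tendstoUniformly]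
  have e2 : ⇑(half hT (ω, ⟨fun t => qvRaw T hT ω (t : ℝ), hq⟩)) =
      fun t : Icc (0:ℝ) T => SS T hT (t : ℝ) ω := by
   ext t
   rw [← ev_coe hT, ev_half hT _ t.2]
   simp only [ev_mk hT hq t.2]
   unfold qvRaw
   ring
  rw [e2]
  exact h.1

lemma ev_mono {V : Path T} (h : Monotone V) : Monotone (ev T hT V) := by
  intro s t hst
  unfold ev
  exact h (monotone_projIcc hT hst)

lemma BO_sp {p : PathPair T} (h : BO hT p) {s : ℝ} (hs : s ∈ Icc (0:ℝ) T) : BO hT (stp hT p s) := by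
  refine ⟨?_, ?_⟩
  · intro u v huv
    show sp hT p.2 s u ≤ sp hT p.2 s v
    rw [← ev_coe hT, ← ev_coe hT, ev_sp, ev_sp]
    exact ev_mono hT h.1 (min_le_min_right _ huv)
  · have := (((sp_cont hT).comp (Continuous.prodMk_left s)).tendsto _).comp h.2
    have e : half hT (stp hT p s) = sp hT (half hT p) s := by
      refine path_ext hT fun t ht => ?_
      rw [ev_half hT _ ht, ev_sp, ev_half hT _ ⟨le_min ht.1 hs.1, (min_le_left _ _).trans ht.2⟩]
      simp only [stp, ev_sp, min_eq_left hs.1]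
    rw [e]
    refine this.congr fun m => ?_
    refine path_ext hT fun t ht => ?_
    simp only [Function.comp, ev_sp]
    rw [ev_SmP hT _ _ ⟨le_min ht.1 hs.1, (min_le_left _ _).trans ht.2⟩, ev_SmP hT _ _ ht]
    exact (Sm_sp hT m t p.1 hs).symm

lemma psi_sp {ω : Path T} (h : ω ∈ BigOmega T hT) {s : ℝ} (hs : s ∈ Icc (0:ℝ) T) :
    ((sp hT ω s, qv T hT (sp hT ω s)) : PathPair T) = stp hT (ω, qv T hT ω) s := by
  have := (BO_sp hT (BO_of_mem hT h) hs).qv hT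
  simp only [stp] at this ⊢
  rw [this]

lemma SmP_measurable (m : ℕ) : Measurable (SmP hT m) :=
  measurable_path fun t => Sm_measurable hT m t

lemma BO_measurable : MeasurableSet (BigOmega T hT) ∧ Measurable (qv T hT) := by
  let C : Set (Path T) := {ω | ∃ l, Tendsto (fun m => SmP hT m ω) atTop (𝓝 l)}
  have hC : MeasurableSet C := measurableSet_exists_tendsto (SmP_measurable hT)
  let f : Path T → Path T := fun ω => if h : ω ∈ C then h.choose else 0
  have hf : Measurable f := by
    refine measurable_of_tendsto_metrizable (f := fun m => C.indicator (SmP hT m))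
      (fun m => (SmP_measurable hT m).indicator hC) (tendsto_pi_nhds.2 fun ω => ?_)
    by_cases h : ω ∈ C
    · simp only [f, dif_pos h, indicator_of_mem h]
      exact h.choose_spec
    · simp only [f, dif_neg h, indicator_of_notMem h]
      exact tendsto_const_nhds
  let V : Path T → Path T := fun ω =>
    ω ^ 2 - ContinuousMap.const _ (ω (t0 T hT) ^ 2) - (2:ℝ) • f ω
  have hV : Measurable V := by
    refine measurable_path fun t => ?_
    have h1 : Measurable fun ω : Path T => ω t := (ContinuousEvalConst.continuous_eval_const t).measurable
    have h2 : Measurable fun ω : Path T => ω (t0 T hT) := (ContinuousEvalConst.continuous_eval_const _).measurable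
    have h3 : Measurable fun ω : Path T => f ω t := (ContinuousEvalConst.continuous_eval_const t).measurable.comp hf
    simp only [V]
    exact ((h1.pow_const 2).sub (h2.pow_const 2)).sub (h3.const_mul 2)
  have hM : IsClosed {v : Path T | Monotone v} := by
    have : {v : Path T | Monotone v} = ⋂ (s) (t) (_ : s ≤ t), {v : Path T | v s ≤ v t} := by
      ext v; simp only [Monotone, mem_setOf_eq, mem_iInter]
    rw [this]
    exact isClosed_iInter fun s => isClosed_iInter fun t => isClosed_iInter fun _ =>
      isClosed_le (ContinuousEvalConst.continuous_eval_const s)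
        (ContinuousEvalConst.continuous_eval_const t)
  have hhalf : ∀ ω, half hT (ω, V ω) = f ω := by
    intro ω; ext t; simp [half, V]
  have key : BigOmega T hT = C ∩ V ⁻¹' {v | Monotone v} := by
    ext ω
    constructor
    · intro h
      have hb := BO_of_mem hT h
      have hc : ω ∈ C := ⟨_, hb.2⟩
      have e : f ω = half hT (ω, qv T hT ω) := by
        simp only [f, dif_pos hc]
        exact tendsto_nhds_unique hc.choose_spec hb.2
      refine ⟨hc, ?_⟩
      have e2 : V ω = qv T hT ω := by
        ext t; simp only [V, e, half]; simp; ring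
      show Monotone (V ω)
      rw [e2]; exact hb.1
    · rintro ⟨hc, hv⟩
      have : BO hT (ω, V ω) := by
        refine ⟨hv, ?_⟩
        rw [hhalf]
        simp only [f, dif_pos hc]
        exact hc.choose_spec
      exact this.mem hT
  have hBm : MeasurableSet (BigOmega T hT) := by
    rw [key]; exact hC.inter (hV hM.measurableSet)
  refine ⟨hBm, ?_⟩
  have : qv T hT = (BigOmega T hT).indicator V := by
    ext1 ω
    by_cases h : ω ∈ BigOmega T hT
    · rw [indicator_of_mem h]
      rw [key] at h
      have : BO hT (ω, V ω) := by
        refine ⟨h.2, ?_⟩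
        rw [hhalf]
        simp only [f, dif_pos h.1]
        exact h.1.choose_spec
      exact this.qv hT
    · rw [indicator_of_notMem h]
      unfold qv
      rw [dif_neg (fun h' => h h'.1)]
  rw [this]
  exact hV.indicator hBm

/-- the embedding -/
def ps (ω : Path T) : PathPair T := (ω, qv T hT ω)

lemma ps_measurable : Measurable (ps hT) := measurable_id.prodMk (BO_measurable hT).2

lemma ps_sp {ω : Path T} (h : ω ∈ BigOmega T hT) {s : ℝ} (hs : s ∈ Icc (0:ℝ) T) :
    ps hT (sp hT ω s) = stp hT (ps hT ω) s := psi_sp hT h hs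

lemma sp_Fraw {s : ℝ} (hs : s ∈ Icc (0:ℝ) T) : Measurable[Fraw T s] fun ω : Path T => sp hT ω s := by
  refine measurable_path (m := Fraw T s) fun t => ?_
  have e : (fun ω : Path T => sp hT ω s t) = fun ω => ω (clamp T hT (min t s)) := by
    ext ω
    rw [← ev_coe hT, ev_sp]; rfl
  rw [e]
  have h1 : MeasurableSpace.comap (fun ω : Path T => ω (clamp T hT (min t s))) inferInstance ≤ Fraw T s := by
    unfold Fraw
    refine le_iSup₂_of_le (clamp T hT (min t s)) ?_ le_rfl
    rw [clamp_val]
    exact max_le hs.1 ((min_le_right _ _).trans (min_le_right _ _))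
  exact (comap_measurable _).mono h1 le_rfl

lemma Fraw_le_sp (s : ℝ) : Fraw T s ≤ MeasurableSpace.comap (fun ω : Path T => sp hT ω s) inferInstance := by
  unfold Fraw
  refine iSup₂_le fun t ht => ?_
  have e : (fun ω : Path T => ω t) = (fun ω : Path T => ω t) ∘ fun ω => sp hT ω s := by
    ext ω
    simp only [Function.comp]
    rw [← ev_coe hT, ← ev_coe hT, ev_sp, min_eq_left ht]
  rw [e, ← MeasurableSpace.comap_comp]
  exact MeasurableSpace.comap_mono (ContinuousEvalConst.continuous_eval_const t).measurable.comap_le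

end BO

section Stop

variable {T : ℝ} (hT : 0 ≤ T)

lemma agr_stp {p q : PathPair T} {t u : ℝ} (h : stp hT p t = stp hT q t) (hu : u ≤ t) :
    stp hT p u = stp hT q u := by
  have := congrArg (fun x => stp hT x u) h
  simpa only [stp_stp, min_eq_left hu] using this

lemma agr1 {p q : PathPair T} {t u : ℝ} (h : stp hT p t = stp hT q t) (hu : u ≤ t) :
    ev T hT p.1 u = ev T hT q.1 u := by
  have := congrArg (fun x : PathPair T => ev T hT x.1 u) h
  simpa only [stp, ev_sp, min_eq_left hu] using this

lemma agr2 {p q : PathPair T} {t u : ℝ} (h : stp hT p t = stp hT q t) (hu : u ≤ t) :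
    ev T hT p.2 u = ev T hT q.2 u := by
  have := congrArg (fun x : PathPair T => ev T hT x.2 u) h
  simpa only [stp, ev_sp, min_eq_left hu] using this

lemma agrU {p q : PathPair T} {t u : ℝ} (h : stp hT p t = stp hT q t) (hu : u ≤ t) :
    UU hT p u = UU hT q u := by
  have := congrArg (fun x : PathPair T => UU hT x u) h
  simpa only [UU_stp, min_eq_left hu] using this

lemma agr_ge {p q : PathPair T} {t : ℝ} (h : stp hT p t = stp hT q t) (ht : T ≤ t) : p = q := by
  simpa only [stp_ge hT _ ht] using h

/-- stopping times on the pair space, in Galmarino form -/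
structure Stp (τ : PathPair T → ℝ) : Prop where
  nn : ∀ p, 0 ≤ τ p
  le : ∀ p, τ p ≤ T
  meas : Measurable τ
  loc : ∀ p q t, stp hT p t = stp hT q t → τ p < t → τ q = τ p

/-- measurability at a stopping time, in Galmarino form -/
structure MA (τ h : PathPair T → ℝ) : Prop where
  meas : Measurable h
  loc : ∀ p q t, stp hT p t = stp hT q t → τ p < t → h q = h p

variable {hT}

lemma Stp.lt_iff {τ : PathPair T → ℝ} (h : Stp hT τ) {p q : PathPair T} {t : ℝ}
    (e : stp hT p t = stp hT q t) : τ p < t ↔ τ q < t :=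
  ⟨fun h' => by rw [h.loc p q t e h']; exact h', fun h' => by rw [h.loc q p t e.symm h']; exact h'⟩

lemma Stp.const {c : ℝ} (h0 : 0 ≤ c) (h1 : c ≤ T) : Stp hT (fun _ => c) :=
  ⟨fun _ => h0, fun _ => h1, measurable_const, fun _ _ _ _ _ => rfl⟩

lemma Stp.min {τ κ : PathPair T → ℝ} (h : Stp hT τ) (h' : Stp hT κ) :
    Stp hT (fun p => min (τ p) (κ p)) := by
  refine ⟨fun p => le_min (h.nn p) (h'.nn p), fun p => (min_le_left _ _).trans (h.le p),
    h.meas.min h'.meas, fun p q t e hlt => ?_⟩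
  have h1 := h.lt_iff e
  have h2 := h'.lt_iff e
  have h3 := h.loc p q t e
  have h4 := h'.loc p q t e
  grind

lemma Stp.max {τ κ : PathPair T → ℝ} (h : Stp hT τ) (h' : Stp hT κ) :
    Stp hT (fun p => max (τ p) (κ p)) := by
  refine ⟨fun p => (h.nn p).trans (le_max_left _ _), fun p => max_le (h.le p) (h'.le p),
    h.meas.max h'.meas, fun p q t e hlt => ?_⟩
  have h3 := h.loc p q t e
  have h4 := h'.loc p q t e
  grind

lemma MA.const (τ : PathPair T → ℝ) (c : ℝ) : MA hT τ (fun _ => c) :=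
  ⟨measurable_const, fun _ _ _ _ _ => rfl⟩

lemma MA.add {τ f g : PathPair T → ℝ} (hf : MA hT τ f) (hg : MA hT τ g) :
    MA hT τ (fun p => f p + g p) :=
  ⟨hf.meas.add hg.meas, fun p q t e h => by rw [hf.loc p q t e h, hg.loc p q t e h]⟩

lemma MA.sub {τ f g : PathPair T → ℝ} (hf : MA hT τ f) (hg : MA hT τ g) :
    MA hT τ (fun p => f p - g p) :=
  ⟨hf.meas.sub hg.meas, fun p q t e h => by rw [hf.loc p q t e h, hg.loc p q t e h]⟩

lemma MA.mul {τ f g : PathPair T → ℝ} (hf : MA hT τ f) (hg : MA hT τ g) :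
    MA hT τ (fun p => f p * g p) :=
  ⟨hf.meas.mul hg.meas, fun p q t e h => by rw [hf.loc p q t e h, hg.loc p q t e h]⟩

lemma MA.comp {τ f : PathPair T → ℝ} {φ : ℝ → ℝ} (hφ : Measurable φ) (hf : MA hT τ f) :
    MA hT τ (fun p => φ (f p)) :=
  ⟨hφ.comp hf.meas, fun p q t e h => by rw [hf.loc p q t e h]⟩

lemma MA.mono {τ κ f : PathPair T → ℝ} (hf : MA hT τ f) (h : ∀ p, τ p ≤ κ p) : MA hT κ f :=
  ⟨hf.meas, fun p q t e h' => hf.loc p q t e ((h p).trans_lt h')⟩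

lemma MA.ite_le {τ κ f : PathPair T → ℝ} (hτ : Stp hT τ) (hκ : Stp hT κ) (hf : MA hT τ f) :
    MA hT (fun p => min (τ p) (κ p)) (fun p => if τ p ≤ κ p then f p else 0) := by
  refine ⟨Measurable.ite (measurableSet_le hτ.meas hκ.meas) hf.meas measurable_const, ?_⟩
  intro p q t e h
  have h1 := hτ.lt_iff e
  have h2 := hκ.lt_iff e
  have h3 := hτ.loc p q t e
  have h4 := hκ.loc p q t e
  have h5 := hf.loc p q t e
  grind

lemma MA.ev1 {τ : PathPair T → ℝ} (hτ : Stp hT τ) : MA hT τ (fun p => ev T hT p.1 (τ p)) :=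
  ⟨ev_meas hT measurable_fst hτ.meas, fun p q t e h => by
    rw [hτ.loc p q t e h, agr1 hT e h.le]⟩

lemma MA.ev2 {τ : PathPair T → ℝ} (hτ : Stp hT τ) : MA hT τ (fun p => ev T hT p.2 (τ p)) :=
  ⟨ev_meas hT measurable_snd hτ.meas, fun p q t e h => by
    rw [hτ.loc p q t e h, agr2 hT e h.le]⟩

/-- first time that `f` exceeds `c` -/
def hit (f : ℝ → PathPair T → ℝ) (c : ℝ) (p : PathPair T) : ℝ :=
  sInf ({u : ℝ | u ∈ Icc (0:ℝ) T ∧ c < f u p} ∪ {T})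

lemma hit_bdd (f : ℝ → PathPair T → ℝ) (c : ℝ) (p : PathPair T) (hT : 0 ≤ T) :
    BddBelow ({u : ℝ | u ∈ Icc (0:ℝ) T ∧ c < f u p} ∪ {T}) := by
  refine ⟨0, ?_⟩
  rintro u (h | h)
  · exact h.1.1
  · rw [mem_singleton_iff.1 h]; exact hT

lemma hit_nn (hT : 0 ≤ T) (f : ℝ → PathPair T → ℝ) (c : ℝ) (p : PathPair T) : 0 ≤ hit f c p := by
  refine le_csInf ⟨T, Or.inr rfl⟩ ?_
  rintro u (h | h)
  · exact h.1.1
  · rw [mem_singleton_iff.1 h]; exact hT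

lemma hit_le (hT : 0 ≤ T) (f : ℝ → PathPair T → ℝ) (c : ℝ) (p : PathPair T) : hit f c p ≤ T :=
  csInf_le (hit_bdd f c p hT) (Or.inr rfl)

lemma hit_lt_iff (hT : 0 ≤ T) {f : ℝ → PathPair T → ℝ} {c : ℝ} {p : PathPair T} {t : ℝ}
    (ht : t ≤ T) : hit f c p < t ↔ ∃ u ∈ Icc (0:ℝ) T, u < t ∧ c < f u p := by
  unfold hit
  rw [csInf_lt_iff (hit_bdd f c p hT) ⟨T, Or.inr rfl⟩]
  constructor
  · rintro ⟨u, h | h, h'⟩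
    · exact ⟨u, h.1, h', h.2⟩
    · rw [mem_singleton_iff.1 h] at h'; exact absurd ht (not_le.2 h')
  · rintro ⟨u, h1, h2, h3⟩; exact ⟨u, Or.inl ⟨h1, h3⟩, h2⟩

lemma le_of_lt_hit (hT : 0 ≤ T) {f : ℝ → PathPair T → ℝ} {c : ℝ} {p : PathPair T} {u : ℝ}
    (hu : 0 ≤ u) (h : u < hit f c p) : f u p ≤ c := by
  by_contra h'
  push Not at h'
  exact absurd (csInf_le (hit_bdd f c p hT) (Or.inl ⟨⟨hu, h.le.trans (hit_le hT f c p)⟩, h'⟩))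
    (not_le.2 h)

lemma le_of_le_hit (hT : 0 ≤ T) {f : ℝ → PathPair T → ℝ} {c : ℝ} {p : PathPair T}
    (hf : Continuous fun u => f u p) {u : ℝ}
    (hu : 0 ≤ u) (h : u ≤ hit f c p) (h0 : 0 < hit f c p) : f u p ≤ c := by
  have h1 : Ioo 0 (hit f c p) ⊆ {u | f u p ≤ c} := fun v hv => le_of_lt_hit hT hv.1.le hv.2
  have h2 : IsClosed {u | f u p ≤ c} := isClosed_le hf continuous_const
  have h3 := closure_minimal h1 h2
  rw [closure_Ioo h0.ne] at h3
  exact h3 ⟨hu, h⟩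

lemma ge_of_hit_lt (hT : 0 ≤ T) {f : ℝ → PathPair T → ℝ} {c : ℝ} {p : PathPair T}
    (hf : Continuous fun u => f u p) (h : hit f c p < T) : c ≤ f (hit f c p) p := by
  by_contra h'
  push Not at h'
  have hev : ∀ᶠ u in 𝓝 (hit f c p), f u p < c :=
    (hf.tendsto _).eventually (eventually_lt_nhds h')
  obtain ⟨ε, hε, hb⟩ := Metric.eventually_nhds_iff.1 hev
  obtain ⟨u, hu, hut, hc⟩ := (hit_lt_iff hT (min_le_right (hit f c p + ε) T)).1
    (lt_min (by linarith : hit f c p < hit f c p + ε) h)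
  have h1 : hit f c p ≤ u := csInf_le (hit_bdd f c p hT) (Or.inl ⟨hu, hc⟩)
  have h2 : u < hit f c p + ε := hut.trans_le (min_le_left _ _)
  have := hb (show dist u (hit f c p) < ε by rw [Real.dist_eq, abs_of_nonneg (by linarith)]; linarith)
  linarith

variable (hT)

lemma hit_Stp {f : ℝ → PathPair T → ℝ} {c : ℝ} (hc : ∀ p, Continuous fun u => f u p)
    (hm : ∀ u ∈ Icc (0:ℝ) T, Measurable (f u))
    (ha : ∀ p q t, stp hT p t = stp hT q t → ∀ u, 0 ≤ u → u ≤ t → f u p = f u q) :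
    Stp hT (hit f c) := by
  refine ⟨hit_nn hT f c, hit_le hT f c, ?_, ?_⟩
  · refine measurable_of_Iio fun t => ?_
    by_cases ht : t ≤ T
    · have : hit f c ⁻¹' Iio t = ⋃ (r : ℚ) (_ : (r:ℝ) ∈ Icc (0:ℝ) T ∧ (r:ℝ) < t), {p | c < f r p} := by
        ext p
        simp only [mem_preimage, mem_Iio, mem_iUnion, mem_setOf_eq, exists_prop]
        rw [hit_lt_iff hT ht]
        constructor
        · rintro ⟨u, hu, hut, h⟩
          have hev : ∀ᶠ v in 𝓝 u, c < f v p := ((hc p).tendsto _).eventually (eventually_gt_nhds h)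
          obtain ⟨ε, hε, hb⟩ := Metric.eventually_nhds_iff.1 hev
          obtain ⟨r, hr1, hr2⟩ := exists_rat_btwn (lt_min hut (show u < u + ε by linarith))
          have hr3 := hr2.trans_le (min_le_left _ _)
          have hr4 := hr2.trans_le (min_le_right _ _)
          refine ⟨r, ⟨⟨hu.1.trans hr1.le, hr3.le.trans ht⟩, hr3⟩, hb ?_⟩
          rw [Real.dist_eq, abs_of_nonneg (by linarith)]; linarith
        · rintro ⟨r, ⟨h1, h2⟩, h3⟩
          exact ⟨r, h1, h2, h3⟩
      rw [this]
      exact MeasurableSet.iUnion fun r => MeasurableSet.iUnion fun hr =>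
        measurableSet_lt measurable_const (hm r hr.1)
    · convert MeasurableSet.univ
      ext p
      simp only [mem_preimage, mem_Iio, mem_univ, iff_true]
      exact (hit_le hT f c p).trans_lt (not_le.1 ht)
  · have key : ∀ p q t, stp hT p t = stp hT q t → hit f c p < t → hit f c q ≤ hit f c p := by
      intro p q t e h
      by_cases htT : T ≤ t
      · rw [agr_ge hT e htT]
      push Not at htT
      by_contra h'
      push Not at h'
      obtain ⟨s, hs1, hs2⟩ := exists_between (lt_min h h')
      have hs3 : s < t := hs2.trans_le (min_le_left _ _)
      obtain ⟨u, hu, hus, hcu⟩ := (hit_lt_iff hT (hs3.le.trans htT.le)).1 hs1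
      rw [ha p q t e u hu.1 (hus.le.trans hs3.le)] at hcu
      have : hit f c q < s := (hit_lt_iff hT (hs3.le.trans htT.le)).2 ⟨u, hu, hus, hcu⟩
      exact absurd (hs2.trans_le (min_le_right _ _)) (not_lt.2 this.le)
    intro p q t e h
    have h1 := key p q t e h
    exact le_antisymm h1 (key q p t e.symm (h1.trans_lt h))

/-- exit time of the running size above `R` -/
def kap (R : ℝ) : PathPair T → ℝ := hit (fun u p => UU hT p u) R

lemma kap_Stp (R : ℝ) : Stp hT (kap hT R) :=
  hit_Stp hT (fun p => UU_cont_t hT p)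
    (fun u _ => ((UU_cont hT).comp (Continuous.prodMk_left u)).measurable)
    (fun p q t e u _ hu => agrU hT e hu)

lemma UU_le_kap {R : ℝ} {p : PathPair T} {u : ℝ} (hu : 0 ≤ u) (h : u ≤ kap hT R p)
    (h0 : 0 < kap hT R p) : UU hT p u ≤ R :=
  le_of_le_hit hT (UU_cont_t hT p) hu h h0

lemma kap_eq {R : ℝ} {p : PathPair T} (h : ‖p.1‖ + ‖p.2‖ ≤ R) : kap hT R p = T := by
  by_contra h'
  have h1 : kap hT R p < T := lt_of_le_of_ne (hit_le hT _ _ _) h'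
  obtain ⟨u, _, _, h3⟩ := (hit_lt_iff hT le_rfl).1 h1
  exact absurd ((UU_le_norm hT p u).trans h) (not_le.2 h3)

/-- the capped times `σ^m_k` on pairs -/
def sg (m k : ℕ) (p : PathPair T) : ℝ := min (sig T hT m k p.1) T

lemma sg_Stp (m k : ℕ) : Stp hT (sg hT m k) := by
  refine ⟨fun p => le_min (sig_nonneg hT m k _) hT, fun p => min_le_right _ _,
    ((sig_measurable hT m k).comp measurable_fst).min measurable_const, ?_⟩
  intro p q t e h
  by_cases htT : T ≤ t
  · rw [agr_ge hT e htT]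
  push Not at htT
  unfold sg at *
  have h1 : sig T hT m k p.1 < t := by
    rcases min_lt_iff.1 h with h | h
    · exact h
    · linarith
  have ht : t ∈ Icc (0:ℝ) T := ⟨(sig_nonneg hT m k p.1).trans h1.le, htT.le⟩
  have e1 := sig_sp hT m k p.1 ht
  have e2 := sig_sp hT m k q.1 ht
  have e3 : sp hT p.1 t = sp hT q.1 t := congrArg Prod.fst e
  rw [if_pos h1.le, e3, e2] at e1
  split_ifs at e1 with h2
  · rw [e1]
  · linarith

end Stop

section OptStop

variable {T : ℝ} (hT : 0 ≤ T)

lemma opt_stop {Q : Measure (PathPair T)} [IsProbabilityMeasure Q] {Y : ℝ → PathPair T → ℝ}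
    {D : PathPair T → ℝ} (hD : Integrable D Q)
    (hYD : ∀ u ∈ Icc (0:ℝ) T, ∀ p, |Y u p| ≤ D p) (hYc : ∀ p, Continuous fun u => Y u p)
    (hYm : ∀ u ∈ Icc (0:ℝ) T, Measurable (Y u))
    (hmart : ∀ t ∈ Icc (0:ℝ) T, ∀ g : PathPair T → ℝ, Measurable g → (∃ C, ∀ p, |g p| ≤ C) →
      (∀ p, g (stp hT p t) = g p) → ∫ p, g p * (Y T p - Y t p) ∂Q = 0)
    {τ h : PathPair T → ℝ} (hτ : Stp hT τ) (hh : MA hT τ h) {C : ℝ} (hC : ∀ p, |h p| ≤ C) :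
    ∫ p, h p * (Y T p - Y (τ p) p) ∂Q = 0 := by
  have hTT : T ∈ Icc (0:ℝ) T := ⟨hT, le_rfl⟩
  let a : ℕ → ℝ := fun n => (n:ℝ) + 1
  have ha : ∀ n, 0 < a n := fun n => by positivity
  let x : ℕ → PathPair T → ℝ := fun n p => (⌊a n * τ p⌋₊ + 1) / a n
  let tk : ℕ → ℕ → ℝ := fun n k => min T ((k + 1) / a n)
  have htk : ∀ n k, tk n k ∈ Icc (0:ℝ) T := fun n k =>
    ⟨le_min hT (by have := ha n; positivity), min_le_left _ _⟩
  let F : ℕ → PathPair T → ℝ := fun n p => ∑ k ∈ Finset.range (⌊a n * T⌋₊ + 1),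
    (if ⌊a n * τ p⌋₊ = k then h p else 0) * (Y T p - Y (tk n k) p)
  have hFe : ∀ n p, F n p = h p * (Y T p - Y (min T (x n p)) p) := by
    intro n p
    have hmem : ⌊a n * τ p⌋₊ ∈ Finset.range (⌊a n * T⌋₊ + 1) := by
      rw [Finset.mem_range, Nat.lt_succ_iff]
      exact Nat.floor_mono (mul_le_mul_of_nonneg_left (hτ.le p) (ha n).le)
    simp only [F, ite_mul, zero_mul]
    rw [Finset.sum_ite_eq, if_pos hmem]
  have hgm : ∀ n k, Measurable fun p => if ⌊a n * τ p⌋₊ = k then h p else 0 := by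
    intro n k
    refine Measurable.ite ?_ hh.meas measurable_const
    exact (Nat.measurable_floor.comp (hτ.meas.const_mul (a n))) (measurableSet_singleton k)
  have hC0 : 0 ≤ C := by
    obtain ⟨p⟩ : Nonempty (PathPair T) := inferInstance
    exact (abs_nonneg _).trans (hC p)
  have hgb : ∀ n k p, |if ⌊a n * τ p⌋₊ = k then h p else 0| ≤ C := by
    intro n k p
    split_ifs
    · exact hC p
    · simpa using hC0
  have hdiff : ∀ u ∈ Icc (0:ℝ) T, ∀ p, |Y T p - Y u p| ≤ 2 * D p := by
    intro u hu p
    have h1 := hYD u hu p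
    have h2 := hYD T hTT p
    rw [abs_le] at *
    constructor <;> linarith
  have hF0 : ∀ n, ∫ p, F n p ∂Q = 0 := by
    intro n
    simp only [F]
    rw [integral_finset_sum]
    · refine Finset.sum_eq_zero fun k _ => ?_
      refine hmart _ (htk n k) _ (hgm n k) ⟨C, hgb n k⟩ fun p => ?_
      have e : stp hT (stp hT p (tk n k)) (tk n k) = stp hT p (tk n k) := by
        rw [stp_stp, min_self]
      have key : ∀ p q, stp hT p (tk n k) = stp hT q (tk n k) → ⌊a n * τ p⌋₊ = k →
          ⌊a n * τ q⌋₊ = k ∧ h q = h p := by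
        intro p q e hk
        by_cases hlt : (k + 1) / a n ≤ T
        · have h1 : τ p < tk n k := by
            simp only [tk, min_eq_right hlt]
            rw [lt_div_iff₀ (ha n), mul_comm, ← hk]
            exact Nat.lt_floor_add_one _
          exact ⟨by rw [hτ.loc p q _ e h1]; exact hk, hh.loc p q _ e h1⟩
        · push Not at hlt
          have : p = q := agr_ge hT e (by simp only [tk, min_eq_left hlt.le]; exact le_rfl)
          subst this
          exact ⟨hk, rfl⟩
      by_cases hk : ⌊a n * τ p⌋₊ = k
      · have := key p _ e.symm hk
        rw [if_pos hk, if_pos this.1, this.2]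
      · have : ¬ ⌊a n * τ (stp hT p (tk n k))⌋₊ = k := fun h' => hk (key _ p e h').1
        rw [if_neg hk, if_neg this]
    · intro k _
      refine Integrable.mono' ((hD.const_mul 2).const_mul C)
        ((hgm n k).mul ((hYm T hTT).sub (hYm _ (htk n k)))).aestronglyMeasurable
        (ae_of_all _ fun p => ?_)
      rw [norm_mul, Real.norm_eq_abs, Real.norm_eq_abs]
      exact mul_le_mul (hgb n k p) (hdiff _ (htk n k) p) (abs_nonneg _) hC0
  have hlim : Tendsto (fun n => ∫ p, F n p ∂Q) atTop (𝓝 (∫ p, h p * (Y T p - Y (τ p) p) ∂Q)) := by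
    refine tendsto_integral_of_dominated_convergence (fun p => C * (2 * D p)) ?_
      ((hD.const_mul 2).const_mul C) ?_ ?_
    · intro n
      refine Measurable.aestronglyMeasurable ?_
      exact Finset.measurable_sum _ fun k _ => (hgm n k).mul ((hYm T hTT).sub (hYm _ (htk n k)))
    · intro n
      refine ae_of_all _ fun p => ?_
      rw [hFe, norm_mul, Real.norm_eq_abs, Real.norm_eq_abs]
      refine mul_le_mul (hC p) (hdiff _ ?_ p) (abs_nonneg _) hC0
      exact ⟨le_min hT (by have := ha n; simp only [x]; positivity), min_le_left _ _⟩
    · refine ae_of_all _ fun p => ?_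
      simp only [hFe]
      have hx : Tendsto (fun n => x n p) atTop (𝓝 (τ p)) := by
        have h1 : Tendsto (fun n : ℕ => τ p + 1 / ((n:ℝ) + 1)) atTop (𝓝 (τ p)) := by
          simpa using tendsto_const_nhds.add (tendsto_one_div_add_atTop_nhds_zero_nat (𝕜 := ℝ))
        refine tendsto_of_tendsto_of_tendsto_of_le_of_le tendsto_const_nhds h1 ?_ ?_
        · intro n
          simp only [x]
          rw [le_div_iff₀ (ha n), mul_comm]
          exact (Nat.lt_floor_add_one _).le
        · intro n
          simp only [x]
          rw [div_le_iff₀ (ha n)]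
          have := Nat.floor_le (mul_nonneg (ha n).le (hτ.nn p))
          have h3 : 1 / ((n:ℝ) + 1) * a n = 1 := by
            simp only [a]; field_simp
          have h4 : (τ p + 1 / ((n:ℝ) + 1)) * a n = a n * τ p + 1 / ((n:ℝ) + 1) * a n := by ring
          rw [h4, h3]; linarith
      have hc2 : Continuous fun u => h p * (Y T p - Y (min T u) p) :=
        continuous_const.mul (continuous_const.sub ((hYc p).comp (continuous_const.min continuous_id)))
      have := (hc2.tendsto (τ p)).comp hx
      simp only [min_eq_right (hτ.le p)] at this
      exact this
  simp only [hF0] at hlim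
  exact (tendsto_nhds_unique hlim tendsto_const_nhds)

/-- two-time version -/
lemma opt_stop2 {Q : Measure (PathPair T)} [IsProbabilityMeasure Q] {Y : ℝ → PathPair T → ℝ}
    {D : PathPair T → ℝ} (hD : Integrable D Q)
    (hYD : ∀ u ∈ Icc (0:ℝ) T, ∀ p, |Y u p| ≤ D p) (hYc : ∀ p, Continuous fun u => Y u p)
    (hYm : ∀ u ∈ Icc (0:ℝ) T, Measurable (Y u))
    (hYm2 : ∀ τ, Stp hT τ → Measurable fun p => Y (τ p) p)
    (hmart : ∀ t ∈ Icc (0:ℝ) T, ∀ g : PathPair T → ℝ, Measurable g → (∃ C, ∀ p, |g p| ≤ C) →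
      (∀ p, g (stp hT p t) = g p) → ∫ p, g p * (Y T p - Y t p) ∂Q = 0)
    {τ κ h : PathPair T → ℝ} (hτ : Stp hT τ) (hκ : Stp hT κ) (hle : ∀ p, τ p ≤ κ p)
    (hh : MA hT τ h) {C : ℝ} (hC : ∀ p, |h p| ≤ C) :
    ∫ p, h p * (Y (κ p) p - Y (τ p) p) ∂Q = 0 := by
  have h1 := opt_stop hT hD hYD hYc hYm hmart hτ hh hC
  have h2 := opt_stop hT hD hYD hYc hYm hmart hκ (hh.mono hle) hC
  have hTT : T ∈ Icc (0:ℝ) T := ⟨hT, le_rfl⟩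
  have hint : ∀ σ, Stp hT σ → Integrable (fun p => h p * (Y T p - Y (σ p) p)) Q := by
    intro σ hσ
    refine Integrable.mono' ((hD.const_mul 2).const_mul C)
      (hh.meas.mul ((hYm T hTT).sub (hYm2 σ hσ))).aestronglyMeasurable (ae_of_all _ fun p => ?_)
    rw [norm_mul, Real.norm_eq_abs, Real.norm_eq_abs]
    refine mul_le_mul (hC p) ?_ (abs_nonneg _) ((abs_nonneg _).trans (hC p))
    have h1 := hYD _ ⟨hσ.nn p, hσ.le p⟩ p
    have h2 := hYD T hTT p
    rw [abs_le] at *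
    constructor <;> linarith
  have e : (fun p => h p * (Y (κ p) p - Y (τ p) p)) = fun p =>
      h p * (Y T p - Y (τ p) p) - h p * (Y T p - Y (κ p) p) := by
    ext p; ring
  rw [e, integral_sub (hint τ hτ) (hint κ hκ), h1, h2, sub_zero]

end OptStop

section LPsec

variable {T : ℝ} (hT : 0 ≤ T)

/-- the process `S² - V` -/
def XX (p : PathPair T) (u : ℝ) : ℝ := ev T hT p.1 u ^ 2 - ev T hT p.2 u

/-- martingale property of `S` in optional form -/
def LP1 (Q : Measure (PathPair T)) : Prop :=
  ∀ (τ κ h : PathPair T → ℝ) (C : ℝ), Stp hT τ → Stp hT κ → (∀ p, τ p ≤ κ p) → MA hT τ h →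
    (∀ p, |h p| ≤ C) → ∫ p, h p * (ev T hT p.1 (κ p) - ev T hT p.1 (τ p)) ∂Q = 0

/-- local martingale property of `S² - V` in optional form -/
def LP2 (Q : Measure (PathPair T)) : Prop :=
  ∀ (R : ℝ) (τ κ h : PathPair T → ℝ) (C : ℝ), Stp hT τ → Stp hT κ → (∀ p, τ p ≤ κ p) →
    (∀ p, κ p ≤ kap hT R p) → MA hT τ h →
    (∀ p, |h p| ≤ C) → ∫ p, h p * (XX hT p (κ p) - XX hT p (τ p)) ∂Q = 0

/-- truncation -/
def clip (R x : ℝ) : ℝ := max (-R) (min R x)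

lemma clip_meas (R : ℝ) : Measurable (clip R) := by unfold clip; fun_prop

lemma clip_abs {R : ℝ} (hR : 0 ≤ R) (x : ℝ) : |clip R x| ≤ R := by
  unfold clip
  rw [abs_le]
  exact ⟨le_max_left _ _, max_le (by linarith) (min_le_left _ _)⟩

lemma clip_eq {R x : ℝ} (h : |x| ≤ R) : clip R x = x := by
  rw [abs_le] at h
  unfold clip
  rw [min_eq_right h.2, max_eq_right h.1]

lemma Sm_agr (m : ℕ) {p q : PathPair T} {t u : ℝ} (e : stp hT p t = stp hT q t) (h0 : 0 ≤ u)
    (hu : u ≤ t) : Sm T hT m u p.1 = Sm T hT m u q.1 := by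
  by_cases htT : T ≤ t
  · rw [agr_ge hT e htT]
  push Not at htT
  have ht : t ∈ Icc (0:ℝ) T := ⟨h0.trans hu, htT.le⟩
  have h1 := Sm_sp hT m u p.1 ht
  have h2 := Sm_sp hT m u q.1 ht
  have e3 : sp hT p.1 t = sp hT q.1 t := congrArg Prod.fst e
  rw [min_eq_left hu] at h1 h2
  rw [← h1, ← h2, e3]

/-- the defect process -/
def Lm (m : ℕ) (u : ℝ) (p : PathPair T) : ℝ :=
  ev T hT p.1 u ^ 2 - ev T hT p.1 0 ^ 2 - ev T hT p.2 u - 2 * Sm T hT m u p.1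

lemma Lm_cont (m : ℕ) (p : PathPair T) : Continuous fun u => Lm hT m u p := by
  have h1 := ev_cont_t hT p.1
  have h2 := ev_cont_t hT p.2
  have h3 := Sm_cont hT m p.1
  unfold Lm
  fun_prop

lemma Lm_meas (m : ℕ) (u : ℝ) : Measurable (Lm hT m u) := by
  have h1 : ∀ u, Measurable fun p : PathPair T => ev T hT p.1 u :=
    fun u => ev_meas hT measurable_fst measurable_const
  have h2 : Measurable fun p : PathPair T => ev T hT p.2 u := ev_meas hT measurable_snd measurable_const
  have h3 : Measurable fun p : PathPair T => Sm T hT m u p.1 := (Sm_measurable hT m u).comp measurable_fst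
  unfold Lm
  exact ((((h1 u).pow_const 2).sub ((h1 0).pow_const 2)).sub h2).sub (h3.const_mul 2)

lemma Lm_agr (m : ℕ) {p q : PathPair T} {t u : ℝ} (e : stp hT p t = stp hT q t) (h0 : 0 ≤ u)
    (hu : u ≤ t) : Lm hT m u p = Lm hT m u q := by
  unfold Lm
  rw [Sm_agr hT m e h0 hu, agr1 hT e hu, agr1 hT e (h0.trans hu), agr2 hT e hu]

/-- exit time of the defect -/
def rho (m : ℕ) (ε : ℝ) : PathPair T → ℝ := hit (fun u p => |Lm hT m u p|) ε

lemma rho_Stp (m : ℕ) (ε : ℝ) : Stp hT (rho hT m ε) :=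
  hit_Stp hT (fun p => (Lm_cont hT m p).abs) (fun u _ => (Lm_meas hT m u).abs)
    (fun p q t e u h0 hu => by rw [Lm_agr hT m e h0 hu])

lemma sig_m1 (m k : ℕ) : Measurable fun p : PathPair T => sig T hT m k p.1 :=
  (sig_measurable hT m k).comp measurable_fst

lemma Sm_jmeas (m : ℕ) {f : PathPair T → ℝ} (hf : Measurable f) :
    Measurable fun p : PathPair T => Sm T hT m (f p) p.1 := by
  refine measurable_of_tendsto_metrizable
    (f := fun J p => ∑ k ∈ Finset.range J, smT hT m k (f p) p.1) ?_
    (tendsto_pi_nhds.2 fun p => Sm_tendsto hT m (f p) p.1)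
  intro J
  refine Finset.measurable_sum _ fun k _ => ?_
  have h1 := sig_m1 hT m k
  have h2 := sig_m1 hT m (k+1)
  exact (ev_meas hT measurable_fst h1).mul ((ev_meas hT measurable_fst (h2.min hf)).sub
    (ev_meas hT measurable_fst (h1.min hf)))

lemma ev_min_sg (ω : Path T) (x t : ℝ) (ht : t ≤ T) :
    ev T hT ω (min x t) = ev T hT ω (min (min x T) t) := by
  congr 1; grind

lemma ev_min_T (ω : Path T) (x : ℝ) : ev T hT ω x = ev T hT ω (min x T) := by
  rcases le_total x T with h | h
  · rw [min_eq_left h]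
  · rw [min_eq_right h, ev_ge hT ω h]

variable {Q : Measure (PathPair T)} [IsProbabilityMeasure Q]

lemma ev1_int (hN : Integrable (fun p : PathPair T => ‖p.1‖ + ‖p.2‖) Q) {τ : PathPair T → ℝ}
    (hτ : Measurable τ) : Integrable (fun p : PathPair T => ev T hT p.1 (τ p)) Q := by
  refine hN.mono' (ev_meas hT measurable_fst hτ).aestronglyMeasurable (ae_of_all _ fun p => ?_)
  have := ev_abs_le hT p.1 (τ p)
  rw [Real.norm_eq_abs]
  linarith [norm_nonneg p.2]

lemma ev2_int (hN : Integrable (fun p : PathPair T => ‖p.1‖ + ‖p.2‖) Q) {τ : PathPair T → ℝ}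
    (hτ : Measurable τ) : Integrable (fun p : PathPair T => ev T hT p.2 (τ p)) Q := by
  refine hN.mono' (ev_meas hT measurable_snd hτ).aestronglyMeasurable (ae_of_all _ fun p => ?_)
  have := ev_abs_le hT p.2 (τ p)
  rw [Real.norm_eq_abs]
  linarith [norm_nonneg p.1]

lemma bdd_mul_int {f h : PathPair T → ℝ} (hf : Integrable f Q) (hh : Measurable h) {C : ℝ}
    (hC : ∀ p, |h p| ≤ C) : Integrable (fun p => h p * f p) Q :=
  hf.bdd_mul hh.aestronglyMeasurable (ae_of_all _ fun p => (Real.norm_eq_abs (h p)).trans_le (hC p))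

lemma smT_lp (hN : Integrable (fun p : PathPair T => ‖p.1‖ + ‖p.2‖) Q) (h1 : LP1 hT Q)
    {R : ℝ} {α β h : PathPair T → ℝ} {C : ℝ} (hα : Stp hT α) (hβ : Stp hT β)
    (hle : ∀ p, α p ≤ β p) (hβR : ∀ p, β p ≤ kap hT R p) (hh : MA hT α h) (hC : ∀ p, |h p| ≤ C)
    (m k : ℕ) :
    Integrable (fun p => h p * (smT hT m k (β p) p.1 - smT hT m k (α p) p.1)) Q ∧
    ∫ p, h p * (smT hT m k (β p) p.1 - smT hT m k (α p) p.1) ∂Q = 0 := by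
  have hR' : 0 ≤ |R| := abs_nonneg R
  have hC0 : 0 ≤ C := by
    obtain ⟨p⟩ : Nonempty (PathPair T) := inferInstance
    exact (abs_nonneg _).trans (hC p)
  have hs := sg_Stp hT m k
  have hs' := sg_Stp hT m (k+1)
  have hb : Stp hT (fun p => min (sg hT m (k+1) p) (β p)) := hs'.min hβ
  have ha : Stp hT (fun p => min (max (sg hT m k p) (α p)) (min (sg hT m (k+1) p) (β p))) :=
    (hs.max hα).min hb
  set b : PathPair T → ℝ := fun p => min (sg hT m (k+1) p) (β p) with hbdef
  set a : PathPair T → ℝ := fun p => min (max (sg hT m k p) (α p)) (b p) with hadef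
  let c : PathPair T → ℝ := fun p =>
    (if α p ≤ a p then h p else 0) * clip |R| (ev T hT p.1 (min (sg hT m k p) (a p)))
  have hc : MA hT a c := by
    refine MA.mul ((MA.ite_le hα ha hh).mono fun p => min_le_right _ _) ?_
    exact MA.comp (clip_meas _) ((MA.ev1 (hs.min ha)).mono fun p => min_le_right _ _)
  have hcb : ∀ p, |c p| ≤ C * |R| := by
    intro p
    simp only [c]
    rw [abs_mul]
    refine mul_le_mul ?_ (clip_abs hR' _) (abs_nonneg _) hC0
    split_ifs
    · exact hC p
    · simpa using hC0
  have e : (fun p => h p * (smT hT m k (β p) p.1 - smT hT m k (α p) p.1)) =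
      fun p => c p * (ev T hT p.1 (b p) - ev T hT p.1 (a p)) := by
    ext p
    have hsk : sg hT m k p ≤ sg hT m (k+1) p := min_le_min_right _ (sig_le_succ hT m k p.1)
    have e1 : smT hT m k (β p) p.1 - smT hT m k (α p) p.1 =
        ev T hT p.1 (sg hT m k p) * (ev T hT p.1 (b p) - ev T hT p.1 (a p)) := by
      unfold smT
      rw [ev_min_T hT p.1 (sig T hT m k p.1), ev_min_sg hT p.1 _ _ (hβ.le p),
        ev_min_sg hT p.1 (sig T hT m k p.1) _ (hβ.le p), ev_min_sg hT p.1 _ _ (hα.le p),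
        ev_min_sg hT p.1 (sig T hT m k p.1) _ (hα.le p)]
      change ev T hT p.1 (sg hT m k p) * (ev T hT p.1 (min (sg hT m (k+1) p) (β p)) -
        ev T hT p.1 (min (sg hT m k p) (β p))) - ev T hT p.1 (sg hT m k p) *
        (ev T hT p.1 (min (sg hT m (k+1) p) (α p)) - ev T hT p.1 (min (sg hT m k p) (α p))) = _
      have hl := hle p
      simp only [hadef, hbdef]
      rcases le_total (sg hT m (k+1) p) (α p) with h3 | h3
      · have i1 : min (sg hT m (k+1) p) (β p) = sg hT m (k+1) p := by grind
        have i2 : min (sg hT m k p) (β p) = sg hT m k p := by grind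
        have i3 : min (sg hT m (k+1) p) (α p) = sg hT m (k+1) p := by grind
        have i4 : min (sg hT m k p) (α p) = sg hT m k p := by grind
        have i5 : min (max (sg hT m k p) (α p)) (sg hT m (k+1) p) = sg hT m (k+1) p := by grind
        rw [i1, i2, i3, i4, i5]; ring
      · have i3 : min (sg hT m (k+1) p) (α p) = α p := by grind
        rcases le_total (sg hT m k p) (α p) with h4 | h4
        · have i2 : min (sg hT m k p) (β p) = sg hT m k p := by grind
          have i4 : min (sg hT m k p) (α p) = sg hT m k p := by grind
          have i5 : min (max (sg hT m k p) (α p)) (min (sg hT m (k+1) p) (β p)) = α p := by grind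
          rw [i2, i3, i4, i5]; ring
        · have i4 : min (sg hT m k p) (α p) = α p := by grind
          have i5 : min (max (sg hT m k p) (α p)) (min (sg hT m (k+1) p) (β p)) =
            min (sg hT m k p) (β p) := by grind
          rw [i3, i4, i5]; ring
    rw [e1]
    have hab : a p ≤ b p := min_le_right _ _
    rcases hab.lt_or_eq with hlt | heq
    · have e2 : a p = max (sg hT m k p) (α p) := by
        simp only [hadef] at hlt ⊢; grind
      have e3 : α p ≤ a p := by rw [e2]; exact le_max_right _ _
      have e4 : sg hT m k p ≤ a p := by rw [e2]; exact le_max_left _ _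
      have e5 : b p ≤ kap hT R p := (min_le_right _ _).trans (hβR p)
      have e6 : 0 < kap hT R p := by linarith [ha.nn p]
      have e7 : UU hT p (sg hT m k p) ≤ R :=
        UU_le_kap hT (hs.nn p) (e4.trans (hab.trans e5)) e6
      have e8 : |ev T hT p.1 (sg hT m k p)| ≤ |R| :=
        (ev1_le_UU hT p _).trans (e7.trans (le_abs_self R))
      simp only [c]
      rw [if_pos e3, min_eq_left e4, clip_eq e8]
      ring
    · rw [heq]; ring
  rw [e]
  refine ⟨?_, h1 a b c _ ha hb (fun p => min_le_right _ _) hc hcb⟩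
  exact bdd_mul_int ((ev1_int hT hN hb.meas).sub (ev1_int hT hN ha.meas)) hc.meas hcb

lemma Sm_lp (hN : Integrable (fun p : PathPair T => ‖p.1‖ + ‖p.2‖) Q) (h1 : LP1 hT Q)
    {R : ℝ} {α β h : PathPair T → ℝ} {C : ℝ} (hα : Stp hT α) (hβ : Stp hT β)
    (hle : ∀ p, α p ≤ β p) (hβR : ∀ p, β p ≤ kap hT R p) (hh : MA hT α h) (hC : ∀ p, |h p| ≤ C)
    (m J : ℕ) :
    ∫ p, h p * (Sm T hT m (min (β p) (sig T hT m J p.1)) p.1 -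
      Sm T hT m (min (α p) (sig T hT m J p.1)) p.1) ∂Q = 0 := by
  simp_rw [← Sm_partial, ← Finset.sum_sub_distrib, Finset.mul_sum]
  rw [integral_finset_sum _ fun k _ => (smT_lp hT hN h1 hα hβ hle hβR hh hC m k).1]
  exact Finset.sum_eq_zero fun k _ => (smT_lp hT hN h1 hα hβ hle hβR hh hC m k).2

lemma Sm_bdd {m : ℕ} {R : ℝ} {p : PathPair T} {b : ℝ} (hb : 0 < b) (hbR : b ≤ kap hT R p)
    (hbr : b ≤ rho hT m 1 p) {u : ℝ} (hu : 0 ≤ u) (hub : u ≤ b) :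
    |Sm T hT m u p.1| ≤ R ^ 2 + R + 1 := by
  have h1 : UU hT p u ≤ R := UU_le_kap hT hu (hub.trans hbR) (hb.trans_le hbR)
  have h2 : UU hT p 0 ≤ R := UU_le_kap hT le_rfl (hb.le.trans hbR) (hb.trans_le hbR)
  have h3 : |Lm hT m u p| ≤ 1 :=
    le_of_le_hit hT (f := fun u p => |Lm hT m u p|) (Lm_cont hT m p).abs hu (hub.trans hbr) (hb.trans_le hbr)
  have h4 := (ev1_le_UU hT p u).trans h1
  have h5 := (ev1_le_UU hT p 0).trans h2
  have h6 := (ev2_le_UU hT p u).trans h1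
  have h7 : ev T hT p.1 u ^ 2 ≤ R ^ 2 := by
    rw [← sq_abs]; exact pow_le_pow_left₀ (abs_nonneg _) h4 2
  have h8 : ev T hT p.1 0 ^ 2 ≤ R ^ 2 := by
    rw [← sq_abs]; exact pow_le_pow_left₀ (abs_nonneg _) h5 2
  unfold Lm at h3
  rw [abs_le] at *
  constructor <;> nlinarith [sq_nonneg (ev T hT p.1 u), sq_nonneg (ev T hT p.1 0)]

lemma Sm_diff_bdd {m : ℕ} {R : ℝ} {p : PathPair T} {b a : ℝ} (hb : 0 ≤ b) (hbR : b ≤ kap hT R p)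
    (hbr : b ≤ rho hT m 1 p) (ha : 0 ≤ a) (hab : a ≤ b) :
    |Sm T hT m b p.1 - Sm T hT m a p.1| ≤ 2 * (R ^ 2 + R + 1) := by
  rcases hb.lt_or_eq with h | h
  · have h1 := Sm_bdd hT h hbR hbr hb le_rfl
    have h2 := Sm_bdd hT h hbR hbr ha hab
    rw [abs_le] at *
    constructor <;> linarith
  · have : a = b := by linarith
    rw [this]; simp; nlinarith [sq_nonneg (R + 1/2)]

lemma Sm_lp' (hN : Integrable (fun p : PathPair T => ‖p.1‖ + ‖p.2‖) Q) (h1 : LP1 hT Q)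
    {R : ℝ} {α β h : PathPair T → ℝ} {C : ℝ} (hα : Stp hT α) (hβ : Stp hT β)
    (hle : ∀ p, α p ≤ β p) (hβR : ∀ p, β p ≤ kap hT R p) (hh : MA hT α h) (hC : ∀ p, |h p| ≤ C)
    (m : ℕ) (hβr : ∀ p, β p ≤ rho hT m 1 p) :
    ∫ p, h p * (Sm T hT m (β p) p.1 - Sm T hT m (α p) p.1) ∂Q = 0 := by
  have hlim : Tendsto (fun J => ∫ p, h p * (Sm T hT m (min (β p) (sig T hT m J p.1)) p.1 -
      Sm T hT m (min (α p) (sig T hT m J p.1)) p.1) ∂Q) atTop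
      (𝓝 (∫ p, h p * (Sm T hT m (β p) p.1 - Sm T hT m (α p) p.1) ∂Q)) := by
    refine tendsto_integral_of_dominated_convergence (fun _ => C * (2 * (R ^ 2 + R + 1))) ?_
      (integrable_const _) ?_ ?_
    · intro J
      have h2 := sig_m1 hT m J
      exact (hh.meas.mul ((Sm_jmeas hT m (hβ.meas.min h2)).sub
        (Sm_jmeas hT m (hα.meas.min h2)))).aestronglyMeasurable
    · intro J
      refine ae_of_all _ fun p => ?_
      rw [norm_mul, Real.norm_eq_abs, Real.norm_eq_abs]
      have hs := sig_nonneg hT m J p.1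
      exact mul_le_mul (hC p) (Sm_diff_bdd hT (le_min (hβ.nn p) hs)
        ((min_le_left _ _).trans (hβR p)) ((min_le_left _ _).trans (hβr p))
        (le_min (hα.nn p) hs) (min_le_min_right _ (hle p))) (abs_nonneg _)
        ((abs_nonneg _).trans (hC p))
    · refine ae_of_all _ fun p => ?_
      refine tendsto_const_nhds.congr' ?_
      obtain ⟨N, hNN⟩ := sig_eventually hT m p.1
      filter_upwards [eventually_ge_atTop N] with J hJ
      rw [hNN J hJ, min_eq_left (by linarith [hβ.le p]), min_eq_left (by linarith [hα.le p])]
  simp only [Sm_lp hT hN h1 hα hβ hle hβR hh hC] at hlim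
  exact tendsto_nhds_unique hlim tendsto_const_nhds

lemma LP2_of_BO (hN : Integrable (fun p : PathPair T => ‖p.1‖ + ‖p.2‖) Q) (h1 : LP1 hT Q)
    (hBO : ∀ᵐ p ∂Q, BO hT p) : LP2 hT Q := by
  intro R τ κ h C hτ hκ hle hκR hh hC
  have hlim : Tendsto (fun m => ∫ p, (if τ p ≤ rho hT m 1 p then h p else 0) *
      (Sm T hT m (min (κ p) (rho hT m 1 p)) p.1 -
      Sm T hT m (min (τ p) (rho hT m 1 p)) p.1) ∂Q) atTop
      (𝓝 (∫ p, h p * ((XX hT p (κ p) - XX hT p (τ p)) / 2) ∂Q)) := by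
    refine tendsto_integral_of_dominated_convergence (fun _ => C * (2 * (R ^ 2 + R + 1))) ?_
      (integrable_const _) ?_ ?_
    · intro m
      have h2 := (rho_Stp hT m 1).meas
      exact (((MA.ite_le hτ (rho_Stp hT m 1) hh).meas).mul ((Sm_jmeas hT m (hκ.meas.min h2)).sub
        (Sm_jmeas hT m (hτ.meas.min h2)))).aestronglyMeasurable
    · intro m
      refine ae_of_all _ fun p => ?_
      rw [norm_mul, Real.norm_eq_abs, Real.norm_eq_abs]
      have hs := (rho_Stp hT m 1).nn p
      refine mul_le_mul ?_ (Sm_diff_bdd hT (le_min (hκ.nn p) hs)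
        ((min_le_left _ _).trans (hκR p)) (min_le_right _ _)
        (le_min (hτ.nn p) hs) (min_le_min_right _ (hle p))) (abs_nonneg _)
        ((abs_nonneg _).trans (hC p))
      split_ifs
      · exact hC p
      · simpa using (abs_nonneg _).trans (hC p)
    · filter_upwards [hBO] with p hp
      have h2 := hp.2
      have h3 : ∀ᶠ m in atTop, rho hT m 1 p = T := by
        rw [Metric.tendsto_nhds] at h2
        filter_upwards [h2 (1/2) (by norm_num)] with m hm
        by_contra h'
        have h4 : rho hT m 1 p < T := lt_of_le_of_ne ((rho_Stp hT m 1).le p) h'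
        obtain ⟨u, hu, _, h5⟩ := (hit_lt_iff hT le_rfl).1 h4
        have h6 := (ContinuousMap.dist_apply_le_dist (f := SmP hT m p.1) (g := half hT p) ⟨u, hu⟩)
        rw [← ev_coe hT, ← ev_coe hT, ev_SmP hT m _ hu, ev_half hT p hu, Real.dist_eq] at h6
        have h7 := h6.trans_lt hm
        simp only [Lm] at h5
        rw [lt_abs] at h5
        rw [abs_lt] at h7
        rcases h5 with h5 | h5 <;> linarith
      have h5 : ∀ u ∈ Icc (0:ℝ) T, Tendsto (fun m => Sm T hT m u p.1) atTop
          (𝓝 ((ev T hT p.1 u ^ 2 - ev T hT p.1 0 ^ 2 - ev T hT p.2 u) / 2)) := by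
        intro u hu
        have := ((ev_cont_p hT u).tendsto _).comp h2
        rw [ev_half hT p hu] at this
        refine this.congr fun m => ?_
        simp only [Function.comp, ev_SmP hT m _ hu]
      have h6 := ((h5 _ ⟨hκ.nn p, hκ.le p⟩).sub (h5 _ ⟨hτ.nn p, hτ.le p⟩)).const_mul (h p)
      refine Tendsto.congr' ?_ (h6.trans (le_of_eq (by congr 2; unfold XX; ring)))
      filter_upwards [h3] with m hm
      rw [hm, min_eq_left (hκ.le p), min_eq_left (hτ.le p), if_pos (hτ.le p)]
  have h0 : ∀ m, ∫ p, (if τ p ≤ rho hT m 1 p then h p else 0) *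
      (Sm T hT m (min (κ p) (rho hT m 1 p)) p.1 -
      Sm T hT m (min (τ p) (rho hT m 1 p)) p.1) ∂Q = 0 := by
    intro m
    refine Sm_lp' hT hN h1 (hτ.min (rho_Stp hT m 1)) (hκ.min (rho_Stp hT m 1))
      (fun p => min_le_min_right _ (hle p)) (fun p => (min_le_left _ _).trans (hκR p))
      (MA.ite_le hτ (rho_Stp hT m 1) hh) (C := C) (fun p => ?_) m (fun p => min_le_right _ _)
    split_ifs
    · exact hC p
    · simpa using (abs_nonneg _).trans (hC p)
  simp only [h0] at hlim
  have h2 := tendsto_nhds_unique hlim tendsto_const_nhds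
  have e : (fun p => h p * ((XX hT p (κ p) - XX hT p (τ p)) / 2)) =
      fun p => (1/2) * (h p * (XX hT p (κ p) - XX hT p (τ p))) := by ext p; ring
  rw [e, integral_const_mul] at h2
  linarith

end LPsec

section Energy

variable {T : ℝ} (hT : 0 ≤ T)

lemma fatou_real {α : Type*} {mα : MeasurableSpace α} {Q : Measure α} {f : ℕ → α → ℝ} {F : α → ℝ}
    {c : ℝ} (hm : ∀ n, Integrable (f n) Q) (h0 : ∀ n, ∀ᵐ p ∂Q, 0 ≤ f n p)
    (hc : ∀ n, ∫ p, f n p ∂Q ≤ c) (hlim : ∀ᵐ p ∂Q, Tendsto (fun n => f n p) atTop (𝓝 (F p))) :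
    Integrable F Q ∧ ∫ p, F p ∂Q ≤ c := by
  have hF0 : 0 ≤ᵐ[Q] F := by
    filter_upwards [hlim, ae_all_iff.2 h0] with p hp h0
    exact ge_of_tendsto' hp h0
  have hFm : AEStronglyMeasurable F Q :=
    aestronglyMeasurable_of_tendsto_ae atTop (fun n => (hm n).aestronglyMeasurable) hlim
  have hc0 : 0 ≤ c := (integral_nonneg_of_ae (h0 0)).trans (hc 0)
  have h1 : ∫⁻ p, ENNReal.ofReal (F p) ∂Q ≤ ENNReal.ofReal c := by
    calc ∫⁻ p, ENNReal.ofReal (F p) ∂Q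
        = ∫⁻ p, liminf (fun n => ENNReal.ofReal (f n p)) atTop ∂Q := by
          refine lintegral_congr_ae ?_
          filter_upwards [hlim] with p hp
          exact ((ENNReal.continuous_ofReal.tendsto _).comp hp).liminf_eq.symm
      _ ≤ liminf (fun n => ∫⁻ p, ENNReal.ofReal (f n p) ∂Q) atTop :=
          lintegral_liminf_le' fun n => (hm n).aestronglyMeasurable.aemeasurable.ennreal_ofReal
      _ ≤ ENNReal.ofReal c := by
          refine liminf_le_of_frequently_le' (Frequently.of_forall fun n => ?_)
          rw [← ofReal_integral_eq_lintegral_ofReal (hm n) (h0 n)]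
          exact ENNReal.ofReal_le_ofReal (hc n)
  have hint : Integrable F Q := by
    refine ⟨hFm, ?_⟩
    rw [hasFiniteIntegral_iff_ofReal hF0]
    exact h1.trans_lt ENNReal.ofReal_lt_top
  refine ⟨hint, ?_⟩
  rw [← ofReal_integral_eq_lintegral_ofReal hint hF0] at h1
  exact (ENNReal.ofReal_le_ofReal_iff hc0).1 h1

lemma kap_bds {R : ℝ} {p : PathPair T} {a b : ℝ} (ha : 0 ≤ a) (hab : a ≤ b)
    (hb : b ≤ kap hT R p) (h : 0 < b) :
    |ev T hT p.1 a| ≤ R ∧ |ev T hT p.2 a| ≤ R := by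
  have h1 : UU hT p a ≤ R := UU_le_kap hT ha (hab.trans hb) (h.trans_le hb)
  exact ⟨(ev1_le_UU hT p a).trans h1, (ev2_le_UU hT p a).trans h1⟩

lemma S_diff_bdd {R : ℝ} {p : PathPair T} {a b : ℝ} (ha : 0 ≤ a) (hab : a ≤ b)
    (hb : b ≤ kap hT R p) : |ev T hT p.1 b - ev T hT p.1 a| ≤ 2 * |R| ∧
    |ev T hT p.2 b - ev T hT p.2 a| ≤ 2 * |R| ∧ |XX hT p b - XX hT p a| ≤ 2 * (R ^ 2 + |R|) := by
  rcases (ha.trans hab).lt_or_eq with h | h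
  · obtain ⟨h1, h2⟩ := kap_bds hT ha hab hb h
    obtain ⟨h3, h4⟩ := kap_bds hT (ha.trans hab) le_rfl hb h
    have hR := le_abs_self R
    have h7 : ev T hT p.1 a ^ 2 ≤ R ^ 2 := by
      rw [← sq_abs]; exact pow_le_pow_left₀ (abs_nonneg _) h1 2
    have h8 : ev T hT p.1 b ^ 2 ≤ R ^ 2 := by
      rw [← sq_abs]; exact pow_le_pow_left₀ (abs_nonneg _) h3 2
    have h9 := sq_nonneg (ev T hT p.1 a)
    have h10 := sq_nonneg (ev T hT p.1 b)
    unfold XX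
    rw [abs_le] at h1 h2 h3 h4
    refine ⟨?_, ?_, ?_⟩ <;> rw [abs_le] <;> constructor <;> linarith
  · have : a = b := by linarith
    subst this
    simp; positivity

variable {Q : Measure (PathPair T)} [IsProbabilityMeasure Q]

lemma bdd_int {f : PathPair T → ℝ} (hf : Measurable f) {C : ℝ} (h : ∀ p, |f p| ≤ C) :
    Integrable f Q :=
  Integrable.mono' (integrable_const C) hf.aestronglyMeasurable (ae_of_all _ h)

lemma energy (hN : Integrable (fun p : PathPair T => ‖p.1‖ + ‖p.2‖) Q) (h1 : LP1 hT Q)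
    (h2 : LP2 hT Q)
    {R : ℝ} {α β h : PathPair T → ℝ} {C : ℝ} (hα : Stp hT α) (hβ : Stp hT β)
    (hle : ∀ p, α p ≤ β p) (hβR : ∀ p, β p ≤ kap hT R p) (hh : MA hT α h) (hC : ∀ p, |h p| ≤ C) :
    ∫ p, h p * (ev T hT p.1 (β p) - ev T hT p.1 (α p)) ^ 2 ∂Q =
      ∫ p, h p * (ev T hT p.2 (β p) - ev T hT p.2 (α p)) ∂Q := by
  have hx := h2 R α β h C hα hβ hle hβR hh hC
  have hcm : MA hT α (fun p => h p * clip |R| (ev T hT p.1 (α p))) :=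
    hh.mul ((MA.ev1 hα).comp (clip_meas _))
  have hcb : ∀ p, |h p * clip |R| (ev T hT p.1 (α p))| ≤ C * |R| := fun p => by
    rw [abs_mul]
    exact mul_le_mul (hC p) (clip_abs (abs_nonneg R) _) (abs_nonneg _) ((abs_nonneg _).trans (hC p))
  have hs := h1 α β _ _ hα hβ hle hcm hcb
  have e : ∀ p, h p * (ev T hT p.1 (β p) - ev T hT p.1 (α p)) ^ 2 =
      (h p * (XX hT p (β p) - XX hT p (α p)) +
      h p * (ev T hT p.2 (β p) - ev T hT p.2 (α p))) -
      2 * (h p * clip |R| (ev T hT p.1 (α p)) * (ev T hT p.1 (β p) - ev T hT p.1 (α p))) := by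
    intro p
    rcases (hle p).lt_or_eq with hlt | heq
    · have := (kap_bds hT (hα.nn p) (hle p) (hβR p) ((hα.nn p).trans_lt hlt)).1
      rw [clip_eq (this.trans (le_abs_self R))]
      unfold XX; ring
    · rw [heq]; ring
  simp_rw [e]
  have m1 := fun {σ} (hσ : Stp hT σ) => ev_meas hT (measurable_fst (α := Path T) (β := Path T)) hσ.meas
  have m2 := fun {σ} (hσ : Stp hT σ) => ev_meas hT (measurable_snd (α := Path T) (β := Path T)) hσ.meas
  have i1 : Integrable (fun p => h p * (XX hT p (β p) - XX hT p (α p))) Q := by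
    refine bdd_mul_int (bdd_int ?_ fun p => (S_diff_bdd hT (hα.nn p) (hle p) (hβR p)).2.2) hh.meas hC
    unfold XX
    exact (((m1 hβ).pow_const 2).sub (m2 hβ)).sub (((m1 hα).pow_const 2).sub (m2 hα))
  have i2 : Integrable (fun p => h p * (ev T hT p.2 (β p) - ev T hT p.2 (α p))) Q :=
    bdd_mul_int ((ev2_int hT hN hβ.meas).sub (ev2_int hT hN hα.meas)) hh.meas hC
  have i3 : Integrable (fun p => h p * clip |R| (ev T hT p.1 (α p)) *
      (ev T hT p.1 (β p) - ev T hT p.1 (α p))) Q :=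
    bdd_mul_int ((ev1_int hT hN hβ.meas).sub (ev1_int hT hN hα.meas)) hcm.meas hcb
  have i12 : Integrable (fun p => h p * (XX hT p (β p) - XX hT p (α p)) +
      h p * (ev T hT p.2 (β p) - ev T hT p.2 (α p))) Q := i1.add i2
  rw [integral_sub i12 (i3.const_mul 2), integral_add i1 i2, integral_const_mul, hx, hs]
  ring

lemma kap_eventually (p : PathPair T) : ∀ᶠ n : ℕ in atTop, kap hT n p = T := by
  obtain ⟨N, hN⟩ := exists_nat_ge (‖p.1‖ + ‖p.2‖)
  filter_upwards [eventually_ge_atTop N] with n hn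
  exact kap_eq hT (hN.trans (by exact_mod_cast hn))

lemma kap_mono {R R' : ℝ} (h : R ≤ R') (p : PathPair T) : kap hT R p ≤ kap hT R' p := by
  refine le_csInf ⟨T, Or.inr rfl⟩ ?_
  rintro u (hu | hu)
  · exact csInf_le (hit_bdd (fun u p => UU hT p u) R p hT) (Or.inl ⟨hu.1, h.trans_lt hu.2⟩)
  · rw [mem_singleton_iff.1 hu]; exact hit_le hT _ _ _

/-- indicator of a bounded initial value -/
def gK (K : ℝ) (p : PathPair T) : ℝ := if |ev T hT p.1 0| ≤ K then 1 else 0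

lemma gK_MA (K : ℝ) {τ : PathPair T → ℝ} (hτ : Stp hT τ) : MA hT τ (gK hT K) := by
  have h0 : MA hT τ (fun p => ev T hT p.1 0) :=
    (MA.ev1 (Stp.const le_rfl hT)).mono (τ := fun _ => 0) hτ.nn
  refine MA.comp (φ := fun x => if |x| ≤ K then (1:ℝ) else 0) ?_ h0
  exact Measurable.ite (measurableSet_le measurable_id.abs measurable_const) measurable_const
    measurable_const

lemma gK_cases (K : ℝ) (p : PathPair T) : gK hT K p = 0 ∨ gK hT K p = 1 := by
  unfold gK; split_ifs <;> simp

lemma gK_abs (K : ℝ) (p : PathPair T) : |gK hT K p| ≤ 1 := by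
  rcases gK_cases hT K p with h | h <;> rw [h] <;> simp

lemma gK_nn (K : ℝ) (p : PathPair T) : 0 ≤ gK hT K p := by
  rcases gK_cases hT K p with h | h <;> rw [h] <;> simp

lemma V_conv (hN : Integrable (fun p : PathPair T => ‖p.1‖ + ‖p.2‖) Q) {σ : PathPair T → ℝ}
    (hσ : Stp hT σ) : Tendsto (fun n : ℕ => ∫ p, |ev T hT p.2 (σ p) -
      ev T hT p.2 (min (σ p) (kap hT n p))| ∂Q) atTop (𝓝 0) := by
  let σn : ℕ → PathPair T → ℝ := fun n p => min (σ p) (kap hT n p)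
  have hσn : ∀ n, Stp hT (σn n) := fun n => hσ.min (kap_Stp hT n)
  have hcv : ∀ p, ∀ᶠ N in atTop, σn N p = σ p := by
    intro p
    filter_upwards [kap_eventually hT p] with N hN
    simp only [σn, hN, min_eq_left (hσ.le p)]
  rw [← integral_zero (PathPair T) ℝ (μ := Q)]
  refine tendsto_integral_of_dominated_convergence (fun p => 2 * (‖p.1‖ + ‖p.2‖))
    (fun N => ((ev2_int hT hN hσ.meas).sub (ev2_int hT hN (hσn N).meas)).abs.aestronglyMeasurable)
    (hN.const_mul 2) ?_ ?_
  · intro N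
    refine ae_of_all _ fun p => ?_
    have a1 := ev_abs_le hT p.2 (σ p)
    have a2 := ev_abs_le hT p.2 (σn N p)
    have a3 := norm_nonneg p.1
    rw [Real.norm_eq_abs, abs_abs]
    rw [abs_le] at *; constructor <;> linarith
  · refine ae_of_all _ fun p => tendsto_const_nhds.congr' ?_
    filter_upwards [hcv p] with N h
    have h' : min (σ p) (kap hT N p) = σ p := h
    rw [h']; simp

lemma sq_conv (hN : Integrable (fun p : PathPair T => ‖p.1‖ + ‖p.2‖) Q) (h1 : LP1 hT Q)
    (h2 : LP2 hT Q) (K : ℝ) {σ : PathPair T → ℝ} (hσ : Stp hT σ) :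
    Integrable (fun p => gK hT K p * ev T hT p.1 (σ p) ^ 2) Q ∧
    Tendsto (fun n : ℕ => ∫ p, |gK hT K p * ev T hT p.1 (σ p) ^ 2 -
      gK hT K p * ev T hT p.1 (min (σ p) (kap hT n p)) ^ 2| ∂Q) atTop (𝓝 0) := by
  let σn : ℕ → PathPair T → ℝ := fun n p => min (σ p) (kap hT n p)
  have hσn : ∀ n, Stp hT (σn n) := fun n => hσ.min (kap_Stp hT n)
  have gm : Measurable (gK hT K) := (gK_MA hT K hσ).meas
  have m1 := fun {σ} (hσ : Stp hT σ) => ev_meas hT (measurable_fst (α := Path T) (β := Path T)) hσ.meas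
  have hiV : ∀ n N, Integrable (fun p => gK hT K p * (ev T hT p.2 (σn N p) - ev T hT p.2 (σn n p))) Q :=
    fun n N => bdd_mul_int ((ev2_int hT hN (hσn N).meas).sub (ev2_int hT hN (hσn n).meas)) gm (gK_abs hT K)
  have hcv : ∀ p, ∀ᶠ N in atTop, σn N p = σ p := by
    intro p
    filter_upwards [kap_eventually hT p] with N hN
    simp only [σn, hN, min_eq_left (hσ.le p)]
  -- L² bound
  have key : ∀ n, Integrable (fun p => gK hT K p * (ev T hT p.1 (σ p) - ev T hT p.1 (σn n p)) ^ 2) Q ∧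
      ∫ p, gK hT K p * (ev T hT p.1 (σ p) - ev T hT p.1 (σn n p)) ^ 2 ∂Q ≤
      ∫ p, |ev T hT p.2 (σ p) - ev T hT p.2 (σn n p)| ∂Q + 0 := by
    intro n
    have e : ∀ N, n ≤ N → ∫ p, gK hT K p * (ev T hT p.1 (σn N p) - ev T hT p.1 (σn n p)) ^ 2 ∂Q =
        ∫ p, gK hT K p * (ev T hT p.2 (σn N p) - ev T hT p.2 (σn n p)) ∂Q := fun N hnN =>
      energy hT hN h1 h2 (R := N) (hσn n) (hσn N)
        (fun p => min_le_min_left _ (kap_mono hT (by exact_mod_cast hnN) p))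
        (fun p => min_le_right _ _) (gK_MA hT K (hσn n)) (gK_abs hT K)
    have hV : Tendsto (fun N => ∫ p, gK hT K p * (ev T hT p.2 (σn N p) - ev T hT p.2 (σn n p)) ∂Q)
        atTop (𝓝 (∫ p, gK hT K p * (ev T hT p.2 (σ p) - ev T hT p.2 (σn n p)) ∂Q)) := by
      refine tendsto_integral_of_dominated_convergence (fun p => 2 * (‖p.1‖ + ‖p.2‖))
        (fun N => (hiV n N).aestronglyMeasurable) (hN.const_mul 2) ?_ ?_
      · intro N
        refine ae_of_all _ fun p => ?_
        have a1 := ev_abs_le hT p.2 (σn N p)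
        have a2 := ev_abs_le hT p.2 (σn n p)
        have a3 := norm_nonneg p.1
        rw [norm_mul, Real.norm_eq_abs, Real.norm_eq_abs]
        have a4 : |ev T hT p.2 (σn N p) - ev T hT p.2 (σn n p)| ≤ 2 * (‖p.1‖ + ‖p.2‖) := by
          rw [abs_le] at *; constructor <;> linarith
        calc _ ≤ 1 * (2 * (‖p.1‖ + ‖p.2‖)) :=
              mul_le_mul (gK_abs hT K p) a4 (abs_nonneg _) zero_le_one
          _ = _ := one_mul _
      · refine ae_of_all _ fun p => tendsto_const_nhds.congr' ?_
        filter_upwards [hcv p] with N h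
        rw [h]
    have hle : ∫ p, gK hT K p * (ev T hT p.2 (σ p) - ev T hT p.2 (σn n p)) ∂Q ≤
        ∫ p, |ev T hT p.2 (σ p) - ev T hT p.2 (σn n p)| ∂Q := by
      refine integral_mono (bdd_mul_int ((ev2_int hT hN hσ.meas).sub (ev2_int hT hN (hσn n).meas)) gm
        (gK_abs hT K)) ((ev2_int hT hN hσ.meas).sub (ev2_int hT hN (hσn n).meas)).abs fun p => ?_
      rcases gK_cases hT K p with h | h
      · simp [h]
      · simp only [h, one_mul]; exact le_abs_self _
    have hsq : ∀ N, n ≤ N → Integrable (fun p => gK hT K p *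
        (ev T hT p.1 (σn N p) - ev T hT p.1 (σn n p)) ^ 2) Q := by
      intro N hnN
      refine bdd_mul_int (bdd_int (((m1 (hσn N)).sub (m1 (hσn n))).pow_const 2)
        (C := (2 * |(N:ℝ)|) ^ 2) fun p => ?_) gm (gK_abs hT K)
      rw [abs_pow]
      exact pow_le_pow_left₀ (abs_nonneg _) (S_diff_bdd hT (hσn n |>.nn p)
        (min_le_min_left _ (kap_mono hT (by exact_mod_cast hnN) p)) (min_le_right _ _)).1 2
    have hsmall : ∀ δ > 0, Integrable (fun p => gK hT K p * (ev T hT p.1 (σ p) - ev T hT p.1 (σn n p)) ^ 2) Q ∧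
      ∫ p, gK hT K p * (ev T hT p.1 (σ p) - ev T hT p.1 (σn n p)) ^ 2 ∂Q ≤
      ∫ p, |ev T hT p.2 (σ p) - ev T hT p.2 (σn n p)| ∂Q + δ := by
      intro δ hδ
      obtain ⟨N0, hN0⟩ := eventually_atTop.1 (hV.eventually (eventually_lt_nhds (lt_of_le_of_lt hle
        (lt_add_of_pos_right _ hδ))))
      refine fatou_real (f := fun j p => gK hT K p *
        (ev T hT p.1 (σn (n + N0 + j) p) - ev T hT p.1 (σn n p)) ^ 2)
        (fun j => hsq _ (by omega)) (fun j => ae_of_all _ fun p =>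
          mul_nonneg (gK_nn hT K p) (sq_nonneg _)) (fun j => ?_) (ae_of_all _ fun p => ?_)
      · rw [e _ (by omega)]
        exact (hN0 _ (by omega)).le
      · refine tendsto_const_nhds.congr' ?_
        obtain ⟨M, hM⟩ := eventually_atTop.1 (hcv p)
        filter_upwards [eventually_ge_atTop M] with j hj
        have := hM (n + N0 + j) (by omega)
        simp only [this]
    exact ⟨(hsmall 1 one_pos).1, le_of_forall_pos_le_add fun δ hδ => by
      simpa using (hsmall δ hδ).2⟩
  have hε := V_conv hT hN hσ
  -- second moments
  let C1 : ℝ := K ^ 2 + ∫ p, 2 * (‖p.1‖ + ‖p.2‖) ∂Q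
  have hbsq : ∀ n, Integrable (fun p => gK hT K p * ev T hT p.1 (σn n p) ^ 2) Q := by
    intro n
    refine bdd_int (gm.mul ((m1 (hσn n)).pow_const 2)) (C := (|K| + 2 * |(n:ℝ)|) ^ 2) fun p => ?_
    have := (S_diff_bdd hT le_rfl (hσn n |>.nn p) (min_le_right _ _ : σn n p ≤ kap hT n p)).1
    unfold gK
    split_ifs with h
    · rw [one_mul, abs_pow]
      refine pow_le_pow_left₀ (abs_nonneg _) ?_ 2
      have h' := h.trans (le_abs_self K)
      rw [abs_le] at this h' ⊢
      constructor <;> linarith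
    · simp; positivity
  have hb1 : ∀ n, ∫ p, gK hT K p * ev T hT p.1 (σn n p) ^ 2 ∂Q ≤ C1 := by
    intro n
    have e := h2 n (fun _ => 0) (σn n) (gK hT K) 1 (Stp.const le_rfl hT) (hσn n) (hσn n).nn
      (fun p => min_le_right _ _) (gK_MA hT K (Stp.const le_rfl hT)) (gK_abs hT K)
    have e2 : ∀ p, gK hT K p * ev T hT p.1 (σn n p) ^ 2 ≤
        gK hT K p * (XX hT p (σn n p) - XX hT p 0) + (K ^ 2 + 2 * (‖p.1‖ + ‖p.2‖)) := by
      intro p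
      have a1 := ev_abs_le hT p.2 (σn n p)
      have a2 := ev_abs_le hT p.2 0
      have a3 := norm_nonneg p.1
      have a4 := norm_nonneg p.2
      rw [abs_le] at a1 a2
      unfold gK XX
      split_ifs with h
      · have : ev T hT p.1 0 ^ 2 ≤ K ^ 2 := by
          rw [← sq_abs]; exact pow_le_pow_left₀ (abs_nonneg _) h 2
        linarith
      · nlinarith [sq_nonneg K]
    have i1 : Integrable (fun p => gK hT K p * (XX hT p (σn n p) - XX hT p 0)) Q := by
      refine bdd_mul_int (bdd_int ?_ fun p => (S_diff_bdd hT le_rfl (hσn n |>.nn p)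
        (min_le_right _ _ : σn n p ≤ kap hT n p)).2.2) gm (gK_abs hT K)
      have m2 := fun {σ} (hσ : Stp hT σ) => ev_meas hT (measurable_snd (α := Path T) (β := Path T)) hσ.meas
      have h0 : Stp hT (fun _ => 0) := Stp.const le_rfl hT
      unfold XX
      exact (((m1 (hσn n)).pow_const 2).sub (m2 (hσn n))).sub (((m1 h0).pow_const 2).sub (m2 h0))
    have i2 : Integrable (fun p : PathPair T => K ^ 2 + 2 * (‖p.1‖ + ‖p.2‖)) Q :=
      (integrable_const _).add (hN.const_mul 2)
    calc _ ≤ ∫ p, (gK hT K p * (XX hT p (σn n p) - XX hT p 0) + (K ^ 2 + 2 * (‖p.1‖ + ‖p.2‖))) ∂Q :=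
          integral_mono (hbsq n) (i1.add i2) e2
      _ = C1 := by
          rw [integral_add i1 i2, e, integral_add (integrable_const _) (hN.const_mul 2)]
          simp [C1]
  have hC1 : 0 ≤ C1 := by
    refine (integral_nonneg fun p => ?_).trans (hb1 0)
    exact mul_nonneg (gK_nn hT K p) (sq_nonneg _)
  have hin : Integrable (fun p => gK hT K p * ev T hT p.1 (σ p) ^ 2) Q := by
    refine Integrable.mono' (((key 0).1.const_mul 2).add ((hbsq 0).const_mul 2))
      (gm.mul ((m1 hσ).pow_const 2)).aestronglyMeasurable (ae_of_all _ fun p => ?_)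
    rw [Real.norm_eq_abs, abs_of_nonneg (mul_nonneg (gK_nn hT K p) (sq_nonneg _))]
    simp only [Pi.add_apply]
    rcases gK_cases hT K p with h | h <;> rw [h]
    · simp
    · nlinarith [sq_nonneg (ev T hT p.1 (σ p) - 2 * ev T hT p.1 (σn 0 p))]
  refine ⟨hin, ?_⟩
  have hup : ∀ n, ∀ η > 0, ∫ p, |gK hT K p * ev T hT p.1 (σ p) ^ 2 -
      gK hT K p * ev T hT p.1 (σn n p) ^ 2| ∂Q ≤
      (1 + 1 / η) * ∫ p, |ev T hT p.2 (σ p) - ev T hT p.2 (σn n p)| ∂Q + η * C1 := by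
    intro n η hη
    have e : ∀ p, |gK hT K p * ev T hT p.1 (σ p) ^ 2 - gK hT K p * ev T hT p.1 (σn n p) ^ 2| ≤
        (1 + 1 / η) * (gK hT K p * (ev T hT p.1 (σ p) - ev T hT p.1 (σn n p)) ^ 2) +
        η * (gK hT K p * ev T hT p.1 (σn n p) ^ 2) := by
      intro p
      rcases gK_cases hT K p with h | h <;> rw [h]
      · simp
      · set x := ev T hT p.1 (σ p)
        set y := ev T hT p.1 (σn n p)
        have e1 : (1 + 1/η) * (1 * (x - y) ^ 2) + η * (1 * y ^ 2) =
          (x - y) ^ 2 + ((x-y) ^ 2 + (η * y) ^ 2) / η := by field_simp; ring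
        have e2 : 2 * |(x - y) * y| ≤ ((x-y) ^ 2 + (η * y) ^ 2) / η := by
          rw [le_div_iff₀ hη]
          have := two_mul_le_add_sq |x - y| |η * y|
          rw [sq_abs, sq_abs, abs_mul, abs_of_pos hη] at this
          rw [abs_mul]
          linarith
        rw [e1]
        have e3 : 1 * x ^ 2 - 1 * y ^ 2 = (x - y) ^ 2 + 2 * ((x - y) * y) := by ring
        rw [e3]
        refine (abs_add_le _ _).trans ?_
        rw [abs_of_nonneg (sq_nonneg (x - y)), abs_mul, abs_two]
        linarith
    have i1 := (key n).1.const_mul (1 + 1 / η)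
    have i2 := (hbsq n).const_mul η
    have := integral_mono (hin.sub (hbsq n)).abs (i1.add i2) e
    refine this.trans ?_
    simp only [Pi.add_apply]
    rw [integral_add i1 i2, integral_const_mul, integral_const_mul]
    have a1 := (key n).2
    rw [add_zero] at a1
    have a2 : 0 ≤ 1 + 1 / η := by positivity
    exact add_le_add (mul_le_mul_of_nonneg_left a1 a2) (mul_le_mul_of_nonneg_left (hb1 n) hη.le)
  rw [Metric.tendsto_atTop]
  intro δ hδ
  obtain ⟨η, hη, hηC⟩ : ∃ η > 0, η * C1 < δ / 2 :=
    ⟨δ / (4 * (C1 + 1)), by positivity, by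
      rw [div_mul_eq_mul_div, div_lt_div_iff₀ (by positivity) (by positivity)]; nlinarith⟩
  have h3 : Tendsto (fun n => (1 + 1 / η) * ∫ p, |ev T hT p.2 (σ p) - ev T hT p.2 (σn n p)| ∂Q)
      atTop (𝓝 0) := by simpa using hε.const_mul (1 + 1 / η)
  obtain ⟨N, hN⟩ := eventually_atTop.1 (h3.eventually (eventually_lt_nhds (half_pos hδ)))
  refine ⟨N, fun n hn => ?_⟩
  rw [Real.dist_eq, sub_zero, abs_of_nonneg (integral_nonneg fun p => abs_nonneg _)]
  have := hup n η hη
  have := hN n hn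
  linarith

end Energy

section Weak

variable {T : ℝ} (hT : 0 ≤ T)

lemma int4 {α : Type*} {mα : MeasurableSpace α} {Q : Measure α} {f a b c d : α → ℝ} {C : ℝ}
    (hf : Integrable f Q) (ha : Integrable a Q) (hb : Integrable b Q) (hc : Integrable c Q)
    (hd : Integrable d Q) (h : ∀ p, |f p| ≤ C * ((a p + b p) + (c p + d p))) :
    |∫ p, f p ∂Q| ≤ C * (((∫ p, a p ∂Q) + ∫ p, b p ∂Q) + ((∫ p, c p ∂Q) + ∫ p, d p ∂Q)) := by
  have h1 : Integrable (fun p => a p + b p) Q := ha.add hb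
  have h2 : Integrable (fun p => c p + d p) Q := hc.add hd
  rw [← integral_add ha hb, ← integral_add hc hd, ← integral_add h1 h2, ← integral_const_mul]
  exact abs_integral_le_integral_abs.trans (integral_mono hf.abs ((h1.add h2).const_mul C) h)

lemma XX_full {Q : Measure (PathPair T)} [IsProbabilityMeasure Q]
    (hN : Integrable (fun p : PathPair T => ‖p.1‖ + ‖p.2‖) Q) (h1 : LP1 hT Q)
    (h2 : LP2 hT Q) (K : ℝ) {τ κ h : PathPair T → ℝ} {C : ℝ} (hτ : Stp hT τ) (hκ : Stp hT κ)
    (hle : ∀ p, τ p ≤ κ p) (hh : MA hT τ h) (hC : ∀ p, |h p| ≤ C) :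
    Integrable (fun p => gK hT K p * (h p * (XX hT p (κ p) - XX hT p (τ p)))) Q ∧
    ∫ p, gK hT K p * (h p * (XX hT p (κ p) - XX hT p (τ p))) ∂Q = 0 := by
  have gm : Measurable (gK hT K) := (gK_MA hT K hτ).meas
  have hC0 : 0 ≤ C := (abs_nonneg _).trans (hC (0, 0))
  have IX : ∀ σ, Stp hT σ → Integrable (fun p => gK hT K p * XX hT p (σ p)) Q := by
    intro σ hσ
    have := (sq_conv hT hN h1 h2 K hσ).1.sub (bdd_mul_int (ev2_int hT hN hσ.meas) gm (gK_abs hT K))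
    refine this.congr (ae_of_all _ fun p => ?_)
    simp only [XX, Pi.sub_apply]; ring
  have IF : ∀ τ κ, Stp hT τ → Stp hT κ →
      Integrable (fun p => gK hT K p * (h p * (XX hT p (κ p) - XX hT p (τ p)))) Q := by
    intro τ κ hτ hκ
    refine (bdd_mul_int ((IX κ hκ).sub (IX τ hτ)) hh.meas hC).congr (ae_of_all _ fun p => ?_)
    simp only [Pi.sub_apply]; ring
  refine ⟨IF τ κ hτ hκ, ?_⟩
  let tn : ℕ → PathPair T → ℝ := fun n p => min (τ p) (kap hT n p)
  let kn : ℕ → PathPair T → ℝ := fun n p => min (κ p) (kap hT n p)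
  have htn : ∀ n, Stp hT (tn n) := fun n => hτ.min (kap_Stp hT n)
  have hkn : ∀ n, Stp hT (kn n) := fun n => hκ.min (kap_Stp hT n)
  have hz : ∀ n, ∫ p, gK hT K p * (h p * (XX hT p (kn n p) - XX hT p (tn n p))) ∂Q = 0 := by
    intro n
    have := h2 n (tn n) (kn n) (fun p => gK hT K p * (if τ p ≤ kap hT n p then h p else 0)) (1 * C)
      (htn n) (hkn n) (fun p => min_le_min_right _ (hle p)) (fun p => min_le_right _ _)
      ((gK_MA hT K (htn n)).mul (MA.ite_le hτ (kap_Stp hT n) hh)) (fun p => by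
        rw [abs_mul]
        refine mul_le_mul (gK_abs hT K p) ?_ (abs_nonneg _) zero_le_one
        split_ifs
        · exact hC p
        · simpa using hC0)
    rw [← this]
    refine integral_congr_ae (ae_of_all _ fun p => ?_)
    simp only
    split_ifs with hc
    · ring
    · have e1 : tn n p = kap hT n p := min_eq_right (not_le.1 hc).le
      have e2 : kn n p = kap hT n p := min_eq_right ((not_le.1 hc).le.trans (hle p))
      rw [e1, e2]; ring
  have lim : Tendsto (fun n : ℕ => C * (((∫ p, |gK hT K p * ev T hT p.1 (κ p) ^ 2 -
      gK hT K p * ev T hT p.1 (kn n p) ^ 2| ∂Q) + ∫ p, |gK hT K p * ev T hT p.1 (τ p) ^ 2 -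
      gK hT K p * ev T hT p.1 (tn n p) ^ 2| ∂Q) + ((∫ p, |ev T hT p.2 (κ p) - ev T hT p.2 (kn n p)| ∂Q)
      + ∫ p, |ev T hT p.2 (τ p) - ev T hT p.2 (tn n p)| ∂Q))) atTop (𝓝 0) := by
    simpa using (((sq_conv hT hN h1 h2 K hκ).2.add (sq_conv hT hN h1 h2 K hτ).2).add
      ((V_conv hT hN hκ).add (V_conv hT hN hτ))).const_mul C
  have hb : ∀ n, |∫ p, gK hT K p * (h p * (XX hT p (κ p) - XX hT p (τ p))) ∂Q| ≤
      C * (((∫ p, |gK hT K p * ev T hT p.1 (κ p) ^ 2 -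
      gK hT K p * ev T hT p.1 (kn n p) ^ 2| ∂Q) + ∫ p, |gK hT K p * ev T hT p.1 (τ p) ^ 2 -
      gK hT K p * ev T hT p.1 (tn n p) ^ 2| ∂Q) + ((∫ p, |ev T hT p.2 (κ p) - ev T hT p.2 (kn n p)| ∂Q)
      + ∫ p, |ev T hT p.2 (τ p) - ev T hT p.2 (tn n p)| ∂Q)) := by
    intro n
    have IA := ((sq_conv hT hN h1 h2 K hκ).1.sub (sq_conv hT hN h1 h2 K (hkn n)).1).abs
    have IB := ((sq_conv hT hN h1 h2 K hτ).1.sub (sq_conv hT hN h1 h2 K (htn n)).1).abs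
    have IC := ((ev2_int hT hN hκ.meas).sub (ev2_int hT hN (hkn n).meas)).abs
    have ID := ((ev2_int hT hN hτ.meas).sub (ev2_int hT hN (htn n).meas)).abs
    have e : ∫ p, gK hT K p * (h p * (XX hT p (κ p) - XX hT p (τ p))) ∂Q =
        ∫ p, (gK hT K p * (h p * (XX hT p (κ p) - XX hT p (τ p))) -
          gK hT K p * (h p * (XX hT p (kn n p) - XX hT p (tn n p)))) ∂Q := by
      rw [integral_sub (IF τ κ hτ hκ) (IF _ _ (htn n) (hkn n)), hz n, sub_zero]
    rw [e]
    refine int4 ((IF τ κ hτ hκ).sub (IF _ _ (htn n) (hkn n))) IA IB IC ID fun p => ?_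
    rcases gK_cases hT K p with hg | hg <;> rw [hg]
    · simp only [zero_mul, sub_zero, abs_zero]; positivity
    · simp only [one_mul, XX]
      rw [← mul_sub, abs_mul]
      refine mul_le_mul (hC p) ?_ (abs_nonneg _) hC0
      generalize ev T hT p.1 (κ p) ^ 2 = a1
      generalize ev T hT p.1 (τ p) ^ 2 = a2
      generalize ev T hT p.1 (kn n p) ^ 2 = a3
      generalize ev T hT p.1 (tn n p) ^ 2 = a4
      generalize ev T hT p.2 (κ p) = b1
      generalize ev T hT p.2 (τ p) = b2
      generalize ev T hT p.2 (kn n p) = b3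
      generalize ev T hT p.2 (tn n p) = b4
      have := abs_le.1 (le_refl |a1 - a3|)
      have := abs_le.1 (le_refl |a2 - a4|)
      have := abs_le.1 (le_refl |b1 - b3|)
      have := abs_le.1 (le_refl |b2 - b4|)
      rw [abs_le]; constructor <;> linarith
  have := ge_of_tendsto' lim hb
  exact abs_nonpos_iff.1 this

lemma Fraw_le (t : ℝ) : Fraw T t ≤ (inferInstance : MeasurableSpace (Path T)) :=
  iSup₂_le fun s _ => (show Continuous fun ω : Path T => ω s by fun_prop).measurable.comap_le

lemma Fplus_le (t : ℝ) : Fplus T t ≤ (inferInstance : MeasurableSpace (Path T)) :=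
  (iInf₂_le (t + 1) (by linarith)).trans (Fraw_le _)

lemma Fplus_loc {A : Set (Path T)} {r t : ℝ} (hA : MeasurableSet[Fplus T r] A) (hrt : r < t)
    {ω ω' : Path T} (e : sp hT ω t = sp hT ω' t) : ω ∈ A ↔ ω' ∈ A := by
  have h1 : MeasurableSet[Fraw T (min t T)] A := (iInf₂_le t hrt : Fplus T r ≤ _) A hA
  obtain ⟨B, -, rfl⟩ := Fraw_le_sp hT _ A h1
  have : ∀ ω, sp hT ω (min t T) = sp hT (sp hT ω t) T := fun ω => by rw [sp_sp, min_comm]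
  simp only [mem_preimage, this, e]

lemma Stp_of {τ : Path T → ℝ} (h0 : ∀ ω, 0 ≤ τ ω) (hle : ∀ ω, τ ω ≤ T) (hs : IsStopPlus T τ) :
    Stp hT (fun p => τ p.1) := by
  refine ⟨fun p => h0 _, fun p => hle _, ?_, ?_⟩
  · refine Measurable.comp ?_ measurable_fst
    refine measurable_of_Iic fun c => ?_
    by_cases hc0 : 0 ≤ c
    · have : τ ⁻¹' Iic c = {ω | τ ω ≤ min c T} := by
        ext ω; simp [hle ω]
      rw [this]
      exact Fplus_le _ _ (hs _ ⟨le_min hc0 hT, min_le_right _ _⟩)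
    · have : τ ⁻¹' Iic c = ∅ := by
        ext ω; have := h0 ω; simp; linarith
      rw [this]; exact MeasurableSet.empty
  · intro p q t e hlt
    have e' : sp hT p.1 t = sp hT q.1 t := congrArg Prod.fst e
    have h1 : τ q.1 ≤ τ p.1 :=
      (Fplus_loc hT (hs _ ⟨h0 p.1, hle p.1⟩) hlt e').1 (le_refl (τ p.1))
    have h2 : τ p.1 ≤ τ q.1 :=
      (Fplus_loc hT (hs _ ⟨h0 q.1, hle q.1⟩) (h1.trans_lt hlt) e').2 (le_refl (τ q.1))
    exact le_antisymm h1 h2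

lemma MA_of {τ h : Path T → ℝ} (h0 : ∀ ω, 0 ≤ τ ω) (hle : ∀ ω, τ ω ≤ T)
    (hh : MeasAtStopPlus T τ h) : MA hT (fun p => τ p.1) (fun p => h p.1) := by
  refine ⟨Measurable.comp (fun B hB => ?_) measurable_fst, fun p q t e hlt => ?_⟩
  · have := Fplus_le _ _ (hh B hB T ⟨hT, le_rfl⟩)
    rwa [show {ω | τ ω ≤ T} = univ from eq_univ_of_forall hle, inter_univ] at this
  · have e' : sp hT p.1 t = sp hT q.1 t := congrArg Prod.fst e
    exact ((Fplus_loc hT (hh {h p.1} (measurableSet_singleton _) _ ⟨h0 p.1, hle p.1⟩) hlt e').1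
      ⟨rfl, le_refl (τ p.1)⟩).1

lemma strat_bds (H : SimpleStrategy T) (l : Fin (H.L + 1)) (ω : Path T) :
    0 ≤ H.τ l ω ∧ H.τ l ω ≤ T := by
  have hm : Monotone fun l => H.τ l ω := Fin.monotone_iff_le_succ.2 fun l => H.τ_mono l ω
  exact ⟨(H.τ_nonneg ω).trans (hm (Fin.zero_le l)), (hm (Fin.le_last l)).trans (H.τ_le ω)⟩

section Z

variable {Ξ : Set (Path T)} {Zbar : PathPair T → ℝ≥0∞} (hB : AssumptionB T hT Ξ Zbar)

include hB

lemma Zmeas : Measurable Zbar := (lsc_of_compact hB.B1).measurable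

lemma Xi_meas : MeasurableSet Ξ := by
  rw [hB.xi_eq]
  exact (BO_measurable hT).1.inter
    (((Zmeas hT hB).comp (ps_measurable hT)) (measurableSet_singleton ⊤).compl)

end Z

end Weak

section Weak2

variable {T : ℝ} (hT : 0 ≤ T) {Ξ : Set (Path T)} {Zbar : PathPair T → ℝ≥0∞}

lemma mart_mul {Q : Measure (Path T)} [IsProbabilityMeasure Q] {m : MeasurableSpace (Path T)}
    (hm : m ≤ instMeasurableSpacePath T) {D g : Path T → ℝ}
    (hD : Integrable D Q) (h0 : ∀ A, MeasurableSet[m] A → ∫ ω in A, D ω ∂Q = 0)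
    (hg : Measurable[m] g) {C : ℝ} (hC : ∀ ω, |g ω| ≤ C) : ∫ ω, g ω * D ω ∂Q = 0 := by
  have h1 : (0 : Path T → ℝ) =ᵐ[Q] Q[D|m] := by
    refine ae_eq_condExp_of_forall_setIntegral_eq hm hD (fun s _ _ => (integrable_zero _ _ _).integrableOn)
      (fun s hs _ => ?_) aestronglyMeasurable_zero
    rw [h0 s hs]; simp
  have hi : Integrable (g * D) Q := by
    have := hD.bdd_mul (c := C) (hg.mono hm le_rfl).aestronglyMeasurable (ae_of_all _ hC)
    exact this
  have h2 := condExp_mul_of_stronglyMeasurable_left (μ := Q) (m := m) hg.stronglyMeasurable hi hD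
  have h3 : ∫ ω, (g * D) ω ∂Q = 0 := by
    rw [← integral_condExp hm (f := g * D)]
    refine integral_eq_zero_of_ae ?_
    filter_upwards [h1, h2] with ω a b
    rw [b, Pi.mul_apply, ← a]; simp
  exact h3

variable (hB : AssumptionB T hT Ξ Zbar)

include hB

lemma ae_Xi {Q : Measure (Path T)} (hQ : Q ∈ MZSet T hT Ξ (fun ω => Zbar (ω, qv T hT ω))) :
    ∀ᵐ ω ∂Q, ω ∈ Ξ := by
  have := hQ.1
  exact (mem_ae_iff_prob_eq_one (Xi_meas hT hB)).2 hQ.2.2.1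

lemma Xi_BO {ω : Path T} (h : ω ∈ Ξ) : ω ∈ BigOmega T hT := by
  rw [hB.xi_eq] at h; exact h.1

lemma Xi_Z {ω : Path T} (h : ω ∈ Ξ) : Zbar (ps hT ω) ≠ ⊤ := by
  rw [hB.xi_eq] at h; exact h.2

lemma normZ {p : PathPair T} (h : Zbar p ≠ ⊤) : ‖p.1‖ + ‖p.2‖ ≤ (Zbar p).toReal :=
  (ENNReal.ofReal_le_iff_le_toReal h).1 (hB.B3 p)

lemma Z_int {Q : Measure (Path T)} (hQ : Q ∈ MZSet T hT Ξ (fun ω => Zbar (ω, qv T hT ω))) :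
    Integrable (fun ω => (Zbar (ps hT ω)).toReal) Q :=
  integrable_toReal_of_lintegral_ne_top ((Zmeas hT hB).comp (ps_measurable hT)).aemeasurable hQ.2.2.2

lemma MZ_facts {Q : Measure (Path T)} (hQ : Q ∈ MZSet T hT Ξ (fun ω => Zbar (ω, qv T hT ω))) :
    IsProbabilityMeasure (Q.map (ps hT)) ∧
    Integrable (fun p : PathPair T => ‖p.1‖ + ‖p.2‖) (Q.map (ps hT)) ∧
    LP1 hT (Q.map (ps hT)) ∧ LP2 hT (Q.map (ps hT)) := by
  have hP := hQ.1
  have pm := ps_measurable hT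
  have hP' : IsProbabilityMeasure (Q.map (ps hT)) := Measure.isProbabilityMeasure_map pm.aemeasurable
  have hXi := ae_Xi hT hB hQ
  have hn : Measurable fun p : PathPair T => ‖p.1‖ + ‖p.2‖ := by fun_prop
  have hNQ : Integrable (fun ω => ‖ω‖ + ‖qv T hT ω‖) Q := by
    refine (Z_int hT hB hQ).mono' (hn.comp pm).aestronglyMeasurable ?_
    filter_upwards [hXi] with ω hω
    have := normZ hT hB (Xi_Z hT hB hω)
    rw [Real.norm_eq_abs, abs_of_nonneg (by positivity)]
    exact this
  have hN : Integrable (fun p : PathPair T => ‖p.1‖ + ‖p.2‖) (Q.map (ps hT)) :=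
    (integrable_map_measure hn.aestronglyMeasurable pm.aemeasurable).2 hNQ
  have hBO : ∀ᵐ p ∂(Q.map (ps hT)), BO hT p := by
    have hms : MeasurableSet {p : PathPair T | p.1 ∈ BigOmega T hT ∧ qv T hT p.1 = p.2} :=
      (measurable_fst (BO_measurable hT).1).inter
        (measurableSet_eq_fun ((BO_measurable hT).2.comp measurable_fst) measurable_snd)
    have : ∀ᵐ p ∂(Q.map (ps hT)), p.1 ∈ BigOmega T hT ∧ qv T hT p.1 = p.2 := by
      rw [ae_map_iff pm.aemeasurable hms]
      filter_upwards [hXi] with ω hω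
      exact ⟨Xi_BO hT hB hω, rfl⟩
    filter_upwards [this] with p hp
    have := BO_of_mem hT hp.1
    rwa [hp.2] at this
  have evm : ∀ u, Measurable fun ω : Path T => ev T hT ω u := fun u => (ev_cont_p hT u).measurable
  have evi : ∀ u, Integrable (fun ω : Path T => ev T hT ω u) Q := fun u => by
    refine hNQ.mono' (evm u).aestronglyMeasurable (ae_of_all _ fun ω => ?_)
    have := ev_abs_le hT ω u
    have := norm_nonneg (qv T hT ω)
    rw [Real.norm_eq_abs]; linarith
  have hmart : ∀ s ∈ Icc (0:ℝ) T, ∀ A, MeasurableSet[Fraw T s] A →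
      ∫ ω in A, (ev T hT ω T - ev T hT ω s) ∂Q = 0 := by
    intro s hs A hA
    obtain ⟨τ, hτ, hlim, hm⟩ := hQ.2.1
    have key : ∀ t ∈ Icc (0:ℝ) T, Tendsto (fun m => ∫ ω in A, Sproc T hT (min (τ m ω) t) ω ∂Q) atTop
        (𝓝 (∫ ω in A, ev T hT ω t ∂Q)) := by
      intro t ht
      refine tendsto_integral_of_dominated_convergence (fun ω => ‖ω‖ + ‖qv T hT ω‖)
        (fun m => ((hm m).1 t ht).aestronglyMeasurable.restrict) hNQ.restrict ?_ ?_
      · refine fun m => ae_of_all _ fun ω => ?_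
        have := ev_abs_le hT ω (min (τ m ω) t)
        have := norm_nonneg (qv T hT ω)
        rw [Real.norm_eq_abs]; unfold Sproc; linarith
      · filter_upwards [ae_restrict_of_ae hlim] with ω hω
        refine tendsto_const_nhds.congr' ?_
        filter_upwards [hω.2.eventually_ge_atTop t] with m hm
        simp only [Sproc, min_eq_right hm]
    have e : ∫ ω in A, ev T hT ω T ∂Q = ∫ ω in A, ev T hT ω s ∂Q := by
      refine tendsto_nhds_unique (key T ⟨hT, le_rfl⟩) ((key s hs).congr fun m => ?_)
      exact ((hm m).2 s T hs ⟨hT, le_rfl⟩ hs.2 A hA).symm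
    rw [integral_sub (evi T).integrableOn (evi s).integrableOn, e, sub_self]
  have h1 : LP1 hT (Q.map (ps hT)) := by
    intro τ κ h C hτ hκ hle hh hC
    refine opt_stop2 hT (Y := fun u p => ev T hT p.1 u) hN (fun u hu p => ?_)
      (fun p => ev_cont_t hT p.1) (fun u hu => (evm u).comp measurable_fst)
      (fun τ hτ => ev_meas hT measurable_fst hτ.meas) ?_ hτ hκ hle hh hC
    · have := ev_abs_le hT p.1 u
      have := norm_nonneg p.2
      linarith
    · rintro t ht g hg ⟨C, hC⟩ hloc
      have hgm : AEStronglyMeasurable (fun p : PathPair T => g p * (ev T hT p.1 T - ev T hT p.1 t))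
          (Q.map (ps hT)) := (hg.mul (((evm T).comp measurable_fst).sub
            ((evm t).comp measurable_fst))).aestronglyMeasurable
      rw [integral_map pm.aemeasurable hgm]
      have e : ∫ ω, g (ps hT ω) * (ev T hT ω T - ev T hT ω t) ∂Q =
          ∫ ω, g (ps hT (sp hT ω t)) * (ev T hT ω T - ev T hT ω t) ∂Q := by
        refine integral_congr_ae ?_
        filter_upwards [hXi] with ω hω
        rw [ps_sp hT (Xi_BO hT hB hω) ht, hloc]
      refine e.trans ?_
      exact mart_mul (Fraw_le t) ((evi T).sub (evi t)) (hmart t ht)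
        ((hg.comp pm).comp (sp_Fraw hT ht)) fun ω => hC _
  exact ⟨hP', hN, h1, LP2_of_BO hT hN h1 hBO⟩

/-- terminal gain -/
lemma gain_int {Q : Measure (Path T)} (hQ : Q ∈ MZSet T hT Ξ (fun ω => Zbar (ω, qv T hT ω)))
    (H G : SimpleStrategy T) (K : ℝ) :
    Integrable (fun ω => gK hT K (ps hT ω) *
      (integ T H (Sproc T hT) T ω + integ T G (SS T hT) T ω)) Q ∧
    ∫ ω, gK hT K (ps hT ω) * (integ T H (Sproc T hT) T ω + integ T G (SS T hT) T ω) ∂Q = 0 := by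
  obtain ⟨hP, hN, h1, h2⟩ := MZ_facts hT hB hQ
  have pm := ps_measurable hT
  have hst : ∀ (H : SimpleStrategy T) l, Stp hT (fun p => H.τ l p.1) := fun H l =>
    Stp_of hT (fun ω => (strat_bds H l ω).1) (fun ω => (strat_bds H l ω).2) (H.7 l)
  have hma : ∀ (H : SimpleStrategy T) (l : Fin H.L), MA hT (fun p => H.τ l.castSucc p.1)
      (fun p => H.coeff l p.1) := fun H l =>
    MA_of hT (fun ω => (strat_bds H _ ω).1) (fun ω => (strat_bds H _ ω).2) (H.coeff_meas l)
  have A : ∀ l : Fin H.L, Integrable (fun p : PathPair T => gK hT K p * (H.coeff l p.1 *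
        (ev T hT p.1 (H.τ l.succ p.1) - ev T hT p.1 (H.τ l.castSucc p.1)))) (Q.map (ps hT)) ∧
      ∫ p, gK hT K p * (H.coeff l p.1 *
        (ev T hT p.1 (H.τ l.succ p.1) - ev T hT p.1 (H.τ l.castSucc p.1))) ∂(Q.map (ps hT)) = 0 := by
    intro l
    obtain ⟨C, hC⟩ := H.coeff_bdd l
    have hc := (gK_MA hT K (hst H l.castSucc)).mul (hma H l)
    have hb : ∀ p : PathPair T, |gK hT K p * H.coeff l p.1| ≤ 1 * C := fun p => by
      rw [abs_mul]; exact mul_le_mul (gK_abs hT K p) (hC _) (abs_nonneg _) zero_le_one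
    have := h1 _ _ _ _ (hst H l.castSucc) (hst H l.succ) (fun p => H.τ_mono l p.1) hc hb
    simp only [← mul_assoc]
    exact ⟨bdd_mul_int ((ev1_int hT hN (hst H l.succ).meas).sub
      (ev1_int hT hN (hst H l.castSucc).meas)) hc.meas hb, this⟩
  have B : ∀ l : Fin G.L, Integrable (fun p : PathPair T => gK hT K p * (G.coeff l p.1 *
        (XX hT p (G.τ l.succ p.1) - XX hT p (G.τ l.castSucc p.1)))) (Q.map (ps hT)) ∧
      ∫ p, gK hT K p * (G.coeff l p.1 *
        (XX hT p (G.τ l.succ p.1) - XX hT p (G.τ l.castSucc p.1))) ∂(Q.map (ps hT)) = 0 := by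
    intro l
    obtain ⟨C, hC⟩ := G.coeff_bdd l
    exact XX_full hT hN h1 h2 K (hst G l.castSucc) (hst G l.succ) (fun p => G.τ_mono l p.1)
      (hma G l) fun p => hC p.1
  let W : PathPair T → ℝ := fun p => ∑ l : Fin H.L, gK hT K p * (H.coeff l p.1 *
        (ev T hT p.1 (H.τ l.succ p.1) - ev T hT p.1 (H.τ l.castSucc p.1))) +
      (∑ l : Fin G.L, gK hT K p * (G.coeff l p.1 *
        (XX hT p (G.τ l.succ p.1) - XX hT p (G.τ l.castSucc p.1)))) * (1/2)
  have i1 := integrable_finsetSum Finset.univ fun l _ => (A l).1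
  have i2 := (integrable_finsetSum Finset.univ fun l _ => (B l).1).mul_const (1/2)
  have hW : Integrable W (Q.map (ps hT)) := i1.add i2
  have hW0 : ∫ p, W p ∂(Q.map (ps hT)) = 0 := by
    rw [integral_add i1 i2, integral_mul_const, integral_finsetSum _ fun l _ => (A l).1,
      integral_finsetSum _ fun l _ => (B l).1]
    simp [(A _).2, (B _).2]
  have e : (fun ω => W (ps hT ω)) =ᵐ[Q] fun ω => gK hT K (ps hT ω) *
      (integ T H (Sproc T hT) T ω + integ T G (SS T hT) T ω) := by
    filter_upwards [ae_Xi hT hB hQ] with ω hω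
    have hb := BO_of_mem hT (Xi_BO hT hB hω)
    have hS : ∀ l, SS T hT (G.τ l ω) ω =
        (XX hT (ps hT ω) (G.τ l ω) - ev T hT ω 0 ^ 2) / 2 := fun l => by
      rw [BO.SS hT hb (strat_bds G l ω)]; simp only [XX, ps]; ring
    simp only [W, integ, Sproc, min_eq_left (strat_bds _ _ _).2, hS, ← Finset.mul_sum]
    rw [mul_assoc, ← mul_add, Finset.sum_mul]
    congr 2
    refine Finset.sum_congr rfl fun l _ => ?_
    simp only [ps]; ring
  refine ⟨((integrable_map_measure hW.aestronglyMeasurable pm.aemeasurable).1 hW).congr e, ?_⟩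
  rw [← integral_congr_ae e, ← hW0, integral_map pm.aemeasurable hW.aestronglyMeasurable]

lemma gain_le {Q : Measure (Path T)} (hQ : Q ∈ MZSet T hT Ξ (fun ω => Zbar (ω, qv T hT ω)))
    (H G : SimpleStrategy T) {c : ℝ} (hc : 0 ≤ c)
    (hb : ∀ ω ∈ Ξ, -(c * (Zbar (ps hT ω)).toReal) ≤
      integ T H (Sproc T hT) T ω + integ T G (SS T hT) T ω) :
    Integrable (fun ω => integ T H (Sproc T hT) T ω + integ T G (SS T hT) T ω) Q ∧
    ∫ ω, (integ T H (Sproc T hT) T ω + integ T G (SS T hT) T ω) ∂Q ≤ 0 := by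
  have hP := hQ.1
  have hZ := (Z_int hT hB hQ).const_mul c
  let W := fun ω => integ T H (Sproc T hT) T ω + integ T G (SS T hT) T ω
  have h := fatou_real (Q := Q) (f := fun (K : ℕ) ω => c * (Zbar (ps hT ω)).toReal + gK hT K (ps hT ω) * W ω)
    (F := fun ω => c * (Zbar (ps hT ω)).toReal + W ω) (c := ∫ ω, c * (Zbar (ps hT ω)).toReal ∂Q)
    (fun K => hZ.add (gain_int hT hB hQ H G K).1) (fun K => ?_) (fun K => ?_) (ae_of_all _ fun ω => ?_)
  · have hi : Integrable W Q := by
      refine (h.1.sub hZ).congr (ae_of_all _ fun ω => ?_)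
      simp
    refine ⟨hi, ?_⟩
    have := h.2
    rw [integral_add hZ hi] at this
    change ∫ ω, W ω ∂Q ≤ 0
    linarith
  · filter_upwards [ae_Xi hT hB hQ] with ω hω
    have h1 := hb ω hω
    have h2 : 0 ≤ c * (Zbar (ps hT ω)).toReal := by positivity
    change -(c * (Zbar (ps hT ω)).toReal) ≤ W ω at h1
    rcases gK_cases hT K (ps hT ω) with h | h <;> rw [h] <;> linarith
  · rw [integral_add hZ (gain_int hT hB hQ H G K).1, (gain_int hT hB hQ H G K).2, add_zero]
  · refine tendsto_const_nhds.congr' ?_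
    obtain ⟨N, hN⟩ := exists_nat_ge |ev T hT ω 0|
    filter_upwards [eventually_ge_atTop N] with n hn
    have : gK hT n (ps hT ω) = 1 := by
      unfold gK
      rw [if_pos]
      exact hN.trans (by exact_mod_cast hn)
    rw [this, one_mul]

lemma weak_duality {Q : Measure (Path T)} (hQ : Q ∈ MZSet T hT Ξ (fun ω => Zbar (ω, qv T hT ω)))
    {ξ : Path T → EReal} {b : ℝ} (hb : ∀ ω, (b : EReal) ≤ ξ ω) {lam : ℝ}
    (hl : lam ∈ PhiZSet T hT Ξ (fun ω => Zbar (ω, qv T hT ω)) ξ) : expEReal Q ξ ≤ lam := by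
  obtain ⟨c, hc, H, G, hadm, hsup⟩ := hl
  have hP := hQ.1
  set W : ℕ → Path T → ℝ := fun n ω => integ T (H n) (Sproc T hT) T ω + integ T (G n) (SS T hT) T ω with hW
  set z : Path T → ℝ := fun ω => (Zbar (ps hT ω)).toReal with hz
  have z1 : ∀ ω ∈ Ξ, 1 ≤ z ω := fun ω hω => by
    have := (ENNReal.toReal_le_toReal ENNReal.one_ne_top (Xi_Z hT hB hω)).2 (hB.one_le _)
    simpa using this
  have hXi := ae_Xi hT hB hQ
  set d : ℝ := c + |lam| + |b| with hd
  have hd0 : 0 ≤ d := by positivity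
  have hlow : ∀ n, ∀ ω ∈ Ξ, -(d * z ω) ≤ W n ω ∧ 0 ≤ lam + d * z ω + W n ω ∧ 0 ≤ b + d * z ω := by
    intro n ω hω
    have h1 : -(c * z ω) ≤ lam + integ T (H n) (Sproc T hT) T ω + integ T (G n) (SS T hT) T ω :=
      hadm n ω hω
    have h1 : -(c * z ω) ≤ lam + W n ω := by rw [hW]; linarith
    have h2 := z1 ω hω
    have h3 := le_abs_self lam
    have h4 := neg_abs_le b
    have h5 : d * z ω = c * z ω + |lam| * z ω + |b| * z ω := by rw [hd]; ring
    have h6 : |lam| * 1 ≤ |lam| * z ω := mul_le_mul_of_nonneg_left h2 (abs_nonneg _)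
    have h7 : |b| * 1 ≤ |b| * z ω := mul_le_mul_of_nonneg_left h2 (abs_nonneg _)
    have h8 : 0 ≤ c * z ω := mul_nonneg hc (by linarith)
    have := abs_nonneg lam
    have := abs_nonneg b
    refine ⟨?_, ?_, ?_⟩ <;> linarith
  have hg := fun n => gain_le hT hB hQ (H n) (G n) hd0 fun ω hω => (hlow n ω hω).1
  have hzi : Integrable z Q := Z_int hT hB hQ
  have hzd : Integrable (fun ω => lam + d * z ω) Q := (integrable_const _).add (hzi.const_mul d)
  set P := ∫⁻ ω, erealPos (ξ ω) ∂Q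
  set N := ∫⁻ ω, erealPos (-ξ ω) ∂Q
  set E := ∫ ω, d * z ω ∂Q with hE
  have hE0 : 0 ≤ E := integral_nonneg fun ω => mul_nonneg hd0 ENNReal.toReal_nonneg
  have hfi : ∀ n, Integrable (fun ω => lam + d * z ω + W n ω) Q := fun n => hzd.add (hg n).1
  have hIle : ∀ n, ∫ ω, (lam + d * z ω + W n ω) ∂Q ≤ lam + E := by
    intro n
    rw [integral_add hzd (hg n).1, integral_add (integrable_const _) (hzi.const_mul d)]
    have := (hg n).2
    simp only [integral_const, probReal_univ, one_smul]
    change ∫ ω, W n ω ∂Q ≤ 0 at this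
    linarith
  have hlE : 0 ≤ lam + E := (integral_nonneg_of_ae (by
    filter_upwards [hXi] with ω hω using (hlow 0 ω hω).2.1)).trans (hIle 0)
  have claim : ∀ ω ∈ Ξ, erealPos (ξ ω) + ENNReal.ofReal (d * z ω) ≤ erealPos (-ξ ω) +
      liminf (fun n => ENNReal.ofReal (lam + d * z ω + W n ω)) atTop := by
    intro ω hω
    have hy : ∀ y : ℝ, (y : EReal) < ξ ω → ENNReal.ofReal (y + d * z ω) ≤
        liminf (fun n => ENNReal.ofReal (lam + d * z ω + W n ω)) atTop := by
      intro y hy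
      have h1 : (y : EReal) < lam + liminf (fun n => ((W n ω : ℝ) : EReal)) atTop :=
        hy.trans_le (hsup ω hω)
      have h2 : ((y - lam : ℝ) : EReal) < liminf (fun n => ((W n ω : ℝ) : EReal)) atTop := by
        by_contra hcon
        have := add_le_add_right (not_lt.1 hcon) (lam : EReal)
        rw [← EReal.coe_add, add_sub_cancel] at this
        exact absurd h1 (not_lt.2 this)
      refine le_liminf_of_le (by isBoundedDefault) ?_
      filter_upwards [eventually_lt_of_lt_liminf h2] with n hn
      refine ENNReal.ofReal_le_ofReal ?_
      have := EReal.coe_lt_coe_iff.1 hn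
      linarith
    by_cases htop : ξ ω = ⊤
    · have : liminf (fun n => ENNReal.ofReal (lam + d * z ω + W n ω)) atTop = ⊤ := by
        refine ENNReal.eq_top_of_forall_nnreal_le fun r => ?_
        have := hy (r - d * z ω) (by rw [htop]; exact EReal.coe_lt_top _)
        simpa using this
      rw [this]; simp
    · have hbot : ξ ω ≠ ⊥ := fun h => by
        have := hb ω; rw [h] at this; exact absurd this (by simp)
      obtain ⟨x, hx⟩ : ∃ x : ℝ, ξ ω = x := ⟨_, (EReal.coe_toReal htop hbot).symm⟩
      rw [hx] at hy ⊢
      have hx0 : 0 ≤ x + d * z ω := by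
        have := hb ω
        rw [hx, EReal.coe_le_coe_iff] at this
        linarith [(hlow 0 ω hω).2.2]
      have h1 : ENNReal.ofReal (x + d * z ω) ≤
          liminf (fun n => ENNReal.ofReal (lam + d * z ω + W n ω)) atTop := by
        refine ENNReal.le_of_forall_pos_le_add fun δ hδ _ => ?_
        have := hy (x - δ) (by rw [EReal.coe_lt_coe_iff]; have : (0:ℝ) < δ := hδ; linarith)
        calc ENNReal.ofReal (x + d * z ω) ≤ ENNReal.ofReal (x - δ + d * z ω) + ENNReal.ofReal δ := by
              refine le_trans (ENNReal.ofReal_le_ofReal ?_) ENNReal.ofReal_add_le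
              linarith
          _ ≤ _ := by rw [ENNReal.ofReal_coe_nnreal]; exact add_le_add_left this _
      refine le_trans ?_ (add_le_add_right h1 _)
      have e1 : erealPos (x : EReal) = ENNReal.ofReal x := by simp [erealPos]
      have e2 : erealPos (-(x : EReal)) = ENNReal.ofReal (-x) := by
        rw [← EReal.coe_neg]; simp [erealPos]
      rw [e1, e2]
      rcases le_total 0 x with h | h
      · rw [ENNReal.ofReal_add h (by have := (hlow 0 ω hω).2.2; exact mul_nonneg hd0 ENNReal.toReal_nonneg)]
        exact le_add_self
      · rw [ENNReal.ofReal_of_nonpos h, zero_add, ← ENNReal.ofReal_add (by linarith) hx0]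
        refine ENNReal.ofReal_le_ofReal (by linarith)
  have hlm : AEMeasurable (fun ω => liminf (fun n => ENNReal.ofReal (lam + d * z ω + W n ω)) atTop) Q :=
    by
    simp only [liminf_eq_iSup_iInf_of_nat]
    exact AEMeasurable.iSup fun n => AEMeasurable.biInf _ (to_countable _)
      fun i _ => (hfi i).aestronglyMeasurable.aemeasurable.ennreal_ofReal
  have hmain : P + ENNReal.ofReal E ≤ N + ENNReal.ofReal (lam + E) := by
    calc P + ENNReal.ofReal E = ∫⁻ ω, (erealPos (ξ ω) + ENNReal.ofReal (d * z ω)) ∂Q := by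
          rw [lintegral_add_right' _ (hzi.const_mul d).aestronglyMeasurable.aemeasurable.ennreal_ofReal,
            ofReal_integral_eq_lintegral_ofReal (hzi.const_mul d)
              (ae_of_all _ fun ω => mul_nonneg hd0 ENNReal.toReal_nonneg)]
      _ ≤ ∫⁻ ω, (erealPos (-ξ ω) + liminf (fun n => ENNReal.ofReal (lam + d * z ω + W n ω)) atTop) ∂Q :=
          lintegral_mono_ae (hXi.mono claim)
      _ = N + ∫⁻ ω, liminf (fun n => ENNReal.ofReal (lam + d * z ω + W n ω)) atTop ∂Q :=
          lintegral_add_right' _ hlm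
      _ ≤ N + ENNReal.ofReal (lam + E) := by
          refine add_le_add_right ?_ _
          refine (lintegral_liminf_le' fun n =>
            (hfi n).aestronglyMeasurable.aemeasurable.ennreal_ofReal).trans ?_
          refine liminf_le_of_frequently_le' (Frequently.of_forall fun n => ?_)
          rw [← ofReal_integral_eq_lintegral_ofReal (hfi n) (by
            filter_upwards [hXi] with ω hω using (hlow n ω hω).2.1)]
          exact ENNReal.ofReal_le_ofReal (hIle n)
  have hNf : N ≠ ⊤ := by
    have : N ≤ ENNReal.ofReal |b| := by
      calc N ≤ ∫⁻ _, ENNReal.ofReal |b| ∂Q := by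
            refine lintegral_mono fun ω => ?_
            have hbω := hb ω
            induction h : ξ ω using EReal.rec with
            | bot => rw [h] at hbω; exact absurd hbω (by simp)
            | top => simp [erealPos]
            | coe x =>
              rw [h, EReal.coe_le_coe_iff] at hbω
              rw [← EReal.coe_neg]
              simp only [erealPos, EReal.coe_ne_top, if_false, EReal.toReal_coe]
              exact ENNReal.ofReal_le_ofReal (by have := neg_abs_le b; linarith)
        _ = _ := by simp
    exact ne_top_of_le_ne_top ENNReal.ofReal_ne_top this
  have hPf : P ≠ ⊤ := fun h => by
    rw [h, top_add, top_le_iff] at hmain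
    exact (ENNReal.add_ne_top.2 ⟨hNf, ENNReal.ofReal_ne_top⟩) hmain
  unfold expEReal
  change (P : EReal) - (N : EReal) ≤ lam
  clear_value P N
  lift P to NNReal using hPf
  lift N to NNReal using hNf
  have h3 : (P : ℝ) + E ≤ N + (lam + E) := by
    have := ENNReal.toReal_mono (ENNReal.add_ne_top.2 ⟨ENNReal.coe_ne_top, ENNReal.ofReal_ne_top⟩) hmain
    rwa [ENNReal.toReal_add ENNReal.coe_ne_top ENNReal.ofReal_ne_top,
      ENNReal.toReal_add ENNReal.coe_ne_top ENNReal.ofReal_ne_top, ENNReal.toReal_ofReal hE0,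
      ENNReal.toReal_ofReal hlE] at this
  have h4 : ((P : ℝ) : EReal) - ((N : ℝ) : EReal) ≤ lam := by
    rw [← EReal.coe_sub, EReal.coe_le_coe_iff]; linarith
  exact h4

end Weak2

section Test

variable {T : ℝ} (hT : 0 ≤ T)

/-- the two processes: `S` and `S² - V` -/
def fx (i : Bool) (p : PathPair T) (u : ℝ) : ℝ := if i then ev T hT p.1 u else XX hT p u

lemma fx_cont (i : Bool) : Continuous fun x : PathPair T × ℝ => fx hT i x.1 x.2 := by
  have h1 : Continuous fun x : PathPair T × ℝ => ev T hT x.1.1 x.2 :=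
    (ev_cont hT).comp ((continuous_fst.comp continuous_fst).prodMk continuous_snd)
  have h2 : Continuous fun x : PathPair T × ℝ => ev T hT x.1.2 x.2 :=
    (ev_cont hT).comp ((continuous_snd.comp continuous_fst).prodMk continuous_snd)
  cases i
  · exact (h1.pow 2).sub h2
  · exact h1

lemma fx_cont_t (i : Bool) (p : PathPair T) : Continuous (fx hT i p) :=
  (fx_cont hT i).comp (Continuous.prodMk_right p)

/-- bound for increments -/
def bd (R : ℝ) : ℝ := 2 * |R| + 2 * (R ^ 2 + |R|)

lemma bd_nn (R : ℝ) : 0 ≤ bd R := by unfold bd; positivity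

lemma fx_bdd (i : Bool) {R : ℝ} {p : PathPair T} {a b : ℝ} (ha : 0 ≤ a) (hab : a ≤ b)
    (hb : b ≤ kap hT R p) : |fx hT i p b - fx hT i p a| ≤ bd R := by
  obtain ⟨h1, -, h3⟩ := S_diff_bdd hT ha hab hb
  have := abs_nonneg R
  have := sq_nonneg R
  unfold bd
  cases i
  · simp only [fx]; simp only [Bool.false_eq_true, if_false]; linarith
  · simp only [fx, if_true]; linarith

lemma kap_nn (R : ℝ) (p : PathPair T) : 0 ≤ kap hT R p := (kap_Stp hT R).nn p

lemma kap_shift {p q : PathPair T} {b δ : ℝ} (h : 2 * dist p q ≤ δ) :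
    kap hT (b - δ) p ≤ kap hT b q := by
  refine le_csInf ⟨T, Or.inr rfl⟩ ?_
  rintro u (hu | hu)
  · refine csInf_le (hit_bdd (fun u p => UU hT p u) (b - δ) p hT) (Or.inl ⟨hu.1, ?_⟩)
    have h1 := (abs_le.1 (UU_sub_le hT p q u)).1
    have h2 : b < UU hT q u := hu.2
    show b - δ < UU hT p u
    linarith
  · rw [mem_singleton_iff.1 hu]; exact hit_le hT _ _ _

lemma kap_cont_ae (R : ℝ) (p : PathPair T) :
    ∀ᵐ a : ℝ, ContinuousAt (fun q => kap hT (R + a) q) p := by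
  have hm : Monotone fun b => kap hT b p := fun b c h => kap_mono hT h p
  have hc : ({a : ℝ | ¬ ContinuousAt (fun b => kap hT b p) (R + a)}).Countable :=
    hm.countable_not_continuousAt.preimage (f := fun a => R + a) (add_right_injective R)
  filter_upwards [hc.ae_notMem volume] with a ha
  simp only [mem_setOf_eq, not_not] at ha
  have hd : Tendsto (fun q => 2 * dist p q) (𝓝 p) (𝓝 0) := by
    have : Continuous fun q => 2 * dist p q := by fun_prop
    simpa using this.tendsto p
  have h1 : Tendsto (fun q => R + a - 2 * dist p q) (𝓝 p) (𝓝 (R + a)) := by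
    simpa using hd.const_sub (R + a)
  have h2 : Tendsto (fun q => R + a + 2 * dist p q) (𝓝 p) (𝓝 (R + a)) := by
    simpa using hd.const_add (R + a)
  refine tendsto_of_tendsto_of_tendsto_of_le_of_le (ha.tendsto.comp h1) (ha.tendsto.comp h2)
    (fun q => kap_shift hT le_rfl) fun q => ?_
  have := kap_shift hT (p := q) (q := p) (b := R + a + 2 * dist p q) (δ := 2 * dist p q)
    (by rw [dist_comm])
  simpa using this

/-- uniform measure on the unit interval -/
def nu1 : Measure ℝ := volume.restrict (Ioc 0 1)

instance : IsProbabilityMeasure nu1 := ⟨by simp [nu1]⟩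

lemma nu1_ae : ∀ᵐ a ∂nu1, a ∈ Ioc (0:ℝ) 1 := ae_restrict_mem measurableSet_Ioc

/-- averaged stopped process -/
def YY (i : Bool) (R t : ℝ) (p : PathPair T) : ℝ :=
  ∫ a, (fx hT i p (min (kap hT (R + a) p) (max 0 t)) - fx hT i p 0) ∂nu1

lemma kap_meas_a (R : ℝ) (p : PathPair T) : Measurable fun a => kap hT (R + a) p :=
  Monotone.measurable fun a b h => kap_mono hT (by linarith) p

lemma YY_ms (i : Bool) (R t : ℝ) (p : PathPair T) :
    Measurable fun a => fx hT i p (min (kap hT (R + a) p) (max 0 t)) - fx hT i p 0 :=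
  (((fx_cont_t hT i p).measurable).comp ((kap_meas_a hT R p).min measurable_const)).sub_const _

lemma YY_bd0 (i : Bool) (R t : ℝ) (p : PathPair T) : ∀ᵐ a ∂nu1,
    |fx hT i p (min (kap hT (R + a) p) (max 0 t)) - fx hT i p 0| ≤ bd (R + 1) := by
  filter_upwards [nu1_ae] with a ha
  exact fx_bdd hT i le_rfl (le_min (kap_nn hT _ p) (le_max_left _ _))
    ((min_le_left _ _).trans (kap_mono hT (by linarith [ha.2]) p))

lemma YY_int (i : Bool) (R t : ℝ) (p : PathPair T) :
    Integrable (fun a => fx hT i p (min (kap hT (R + a) p) (max 0 t)) - fx hT i p 0) nu1 :=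
  Integrable.mono' (integrable_const _) (YY_ms hT i R t p).aestronglyMeasurable (YY_bd0 hT i R t p)

lemma YY_bdd (i : Bool) (R t : ℝ) (p : PathPair T) : |YY hT i R t p| ≤ bd (R + 1) := by
  have := norm_integral_le_of_norm_le_const (μ := nu1) (C := bd (R + 1))
    (f := fun a => fx hT i p (min (kap hT (R + a) p) (max 0 t)) - fx hT i p 0) (YY_bd0 hT i R t p)
  rw [probReal_univ, mul_one] at this
  exact this

lemma YY_cont (i : Bool) (R : ℝ) : Continuous fun x : PathPair T × ℝ => YY hT i R x.2 x.1 := by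
  rw [continuous_iff_continuousAt]
  rintro ⟨p, t⟩
  refine continuousAt_of_dominated (bound := fun _ => bd (R + 1))
    (Eventually.of_forall fun x => (YY_ms hT i R x.2 x.1).aestronglyMeasurable)
    (Eventually.of_forall fun x => YY_bd0 hT i R x.2 x.1) (integrable_const _) ?_
  filter_upwards [ae_restrict_of_ae (kap_cont_ae hT R p)] with a ha
  have h1 : ContinuousAt (fun x : PathPair T × ℝ => kap hT (R + a) x.1) (p, t) :=
    ContinuousAt.comp (f := Prod.fst) (x := (p, t)) (by exact ha) continuousAt_fst
  have h2 : ContinuousAt (fun x : PathPair T × ℝ => min (kap hT (R + a) x.1) (max 0 x.2)) (p, t) :=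
    h1.min (continuous_const.max continuous_snd).continuousAt
  have h3 : ContinuousAt (fun x : PathPair T × ℝ => (x.1, min (kap hT (R + a) x.1) (max 0 x.2))) (p, t) :=
    continuousAt_fst.prodMk h2
  have h4 : Continuous fun x : PathPair T × ℝ => fx hT i x.1 0 :=
    (fx_cont hT i).comp (continuous_fst.prodMk continuous_const)
  have h5 := ContinuousAt.comp (g := fun x : PathPair T × ℝ => fx hT i x.1 x.2) (x := (p, t))
    (fx_cont hT i).continuousAt h3
  exact h5.sub h4.continuousAt

lemma YY_eq (i : Bool) {R t : ℝ} {p : PathPair T} (ht : 0 ≤ t) (h : t ≤ kap hT R p) :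
    YY hT i R t p = fx hT i p t - fx hT i p 0 := by
  have : YY hT i R t p = ∫ _, (fx hT i p t - fx hT i p 0) ∂nu1 := by
    refine integral_congr_ae ?_
    filter_upwards [nu1_ae] with a ha
    have h1 : kap hT R p ≤ kap hT (R + a) p := kap_mono hT (by linarith [ha.1]) p
    rw [max_eq_right ht, min_eq_right (h.trans h1)]
  rw [this]; simp

/-- dyadic grid -/
def gr (T : ℝ) (n k : ℕ) : ℝ := k * T / 2 ^ n

include hT in
lemma gr_nn (n k : ℕ) : 0 ≤ gr T n k := by unfold gr; positivity

include hT in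
lemma gr_mono (n : ℕ) {k l : ℕ} (h : k ≤ l) : gr T n k ≤ gr T n l := by
  unfold gr; gcongr

lemma gr_end (n : ℕ) : gr T n (2 ^ n) = T := by
  unfold gr; push_cast; field_simp

include hT in
lemma gr_le (n : ℕ) {k : ℕ} (h : k ≤ 2 ^ n) : gr T n k ≤ T :=
  (gr_mono hT n h).trans (gr_end n).le

lemma gr_step (n k : ℕ) : gr T n (k + 1) - gr T n k = T / 2 ^ n := by
  unfold gr; push_cast; ring

lemma gr_refine {m n : ℕ} (h : m ≤ n) (j : ℕ) : gr T n (j * 2 ^ (n - m)) = gr T m j := by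
  unfold gr
  obtain ⟨d, rfl⟩ := Nat.exists_eq_add_of_le h
  push_cast
  rw [Nat.add_sub_cancel_left, pow_add]
  field_simp

/-- basic test functional -/
def tst (G : BoundedContinuousFunction (PathPair T) ℝ) (m j : ℕ) (R : ℕ) (i : Bool) (p : PathPair T) : ℝ :=
  G (stp hT p (gr T m j)) * (YY hT i R T p - YY hT i R (gr T m j) p)

lemma tst_cont (G : BoundedContinuousFunction (PathPair T) ℝ) (m j : ℕ) (R : ℕ) (i : Bool) :
    Continuous (tst hT G m j R i) := by
  refine (G.continuous.comp (stp_cont_p hT _)).mul (Continuous.sub ?_ ?_)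
  · exact (YY_cont hT i R).comp (Continuous.prodMk_left T)
  · exact (YY_cont hT i R).comp (Continuous.prodMk_left (gr T m j))

lemma tst_bdd (G : BoundedContinuousFunction (PathPair T) ℝ) (m j : ℕ) (R : ℕ) (i : Bool) (p : PathPair T) :
    ‖tst hT G m j R i p‖ ≤ ‖G‖ * (bd (R + 1) + bd (R + 1)) := by
  unfold tst
  rw [norm_mul]
  refine mul_le_mul (G.norm_coe_le_norm _) ?_ (norm_nonneg _) (norm_nonneg _)
  exact (norm_sub_le _ _).trans (add_le_add (YY_bdd hT i R _ p) (YY_bdd hT i R _ p))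

/-- basic test functional, bundled -/
def tstB (G : BoundedContinuousFunction (PathPair T) ℝ) (m j : ℕ) (R : ℕ) (i : Bool) :
    BoundedContinuousFunction (PathPair T) ℝ :=
  BoundedContinuousFunction.ofNormedAddCommGroup _ (tst_cont hT G m j R i) _ (tst_bdd hT G m j R i)

/-- span of the test functionals -/
def LL : Submodule ℝ (BoundedContinuousFunction (PathPair T) ℝ) :=
  Submodule.span ℝ {ℓ | ∃ G m j R i, j ≤ 2 ^ m ∧ ℓ = tstB hT G m j R i}

end Test

section Hedge

variable {T : ℝ} (hT : 0 ≤ T)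

/-- truncation weight -/
def chi (R u : ℝ) : ℝ := ∫ a, (if u ≤ R + a then (1:ℝ) else 0) ∂nu1

lemma chi_ms (R u : ℝ) : Measurable fun a => if u ≤ R + a then (1:ℝ) else 0 :=
  Measurable.ite (measurableSet_le measurable_const (by fun_prop)) measurable_const measurable_const

lemma chi_int (R u : ℝ) : Integrable (fun a => if u ≤ R + a then (1:ℝ) else 0) nu1 :=
  Integrable.mono' (integrable_const 1) (chi_ms R u).aestronglyMeasurable
    (ae_of_all _ fun a => by split_ifs <;> simp)

lemma chi_abs (R u : ℝ) : |chi R u| ≤ 1 := by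
  have := norm_integral_le_of_norm_le_const (μ := nu1) (C := 1)
    (f := fun a => if u ≤ R + a then (1:ℝ) else 0) (ae_of_all _ fun a => by split_ifs <;> simp)
  rw [probReal_univ, mul_one] at this
  exact this

lemma chi_meas (R : ℝ) : Measurable (chi R) := by
  refine Antitone.measurable fun u v h => integral_mono (chi_int R v) (chi_int R u) fun a => ?_
  simp only
  split_ifs with h1 h2
  · exact le_rfl
  · exact absurd (h.trans h1) h2
  · exact zero_le_one
  · exact le_rfl

lemma step_err (i : Bool) (n j : ℕ) (hj : j ≤ 2 ^ n) {b B w : ℝ} (hbB : b ≤ B) (p : PathPair T)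
    (hw : ∀ u v, 0 ≤ u → u ≤ v → v ≤ kap hT B p → v - u ≤ T / 2 ^ n →
      |fx hT i p v - fx hT i p u| ≤ w) :
    |∑ k ∈ Finset.Ico j (2 ^ n), (if UU hT p (gr T n k) ≤ b then (1:ℝ) else 0) *
      (fx hT i p (min (gr T n (k + 1)) (kap hT B p)) - fx hT i p (min (gr T n k) (kap hT B p))) -
      (fx hT i p (min (kap hT b p) T) - fx hT i p (min (kap hT b p) (gr T n j)))| ≤ w := by
  set κ := kap hT b p with hκ
  set θ := kap hT B p with hθ
  have hκθ : κ ≤ θ := kap_mono hT hbB p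
  have hκ0 : 0 ≤ κ := kap_nn hT b p
  have hθT : θ ≤ T := (kap_Stp hT B).le p
  have hw0 : 0 ≤ w := by
    have := hw 0 0 le_rfl le_rfl (kap_nn hT B p) (by simp; positivity)
    simpa using this
  have tel : fx hT i p (min κ T) - fx hT i p (min κ (gr T n j)) = ∑ k ∈ Finset.Ico j (2 ^ n),
      (fx hT i p (min κ (gr T n (k + 1))) - fx hT i p (min κ (gr T n k))) := by
    rw [Finset.sum_Ico_sub (fun k => fx hT i p (min κ (gr T n k))) hj, gr_end]
  rw [tel, ← Finset.sum_sub_distrib]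
  refine (Finset.abs_sum_le_sum_abs _ _).trans ?_
  have hterm : ∀ k ∈ Finset.Ico j (2 ^ n), |(if UU hT p (gr T n k) ≤ b then (1:ℝ) else 0) *
      (fx hT i p (min (gr T n (k + 1)) θ) - fx hT i p (min (gr T n k) θ)) -
      (fx hT i p (min κ (gr T n (k + 1))) - fx hT i p (min κ (gr T n k)))| ≤
      if gr T n k ≤ κ ∧ κ < gr T n (k + 1) then w else 0 := by
    intro k hkm
    have hk := gr_mono hT n (Nat.le_succ k)
    have hst := gr_step (T := T) n k
    have hk0 := gr_nn hT n k
    rcases lt_or_ge κ (gr T n k) with h1 | h1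
    · have hU : ¬ UU hT p (gr T n k) ≤ b := by
        obtain ⟨u, hu, hut, hub⟩ := (hit_lt_iff hT (gr_le hT n (Finset.mem_Ico.1 hkm).2.le)).1 h1
        exact not_le.2 (lt_of_lt_of_le hub (UU_mono hT p hut.le))
      rw [if_neg hU, if_neg (show ¬(gr T n k ≤ κ ∧ κ < gr T n (k + 1)) from fun h => absurd h1 (not_lt.2 h.1)), min_eq_left h1.le,
        min_eq_left (h1.le.trans hk)]
      simp
    · rcases lt_or_ge κ (gr T n (k + 1)) with h2 | h2
      · rw [if_pos (show gr T n k ≤ κ ∧ κ < gr T n (k + 1) from ⟨h1, h2⟩), min_eq_left h2.le, min_eq_right h1, min_eq_left (h1.trans hκθ)]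
        have hm : κ ≤ min (gr T n (k + 1)) θ := le_min h2.le hκθ
        split_ifs
        · rw [one_mul, sub_sub_sub_cancel_right]
          exact hw _ _ hκ0 hm (min_le_right _ _) (by
            have := min_le_left (gr T n (k + 1)) θ; linarith)
        · rw [zero_mul, zero_sub, abs_neg]
          exact hw _ _ hk0 h1 hκθ (by linarith)
      · rw [if_neg (show ¬(gr T n k ≤ κ ∧ κ < gr T n (k + 1)) from fun h => absurd h.2 (not_lt.2 h2)), min_eq_right h2, min_eq_right h1,
          min_eq_left (h2.trans hκθ), min_eq_left (h1.trans hκθ)]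
        rcases (gr_nn hT n (k + 1)).lt_or_eq with h3 | h3
        · rw [if_pos (UU_le_kap hT hk0 h1 (h3.trans_le h2))]; simp
        · have : gr T n k = gr T n (k + 1) := le_antisymm hk (by rw [← h3]; exact hk0)
          rw [this]; simp
  refine (Finset.sum_le_sum hterm).trans ?_
  rw [← Finset.sum_filter, Finset.sum_const, nsmul_eq_mul]
  have hcard : (Finset.filter (fun k => gr T n k ≤ κ ∧ κ < gr T n (k + 1))
      (Finset.Ico j (2 ^ n))).card ≤ 1 := by
    refine Finset.card_le_one.2 fun k hk l hl => ?_
    simp only [Finset.mem_filter] at hk hl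
    by_contra hne
    rcases lt_or_gt_of_ne hne with h | h
    · exact absurd (hk.2.2.trans_le (gr_mono hT n h)) (not_lt.2 hl.2.1)
    · exact absurd (hl.2.2.trans_le (gr_mono hT n h)) (not_lt.2 hk.2.1)
  have : ((Finset.filter (fun k => gr T n k ≤ κ ∧ κ < gr T n (k + 1))
      (Finset.Ico j (2 ^ n))).card : ℝ) ≤ 1 := by exact_mod_cast hcard
  nlinarith

end Hedge

section Hedge2

variable {T : ℝ} (hT : 0 ≤ T)

lemma hedge_err (i : Bool) (n J : ℕ) (hJ : J ≤ 2 ^ n) {R B w : ℝ} (hB : R + 1 ≤ B) (p : PathPair T)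
    (hw : ∀ u v, 0 ≤ u → u ≤ v → v ≤ kap hT B p → v - u ≤ T / 2 ^ n →
      |fx hT i p v - fx hT i p u| ≤ w) :
    |∑ k ∈ Finset.Ico J (2 ^ n), chi R (UU hT p (gr T n k)) *
      (fx hT i p (min (gr T n (k + 1)) (kap hT B p)) - fx hT i p (min (gr T n k) (kap hT B p))) -
      (YY hT i R T p - YY hT i R (gr T n J) p)| ≤ w := by
  have e1 : ∑ k ∈ Finset.Ico J (2 ^ n), chi R (UU hT p (gr T n k)) *
      (fx hT i p (min (gr T n (k + 1)) (kap hT B p)) - fx hT i p (min (gr T n k) (kap hT B p))) =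
      ∫ a, ∑ k ∈ Finset.Ico J (2 ^ n), (if UU hT p (gr T n k) ≤ R + a then (1:ℝ) else 0) *
      (fx hT i p (min (gr T n (k + 1)) (kap hT B p)) - fx hT i p (min (gr T n k) (kap hT B p))) ∂nu1 := by
    rw [integral_finset_sum _ fun k _ => (chi_int R _).mul_const _]
    exact Finset.sum_congr rfl fun k _ => by rw [integral_mul_const]; rfl
  have e2 : YY hT i R T p - YY hT i R (gr T n J) p = ∫ a, (fx hT i p (min (kap hT (R + a) p) T) -
      fx hT i p (min (kap hT (R + a) p) (gr T n J))) ∂nu1 := by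
    unfold YY
    rw [← integral_sub (YY_int hT i R _ p) (YY_int hT i R _ p), max_eq_right hT,
      max_eq_right (gr_nn hT n J)]
    exact integral_congr_ae (ae_of_all _ fun a => by ring)
  have i1 : Integrable (fun a => ∑ k ∈ Finset.Ico J (2 ^ n), (if UU hT p (gr T n k) ≤ R + a then (1:ℝ) else 0) *
      (fx hT i p (min (gr T n (k + 1)) (kap hT B p)) - fx hT i p (min (gr T n k) (kap hT B p)))) nu1 :=
    integrable_finset_sum _ fun k _ => (chi_int R _).mul_const _
  have i2 : Integrable (fun a => fx hT i p (min (kap hT (R + a) p) T) -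
      fx hT i p (min (kap hT (R + a) p) (gr T n J))) nu1 := by
    have := (YY_int hT i R T p).sub (YY_int hT i R (gr T n J) p)
    rw [max_eq_right hT, max_eq_right (gr_nn hT n J)] at this
    exact this.congr (ae_of_all _ fun a => by simp)
  rw [e1, e2, ← integral_sub i1 i2]
  rw [← Real.norm_eq_abs]
  refine (norm_integral_le_of_norm_le_const (μ := nu1) (C := w) ?_).trans (by rw [probReal_univ, mul_one])
  filter_upwards [nu1_ae] with a ha
  exact step_err hT i n J hJ (by linarith [ha.2]) p hw

/-- gain of a grid strategy stopped at `kap B` -/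
def gain (B : ℝ) (n : ℕ) (H : Bool → ℕ → PathPair T → ℝ) (p : PathPair T) : ℝ :=
  ∑ i, ∑ k ∈ Finset.range (2 ^ n), H i k p *
    (fx hT i p (min (gr T n (k + 1)) (kap hT B p)) - fx hT i p (min (gr T n k) (kap hT B p)))

/-- admissible integrands -/
def Good (n : ℕ) (H : Bool → ℕ → PathPair T → ℝ) : Prop :=
  (∀ i k, Measurable (H i k)) ∧ (∃ C, ∀ i k p, |H i k p| ≤ C) ∧
    ∀ i k p, H i k (stp hT p (gr T n k)) = H i k p

variable (Zbar : PathPair T → ℝ≥0∞)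

/-- approximately hedgeable functionals -/
def Hd (ℓ : PathPair T → ℝ) : Prop := ∀ ε > 0, ∃ B0 : ℝ, ∀ B ≥ B0, ∃ n0 : ℕ, ∀ n ≥ n0,
  ∃ H, Good hT n H ∧ ∀ p, Zbar p ≠ ⊤ → |gain hT B n H p - ℓ p| ≤ ε * (Zbar p).toReal

variable {Zbar}

lemma Hd_basic (hZ1 : ∀ p, 1 ≤ Zbar p) (hZc : ∀ c : ℝ≥0∞, c ≠ ⊤ → IsCompact {p | Zbar p ≤ c})
    (G : BoundedContinuousFunction (PathPair T) ℝ) {m j : ℕ} (hj : j ≤ 2 ^ m) (R : ℕ) (i : Bool) :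
    Hd hT Zbar (tst hT G m j R i) := by
  intro ε hε
  refine ⟨R + 1, fun B hB => ?_⟩
  have hg := norm_nonneg G
  have hbd := bd_nn B
  set c : ℝ := ‖G‖ * bd B / ε with hc
  have hc0 : 0 ≤ c := by positivity
  have huc := ((hZc (ENNReal.ofReal c) ENNReal.ofReal_ne_top).prod (isCompact_Icc (a := (0:ℝ)) (b := T)))
    |>.uniformContinuousOn_of_continuous (fx_cont hT i).continuousOn
  rw [Metric.uniformContinuousOn_iff] at huc
  obtain ⟨δ, hδ, hd⟩ := huc (ε / (‖G‖ + 1)) (by positivity)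
  have ht0 : Tendsto (fun n : ℕ => T / 2 ^ n) atTop (𝓝 0) := by
    have := (tendsto_pow_atTop_nhds_zero_of_lt_one (r := (1/2:ℝ)) (by norm_num) (by norm_num)).const_mul T
    simpa [div_eq_mul_inv] using this
  obtain ⟨n1, hn1⟩ := eventually_atTop.1 (ht0.eventually (gt_mem_nhds hδ))
  refine ⟨max m n1, fun n hn => ?_⟩
  have hmn : m ≤ n := (le_max_left _ _).trans hn
  have hnδ := hn1 n ((le_max_right _ _).trans hn)
  set J := j * 2 ^ (n - m) with hJ
  have hJn : J ≤ 2 ^ n := by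
    calc J ≤ 2 ^ m * 2 ^ (n - m) := Nat.mul_le_mul_right _ hj
      _ = 2 ^ n := by rw [← pow_add, Nat.add_sub_cancel' hmn]
  have hs : gr T n J = gr T m j := gr_refine hmn j
  refine ⟨fun i' k p => if i' = i ∧ J ≤ k then G (stp hT p (gr T m j)) * chi R (UU hT p (gr T n k)) else 0,
    ⟨fun i' k => ?_, ⟨‖G‖, fun i' k p => ?_⟩, fun i' k p => ?_⟩, fun p hp => ?_⟩
  · dsimp only; split_ifs
    · exact (G.continuous.comp (stp_cont_p hT _)).measurable.mul ((chi_meas R).comp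
        ((UU_cont hT).comp (Continuous.prodMk_left (gr T n k))).measurable)
    · exact measurable_const
  · dsimp only; split_ifs
    · rw [abs_mul]
      have := mul_le_mul (G.norm_coe_le_norm (stp hT p (gr T m j))) (chi_abs R (UU hT p (gr T n k)))
        (abs_nonneg _) hg
      simpa using this
    · simpa using hg
  · by_cases h : i' = i ∧ J ≤ k
    · simp only [if_pos h]
      rw [stp_stp, UU_stp, min_self, min_eq_left (hs ▸ gr_mono hT n h.2)]
    · simp only [if_neg h]
  · have e : gain hT B n (fun i' k p => if i' = i ∧ J ≤ k then
        G (stp hT p (gr T m j)) * chi R (UU hT p (gr T n k)) else 0) p =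
        G (stp hT p (gr T m j)) * ∑ k ∈ Finset.Ico J (2 ^ n), chi R (UU hT p (gr T n k)) *
        (fx hT i p (min (gr T n (k + 1)) (kap hT B p)) - fx hT i p (min (gr T n k) (kap hT B p))) := by
      unfold gain
      rw [Finset.sum_eq_single i]
      · simp only [true_and, ite_mul, zero_mul]
        rw [← Finset.sum_filter, Finset.mul_sum]
        refine Finset.sum_congr ?_ fun k _ => by ring
        ext k; simp [and_comm]
      · intro b _ hb; simp [hb]
      · simp
    rw [e]; unfold tst
    rw [← mul_sub, abs_mul, ← hs]
    have hGp := G.norm_coe_le_norm (stp hT p (gr T n J))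
    rw [Real.norm_eq_abs] at hGp
    have hZ1' : 1 ≤ (Zbar p).toReal := by
      have := ENNReal.toReal_mono hp (hZ1 p); simpa using this
    by_cases hpc : Zbar p ≤ ENNReal.ofReal c
    · have := hedge_err hT i n J hJn hB p (w := ε / (‖G‖ + 1)) fun u v hu huv hv hvu => by
        have hvT := hv.trans ((kap_Stp hT B).le p)
        have := hd (p, v) ⟨hpc, hu.trans huv, hvT⟩ (p, u) ⟨hpc, hu, huv.trans hvT⟩ (by
          rw [Prod.dist_eq, dist_self, max_eq_right dist_nonneg, Real.dist_eq, abs_of_nonneg (by linarith)]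
          linarith)
        exact this.le
      calc _ ≤ ‖G‖ * (ε / (‖G‖ + 1)) := mul_le_mul hGp this (abs_nonneg _) hg
        _ ≤ ε := by rw [mul_div_assoc', div_le_iff₀ (by positivity)]; nlinarith
        _ ≤ _ := by nlinarith
    · have := hedge_err hT i n J hJn hB p (w := bd B) fun u v hu huv hv hvu => fx_bdd hT i hu huv hv
      have hcz : c ≤ (Zbar p).toReal := (ENNReal.ofReal_le_iff_le_toReal hp).1 (le_of_not_ge hpc)
      calc _ ≤ ‖G‖ * bd B := mul_le_mul hGp this (abs_nonneg _) hg
        _ = ε * c := by rw [hc]; field_simp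
        _ ≤ _ := by gcongr

lemma Hd_LL (hZ1 : ∀ p, 1 ≤ Zbar p) (hZc : ∀ c : ℝ≥0∞, c ≠ ⊤ → IsCompact {p | Zbar p ≤ c})
    {ℓ : BoundedContinuousFunction (PathPair T) ℝ} (hℓ : ℓ ∈ LL hT) : Hd hT Zbar ℓ := by
  refine Submodule.span_induction (R := ℝ) (p := fun (ℓ : BoundedContinuousFunction (PathPair T) ℝ) _ => Hd hT Zbar ℓ) ?_ ?_ ?_ ?_ hℓ
  · rintro _ ⟨G, m, j, R, i, hj, rfl⟩
    exact Hd_basic hT hZ1 hZc G hj R i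
  · intro ε hε
    refine ⟨0, fun B _ => ⟨0, fun n _ => ⟨fun _ _ _ => 0, ⟨fun _ _ => measurable_const, ⟨0, by simp⟩,
      by simp⟩, fun p _ => ?_⟩⟩⟩
    simp only [gain, zero_mul, Finset.sum_const_zero]
    simp; positivity
  · intro f g _ _ hf hg ε hε
    obtain ⟨B1, h1⟩ := hf (ε / 2) (by positivity)
    obtain ⟨B2, h2⟩ := hg (ε / 2) (by positivity)
    refine ⟨max B1 B2, fun B hB => ?_⟩
    obtain ⟨n1, h1⟩ := h1 B ((le_max_left _ _).trans hB)
    obtain ⟨n2, h2⟩ := h2 B ((le_max_right _ _).trans hB)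
    refine ⟨max n1 n2, fun n hn => ?_⟩
    obtain ⟨H1, ⟨m1, ⟨C1, c1⟩, a1⟩, h1⟩ := h1 n ((le_max_left _ _).trans hn)
    obtain ⟨H2, ⟨m2, ⟨C2, c2⟩, a2⟩, h2⟩ := h2 n ((le_max_right _ _).trans hn)
    refine ⟨fun i k p => H1 i k p + H2 i k p, ⟨fun i k => (m1 i k).add (m2 i k), ⟨C1 + C2, fun i k p =>
      (abs_add_le _ _).trans (add_le_add (c1 i k p) (c2 i k p))⟩, fun i k p => by simp only [a1, a2]⟩, fun p hp => ?_⟩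
    have e : gain hT B n (fun i k p => H1 i k p + H2 i k p) p = gain hT B n H1 p + gain hT B n H2 p := by
      simp only [gain, add_mul, Finset.sum_add_distrib]
    rw [e, BoundedContinuousFunction.coe_add, Pi.add_apply, add_sub_add_comm]
    refine (abs_add_le _ _).trans ((add_le_add (h1 p hp) (h2 p hp)).trans (by linarith))
  · intro a f _ hf ε hε
    obtain ⟨B1, h1⟩ := hf (ε / (|a| + 1)) (by positivity)
    refine ⟨B1, fun B hB => ?_⟩
    obtain ⟨n1, h1⟩ := h1 B hB
    refine ⟨n1, fun n hn => ?_⟩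
    obtain ⟨H1, ⟨m1, ⟨C1, c1⟩, a1⟩, h1⟩ := h1 n hn
    refine ⟨fun i k p => a * H1 i k p, ⟨fun i k => (m1 i k).const_mul a, ⟨|a| * C1, fun i k p => by
      rw [abs_mul]; exact mul_le_mul_of_nonneg_left (c1 i k p) (abs_nonneg a)⟩, fun i k p => by simp only [a1]⟩,
      fun p hp => ?_⟩
    have e : gain hT B n (fun i k p => a * H1 i k p) p = a * gain hT B n H1 p := by
      simp only [gain, mul_assoc, Finset.mul_sum]
    rw [e, BoundedContinuousFunction.smul_apply, smul_eq_mul, ← mul_sub, abs_mul]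
    calc _ ≤ |a| * (ε / (|a| + 1) * (Zbar p).toReal) := mul_le_mul_of_nonneg_left (h1 p hp) (abs_nonneg a)
      _ = (|a| / (|a| + 1)) * (ε * (Zbar p).toReal) := by ring
      _ ≤ 1 * (ε * (Zbar p).toReal) := by
        gcongr
        rw [div_le_one (by positivity)]; linarith
      _ = _ := one_mul _

end Hedge2

section Strat

variable {T : ℝ} (hT : 0 ≤ T)

lemma Fraw_mono {s t : ℝ} (h : s ≤ t) : Fraw T s ≤ Fraw T t :=
  iSup₂_le fun u hu => le_iSup₂_of_le u (hu.trans h) le_rfl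

lemma Fplus_iff {t : ℝ} {A : Set (Path T)} :
    MeasurableSet[Fplus T t] A ↔ ∀ s, t < s → MeasurableSet[Fraw T (min s T)] A := by
  unfold Fplus
  simp only [MeasurableSpace.measurableSet_iInf]

lemma Fraw_le_Fplus {t : ℝ} (ht : t ≤ T) : Fraw T t ≤ Fplus T t :=
  le_iInf₂ fun s hs => Fraw_mono (le_min hs.le ht)

lemma stop_of_lt {τ : Path T → ℝ} (hle : ∀ ω, τ ω ≤ T)
    (h : ∀ r ∈ Icc (0:ℝ) T, MeasurableSet[Fraw T r] {ω | τ ω < r}) : IsStopPlus T τ := by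
  intro t ht
  rcases ht.2.lt_or_eq with htT | rfl
  · refine Fplus_iff.2 fun s hs => ?_
    have hr : t < min s T := lt_min hs htT
    set r := min s T with hrd
    have e : {ω | τ ω ≤ t} = ⋂ n : ℕ, {ω | τ ω < t + (r - t) / (n + 1)} := by
      ext ω
      simp only [mem_setOf_eq, mem_iInter]
      refine ⟨fun h n => lt_of_le_of_lt h ?_, fun h => ?_⟩
      · have : 0 < (r - t) / (n + 1) := div_pos (by linarith) (by positivity)
        linarith
      · have ht1 : Tendsto (fun n : ℕ => t + (r - t) / ((n:ℝ) + 1)) atTop (𝓝 t) := by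
          have := (tendsto_one_div_add_atTop_nhds_zero_nat (𝕜 := ℝ)).const_mul (r - t)
          have := this.const_add t
          simpa [div_eq_mul_inv] using this
        exact ge_of_tendsto' ht1 fun n => (h n).le
    rw [e]
    refine @MeasurableSet.iInter _ _ (Fraw T r) _ _ fun n => ?_
    have h0 : 0 ≤ (r - t) / ((n:ℝ) + 1) := div_nonneg (by linarith) (by positivity)
    have h1 : (r - t) / ((n:ℝ) + 1) ≤ r - t := div_le_self (by linarith) (by linarith [n.cast_nonneg (α := ℝ)])
    exact Fraw_mono (by linarith) _ (h _ ⟨by linarith [ht.1], by linarith [min_le_right s T]⟩)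
  · rw [show {ω | τ ω ≤ t} = univ from eq_univ_of_forall hle]
    exact @MeasurableSet.univ _ (Fplus t t)

/-- path version of `kap` -/
def tht (B : ℝ) (ω : Path T) : ℝ := hit (fun u p => if ∃ q : ℚ, (q:ℝ) = u then
  UU hT (ps hT (sp hT p.1 u)) u else B) B ((ω, ω) : PathPair T)

lemma tht_lt {B r : ℝ} (hr : r ≤ T) {ω : Path T} : tht hT B ω < r ↔
    ∃ q : ℚ, (0 ≤ (q:ℝ) ∧ (q:ℝ) < r) ∧ B < UU hT (ps hT (sp hT ω q)) q := by
  unfold tht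
  rw [hit_lt_iff hT hr]
  constructor
  · rintro ⟨u, hu, hur, h⟩
    by_cases hq : ∃ q : ℚ, (q:ℝ) = u
    · simp only [if_pos hq] at h
      obtain ⟨q, rfl⟩ := hq
      exact ⟨q, ⟨hu.1, hur⟩, h⟩
    · simp only [if_neg hq] at h
      exact absurd h (lt_irrefl _)
  · rintro ⟨q, ⟨h0, h1⟩, h⟩
    refine ⟨q, ⟨h0, h1.le.trans hr⟩, h1, ?_⟩
    rw [if_pos ⟨q, rfl⟩]; exact h

lemma tht_meas (B : ℝ) {r : ℝ} (hr : r ∈ Icc (0:ℝ) T) : MeasurableSet[Fraw T r] {ω | tht hT B ω < r} := by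
  have e : {ω | tht hT B ω < r} = ⋃ q : ℚ, ⋃ (_ : 0 ≤ (q:ℝ) ∧ (q:ℝ) < r),
      (fun ω => sp hT ω q) ⁻¹' {ω | B < UU hT (ps hT ω) q} := by
    ext ω; simp only [mem_setOf_eq, tht_lt hT hr.2, mem_iUnion, mem_preimage, exists_prop]
  rw [e]
  refine @MeasurableSet.iUnion _ _ (Fraw T r) _ _ fun q => @MeasurableSet.iUnion _ _ (Fraw T r) _ _ fun hq => ?_
  refine Fraw_mono hq.2.le _ (sp_Fraw hT ⟨hq.1, hq.2.le.trans hr.2⟩ ?_)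
  exact measurableSet_lt measurable_const
    (((UU_cont hT).comp (Continuous.prodMk_left (q:ℝ))).measurable.comp (ps_measurable hT))

lemma tht_eq (B : ℝ) {ω : Path T} (h : ω ∈ BigOmega T hT) : tht hT B ω = kap hT B (ps hT ω) := by
  have key : ∀ q : ℝ, q ∈ Icc (0:ℝ) T → UU hT (ps hT (sp hT ω q)) q = UU hT (ps hT ω) q := fun q hq => by
    rw [ps_sp hT h hq, UU_stp, min_self]
  have k1 : ∀ r ≤ T, tht hT B ω < r ↔ kap hT B (ps hT ω) < r := by
    intro r hr
    rw [tht_lt hT hr]; unfold kap; rw [hit_lt_iff hT hr]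
    constructor
    · rintro ⟨q, hq, hb⟩
      have hm : (q:ℝ) ∈ Icc (0:ℝ) T := ⟨hq.1, hq.2.le.trans hr⟩
      exact ⟨q, hm, hq.2, by rwa [← key q hm]⟩
    · rintro ⟨u, hu, hur, hb⟩
      obtain ⟨q, hq1, hq2⟩ := exists_rat_btwn hur
      have h0 : 0 ≤ (q:ℝ) := hu.1.trans hq1.le
      refine ⟨q, ⟨h0, hq2⟩, ?_⟩
      rw [key q ⟨h0, hq2.le.trans hr⟩]
      exact lt_of_lt_of_le hb (UU_mono hT _ hq1.le)
  have l1 : tht hT B ω ≤ T := hit_le hT _ _ _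
  have l2 : kap hT B (ps hT ω) ≤ T := hit_le hT _ _ _
  refine le_antisymm (not_lt.1 fun h => ?_) (not_lt.1 fun h => ?_)
  · exact lt_irrefl _ ((k1 _ l1).2 h)
  · exact lt_irrefl _ ((k1 _ l2).1 h)

lemma exists_strat (B : ℝ) (n : ℕ) (H : ℕ → PathPair T → ℝ) (hm : ∀ k, Measurable (H k))
    (hC : ∃ C, ∀ k p, |H k p| ≤ C) (ha : ∀ k p, H k (stp hT p (gr T n k)) = H k p) :
    ∃ St : SimpleStrategy T, ∀ (X : ℝ → Path T → ℝ) (ω) (_ : ω ∈ BigOmega T hT),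
      integ T St X T ω = ∑ k ∈ Finset.range (2 ^ n), H k (ps hT ω) *
        (X (min (gr T n (k + 1)) (kap hT B (ps hT ω))) ω - X (min (gr T n k) (kap hT B (ps hT ω))) ω) := by
  obtain ⟨C, hC⟩ := hC
  have hC0 : 0 ≤ C := (abs_nonneg _).trans (hC 0 ((0, 0) : PathPair T))
  have hθT : ∀ ω, tht hT B ω ≤ T := fun ω => hit_le hT _ _ _
  have hst : ∀ k, IsStopPlus T fun ω => min (gr T n k) (tht hT B ω) := fun k => by
    refine stop_of_lt (fun ω => (min_le_right _ _).trans (hθT ω)) fun r hr => ?_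
    by_cases hk : gr T n k < r
    · rw [show {ω | min (gr T n k) (tht hT B ω) < r} = univ from eq_univ_of_forall fun ω => by simp [hk]]
      exact @MeasurableSet.univ _ (Fraw T r)
    · rw [show {ω | min (gr T n k) (tht hT B ω) < r} = {ω | tht hT B ω < r} by ext ω; simp [hk]]
      exact tht_meas hT B hr
  let St : SimpleStrategy T :=
    { L := 2 ^ n
      τ := fun k ω => min (gr T n k) (tht hT B ω)
      coeff := fun k ω => if tht hT B ω < gr T n k then 0 else H k (ps hT (sp hT ω (gr T n k)))
      τ_nonneg := fun ω => le_min (gr_nn hT n _) (hit_nn hT _ _ _)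
      τ_mono := fun l ω => min_le_min_right _ (gr_mono hT n (by simp))
      τ_le := fun ω => (min_le_right _ _).trans (hθT ω)
      τ_stop := fun l => hst l
      coeff_bdd := fun l => ⟨C, fun ω => by
        split_ifs
        · simpa using hC0
        · exact hC _ _⟩
      coeff_meas := fun l A hA t ht => by
        have hl : gr T n l ∈ Icc (0:ℝ) T := ⟨gr_nn hT n _, gr_le hT n l.2.le⟩
        simp only [Fin.val_castSucc]
        by_cases hlt : gr T n l ≤ t
        · rw [show {ω | min (gr T n l) (tht hT B ω) ≤ t} = univ from eq_univ_of_forall fun ω => by simp [hlt],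
            inter_univ]
          refine Fraw_le_Fplus ht.2 _ (Fraw_mono hlt _ ?_)
          have : Measurable[Fraw T (gr T n l)] fun ω => if tht hT B ω < gr T n l then 0
              else H l (ps hT (sp hT ω (gr T n l))) :=
            Measurable.ite (m := Fraw T (gr T n l)) (f := fun _ => (0:ℝ))
              (g := fun ω => H l (ps hT (sp hT ω (gr T n l)))) (tht_meas hT B hl)
              (@measurable_const _ _ _ (Fraw T (gr T n l)) _)
              (((hm l).comp (ps_measurable hT)).comp (sp_Fraw hT hl))
          exact this hA
        · have hs := hst l t ht
          push Not at hlt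
          have z : ∀ ω, min (gr T n l) (tht hT B ω) ≤ t → tht hT B ω < gr T n l := fun ω h => by
            rcases min_le_iff.1 h with h | h
            · exact absurd h (not_le.2 hlt)
            · exact h.trans_lt hlt
          by_cases h0 : (0:ℝ) ∈ A
          · convert hs using 1
            ext ω
            simp only [mem_inter_iff, mem_preimage, mem_setOf_eq, and_iff_right_iff_imp]
            intro h; rw [if_pos (z ω h)]; exact h0
          · convert @MeasurableSet.empty _ (Fplus T t) using 1
            ext ω
            simp only [mem_inter_iff, mem_preimage, mem_setOf_eq, mem_empty_iff_false, iff_false, not_and']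
            intro h; rw [if_pos (z ω h)]; exact h0 }
  refine ⟨St, fun X ω hω => ?_⟩
  have e := tht_eq hT B hω
  have hθ := (kap_Stp hT B).le (ps hT ω)
  rw [Finset.sum_range]
  refine Finset.sum_congr rfl fun l _ => ?_
  have hl : gr T n l ∈ Icc (0:ℝ) T := ⟨gr_nn hT n _, gr_le hT n (show (l:ℕ) < 2 ^ n from l.2).le⟩
  have e1 : St.τ l.succ ω = min (gr T n (l + 1)) (kap hT B (ps hT ω)) := by rw [← e]; simp [St]
  have e2 : St.τ l.castSucc ω = min (gr T n l) (kap hT B (ps hT ω)) := by rw [← e]; simp [St]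
  have e3 : St.coeff l ω = if tht hT B ω < gr T n l then 0 else H l (ps hT (sp hT ω (gr T n l))) := rfl
  rw [e1, e2, e3, min_eq_left ((min_le_right _ _).trans hθ), min_eq_left ((min_le_right _ _).trans hθ)]
  split_ifs with h
  · rw [e] at h
    rw [min_eq_right h.le, min_eq_right (h.le.trans (gr_mono hT n (Nat.le_succ _)))]; simp
  · rw [ps_sp hT hω hl, ha]

lemma exists_hedge (B : ℝ) (n : ℕ) {H : Bool → ℕ → PathPair T → ℝ} (hH : Good hT n H) :
    ∃ A G : SimpleStrategy T, ∀ ω ∈ BigOmega T hT,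
      integ T A (Sproc T hT) T ω + integ T G (SS T hT) T ω = gain hT B n H (ps hT ω) := by
  obtain ⟨hm, ⟨C, hC⟩, ha⟩ := hH
  obtain ⟨A, hA⟩ := exists_strat hT B n (H true) (hm true) ⟨C, hC true⟩ (ha true)
  obtain ⟨G, hG⟩ := exists_strat hT B n (fun k p => 2 * H false k p) (fun k => (hm false k).const_mul 2)
    ⟨2 * C, fun k p => by rw [abs_mul, abs_two]; linarith [hC false k p]⟩ (fun k p => by simp only [ha])
  refine ⟨A, G, fun ω hω => ?_⟩
  rw [hA _ ω hω, hG _ ω hω, gain, Fintype.sum_bool]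
  congr 1
  refine Finset.sum_congr rfl fun k hk => ?_
  have hb := BO_of_mem hT hω
  have hθ := (kap_Stp hT B).le (ps hT ω)
  have h0 := kap_nn hT B (ps hT ω)
  have hS : ∀ j, SS T hT (min (gr T n j) (kap hT B (ps hT ω))) ω = _ := fun j =>
    BO.SS hT hb ⟨le_min (gr_nn hT n j) h0, (min_le_right _ _).trans hθ⟩
  rw [hS, hS]
  simp only [fx, XX, ps, Bool.false_eq_true, if_false]
  ring

end Strat

section Dual

variable {T : ℝ} (hT : 0 ≤ T)

lemma V_le {p : PathPair T} (h : Monotone p.2) {a b : ℝ} (hab : a ≤ b) :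
    0 ≤ ev T hT p.2 b - ev T hT p.2 a :=
  sub_nonneg.2 (h (Set.monotone_projIcc (h := hT) hab))

variable {Q : Measure (PathPair T)} [IsProbabilityMeasure Q]
  (hN : Integrable (fun p : PathPair T => ‖p.1‖ + ‖p.2‖) Q) (h1 : LP1 hT Q) (h2 : LP2 hT Q)
  (hV : ∀ᵐ p ∂Q, Monotone p.2)

include hT hV in
lemma sq_van {α β : PathPair T → ℝ} (hα : Stp hT α) (hβ : Stp hT β)
    (hle : ∀ p, α p ≤ β p) {R : ℝ} (hβR : ∀ p, β p ≤ kap hT R p) :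
    Tendsto (fun n : ℕ => ∫ p, ∑ j ∈ Finset.range (2 ^ n),
      (ev T hT p.2 (max (α p) (min (β p) (gr T n (j + 1)))) -
        ev T hT p.2 (max (α p) (min (β p) (gr T n j)))) ^ 2 ∂Q) atTop (𝓝 0) := by
  have hum : ∀ n j, Measurable fun p => ev T hT p.2 (max (α p) (min (β p) (gr T n j))) := fun n j =>
    ev_meas hT measurable_snd (hα.meas.max (hβ.meas.min measurable_const))
  have hmon : ∀ p n j, max (α p) (min (β p) (gr T n j)) ≤ max (α p) (min (β p) (gr T n (j + 1))) :=
    fun p n j => max_le_max_left _ (min_le_min_left _ (gr_mono hT n (Nat.le_succ j)))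
  have tel : ∀ p n, ∑ j ∈ Finset.range (2 ^ n), (ev T hT p.2 (max (α p) (min (β p) (gr T n (j + 1)))) -
        ev T hT p.2 (max (α p) (min (β p) (gr T n j)))) = ev T hT p.2 (β p) - ev T hT p.2 (α p) := by
    intro p n
    rw [Finset.sum_range_sub (fun j => ev T hT p.2 (max (α p) (min (β p) (gr T n j)))), gr_end,
      min_eq_left (hβ.le p), max_eq_right (hle p), show gr T n 0 = 0 by simp [gr],
      min_eq_right (hβ.nn p), max_eq_left (hα.nn p)]
  rw [show (0:ℝ) = ∫ _ : PathPair T, (0:ℝ) ∂Q by simp]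
  refine tendsto_integral_of_dominated_convergence (fun _ => (2 * |R|) ^ 2)
    (fun n => (Finset.measurable_sum _ fun j _ => ((hum n _).sub (hum n j)).pow_const 2).aestronglyMeasurable)
    (integrable_const _) (fun n => ?_) ?_
  · filter_upwards [hV] with p hp
    have hd : ∀ j, 0 ≤ ev T hT p.2 (max (α p) (min (β p) (gr T n (j + 1)))) -
        ev T hT p.2 (max (α p) (min (β p) (gr T n j))) := fun j => V_le hT hp (hmon p n j)
    rw [Real.norm_of_nonneg (Finset.sum_nonneg fun j _ => sq_nonneg _)]
    refine (Finset.sum_sq_le_sq_sum_of_nonneg fun j _ => hd j).trans ?_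
    rw [tel]
    refine pow_le_pow_left₀ (V_le hT hp (hle p)) ?_ 2
    exact (le_abs_self _).trans (S_diff_bdd hT (hα.nn p) (hle p) (hβR p)).2.1
  · filter_upwards [hV] with p hp
    have hd : ∀ n j, 0 ≤ ev T hT p.2 (max (α p) (min (β p) (gr T n (j + 1)))) -
        ev T hT p.2 (max (α p) (min (β p) (gr T n j))) := fun n j => V_le hT hp (hmon p n j)
    have hW := V_le hT hp (hle p)
    set W := ev T hT p.2 (β p) - ev T hT p.2 (α p) with hWd
    have huc := (isCompact_Icc (a := (0:ℝ)) (b := T)).uniformContinuousOn_of_continuous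
      (ev_cont_t hT p.2).continuousOn
    rw [Metric.uniformContinuousOn_iff] at huc
    rw [Metric.tendsto_atTop]
    intro ε hε
    obtain ⟨η, hη, h⟩ := huc (ε / (W + 1)) (by positivity)
    have ht0 : Tendsto (fun n : ℕ => T / 2 ^ n) atTop (𝓝 0) := by
      have := (tendsto_pow_atTop_nhds_zero_of_lt_one (r := (1/2:ℝ)) (by norm_num) (by norm_num)).const_mul T
      simpa [div_eq_mul_inv] using this
    obtain ⟨N, hN⟩ := eventually_atTop.1 (ht0.eventually (gt_mem_nhds hη))
    refine ⟨N, fun n hn => ?_⟩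
    rw [Real.dist_eq, sub_zero, abs_of_nonneg (Finset.sum_nonneg fun j _ => sq_nonneg _)]
    have hub : ∀ j, max (α p) (min (β p) (gr T n j)) ∈ Icc (0:ℝ) T := fun j =>
      ⟨(hα.nn p).trans (le_max_left _ _), max_le (hα.le p) ((min_le_left _ _).trans (hβ.le p))⟩
    calc _ ≤ ∑ j ∈ Finset.range (2 ^ n), ε / (W + 1) * (ev T hT p.2 (max (α p) (min (β p) (gr T n (j + 1)))) -
        ev T hT p.2 (max (α p) (min (β p) (gr T n j)))) := by
          refine Finset.sum_le_sum fun j _ => ?_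
          rw [sq]
          refine mul_le_mul_of_nonneg_right ?_ (hd n j)
          have hlt := h _ (hub (j + 1)) _ (hub j) (by
            have h3 := hN n hn
            have h4 := gr_step (T := T) n j
            have h5 := hmon p n j
            rw [Real.dist_eq, abs_of_nonneg (by linarith)]
            have : max (α p) (min (β p) (gr T n (j + 1))) ≤ max (α p) (min (β p) (gr T n j)) + T / 2 ^ n := by
              have := le_max_left (α p) (min (β p) (gr T n j))
              have := le_max_right (α p) (min (β p) (gr T n j))
              have hp0 : 0 ≤ T / 2 ^ n := by positivity
              refine max_le (by linarith) ?_
              rcases min_cases (β p) (gr T n j) with ⟨e, _⟩ | ⟨e, _⟩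
              · have := min_le_left (β p) (gr T n (j + 1)); linarith
              · have := min_le_right (β p) (gr T n (j + 1)); linarith
            linarith)
          rw [Real.dist_eq] at hlt
          exact (le_abs_self _).trans hlt.le
      _ = ε * (W / (W + 1)) := by rw [← Finset.mul_sum, tel]; ring
      _ < ε * 1 := mul_lt_mul_of_pos_left (by rw [div_lt_one (by positivity)]; linarith) hε
      _ = ε := mul_one ε

lemma sum_sq_split (f : ℕ → ℝ) (N : ℕ) : (f N - f 0) ^ 2 = ∑ j ∈ Finset.range N, (f (j + 1) - f j) ^ 2 +
    2 * ∑ j ∈ Finset.range N, (f (j + 1) - f j) * (f N - f (j + 1)) := by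
  have e : ∀ N : ℕ, ∑ j ∈ Finset.range N, (f (j + 1) - f j) = f N - f 0 := Finset.sum_range_sub f
  have key : ∀ c, ∑ j ∈ Finset.range N, (f (j + 1) - f j) ^ 2 + 2 * ∑ j ∈ Finset.range N,
      (f (j + 1) - f j) * (c - f (j + 1)) = (f N - f 0) * (2 * c - f N - f 0) := by
    intro c
    induction N with
    | zero => simp
    | succ N ih => rw [Finset.sum_range_succ, Finset.sum_range_succ]; linarith
  rw [key]; ring

include hN h1 h2 hV in
lemma energy2 {α β : PathPair T → ℝ} (hα : Stp hT α) (hβ : Stp hT β)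
    (hle : ∀ p, α p ≤ β p) {R D : ℝ} (hβR : ∀ p, β p ≤ kap hT R p)
    (hD : ∀ p u, α p ≤ u → u ≤ β p → |ev T hT p.1 (β p) - ev T hT p.1 u| ≤ D) :
    ∫ p, (ev T hT p.2 (β p) - ev T hT p.2 (α p)) ^ 2 ∂Q ≤
      2 * D ^ 2 * ∫ p, (ev T hT p.2 (β p) - ev T hT p.2 (α p)) ∂Q := by
  have hW := sq_van hT hV hα hβ hle hβR
  set u : ℕ → ℕ → PathPair T → ℝ := fun n j p => max (α p) (min (β p) (gr T n j)) with hu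
  have hus : ∀ n j, j ≤ 2 ^ n → Stp hT (u n j) := fun n j hj =>
    hα.max (hβ.min (Stp.const (gr_nn hT n j) (gr_le hT n hj)))
  have hmon : ∀ p n j, u n j p ≤ u n (j + 1) p :=
    fun p n j => max_le_max_left _ (min_le_min_left _ (gr_mono hT n (Nat.le_succ j)))
  have huβ : ∀ p n j, u n j p ≤ β p := fun p n j => max_le (hle p) (min_le_left _ _)
  have huα : ∀ p n j, α p ≤ u n j p := fun p n j => le_max_left _ _
  have hend : ∀ p n, u n (2 ^ n) p = β p := fun p n => by
    simp only [hu]; rw [gr_end, min_eq_left (hβ.le p), max_eq_right (hle p)]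
  have h0 : ∀ p n, u n 0 p = α p := fun p n => by
    simp only [hu]; rw [show gr T n 0 = 0 by simp [gr], min_eq_right (hβ.nn p), max_eq_left (hα.nn p)]
  have em : ∀ τ, Stp hT τ → Measurable fun p : PathPair T => ev T hT p.2 (τ p) := fun τ h =>
    ev_meas hT measurable_snd h.meas
  have em1 : ∀ τ, Stp hT τ → Measurable fun p : PathPair T => ev T hT p.1 (τ p) := fun τ h =>
    ev_meas hT measurable_fst h.meas
  have dv : ∀ {a b : ℝ} {p : PathPair T}, 0 ≤ a → a ≤ b → b ≤ β p →
      |ev T hT p.2 b - ev T hT p.2 a| ≤ 2 * |R| := fun ha hab hb =>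
    (S_diff_bdd hT ha hab (hb.trans (hβR _))).2.1
  have dv1 : ∀ {a b : ℝ} {p : PathPair T}, 0 ≤ a → a ≤ b → b ≤ β p →
      |ev T hT p.1 b - ev T hT p.1 a| ≤ 2 * |R| := fun ha hab hb =>
    (S_diff_bdd hT ha hab (hb.trans (hβR _))).1
  have bound : ∀ n : ℕ, ∫ p, (ev T hT p.2 (β p) - ev T hT p.2 (α p)) ^ 2 ∂Q ≤
      ∫ p, ∑ j ∈ Finset.range (2 ^ n), (ev T hT p.2 (u n (j + 1) p) - ev T hT p.2 (u n j p)) ^ 2 ∂Q +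
      2 * D ^ 2 * ∫ p, (ev T hT p.2 (β p) - ev T hT p.2 (α p)) ∂Q := by
    intro n
    have hR2 : 0 ≤ 2 * |R| := by positivity
    have i1 : ∀ j, j < 2 ^ n → Integrable (fun p => (ev T hT p.2 (u n (j + 1) p) - ev T hT p.2 (u n j p)) ^ 2) Q :=
      fun j hj => bdd_int (((em _ (hus n _ hj)).sub (em _ (hus n j hj.le))).pow_const 2) (C := (2 * |R|) ^ 2)
        fun p => by
          rw [abs_pow]
          exact pow_le_pow_left₀ (abs_nonneg _) (dv ((hus n j hj.le).nn p) (hmon p n j) (huβ p n _)) 2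
    have i2 : ∀ j, j < 2 ^ n → Integrable (fun p => (ev T hT p.2 (u n (j + 1) p) - ev T hT p.2 (u n j p)) *
        (ev T hT p.2 (β p) - ev T hT p.2 (u n (j + 1) p))) Q :=
      fun j hj => bdd_int (((em _ (hus n _ hj)).sub (em _ (hus n j hj.le))).mul ((em _ hβ).sub (em _ (hus n _ hj))))
        (C := (2 * |R|) * (2 * |R|)) fun p => by
          rw [abs_mul]
          exact mul_le_mul (dv ((hus n j hj.le).nn p) (hmon p n j) (huβ p n _))
            (dv ((hus n _ hj).nn p) (huβ p n _) le_rfl) (abs_nonneg _) hR2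
    have i3 : ∀ j, j < 2 ^ n → Integrable (fun p => ev T hT p.2 (u n (j + 1) p) - ev T hT p.2 (u n j p)) Q :=
      fun j hj => bdd_int ((em _ (hus n _ hj)).sub (em _ (hus n j hj.le))) (C := 2 * |R|)
        fun p => dv ((hus n j hj.le).nn p) (hmon p n j) (huβ p n _)
    have e1 : ∀ p : PathPair T, (ev T hT p.2 (β p) - ev T hT p.2 (α p)) ^ 2 =
        ∑ j ∈ Finset.range (2 ^ n), (ev T hT p.2 (u n (j + 1) p) - ev T hT p.2 (u n j p)) ^ 2 +
        2 * ∑ j ∈ Finset.range (2 ^ n), (ev T hT p.2 (u n (j + 1) p) - ev T hT p.2 (u n j p)) *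
        (ev T hT p.2 (β p) - ev T hT p.2 (u n (j + 1) p)) := fun p => by
      have := sum_sq_split (fun j => ev T hT p.2 (u n j p)) (2 ^ n)
      simpa only [hend, h0] using this
    have e2 : ∀ p : PathPair T, ev T hT p.2 (β p) - ev T hT p.2 (α p) =
        ∑ j ∈ Finset.range (2 ^ n), (ev T hT p.2 (u n (j + 1) p) - ev T hT p.2 (u n j p)) := fun p => by
      have := Finset.sum_range_sub (fun j => ev T hT p.2 (u n j p)) (2 ^ n)
      simpa only [hend, h0] using this.symm
    simp only [e1]
    rw [integral_add (integrable_finset_sum _ fun j hj => i1 j (Finset.mem_range.1 hj))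
      ((integrable_finset_sum _ fun j hj => i2 j (Finset.mem_range.1 hj)).const_mul 2), integral_const_mul]
    simp only [e2]
    rw [integral_finset_sum _ fun j hj => i2 j (Finset.mem_range.1 hj),
      integral_finset_sum (f := fun j (p : PathPair T) => ev T hT p.2 (u n (j + 1) p) - ev T hT p.2 (u n j p)) _
        fun j hj => i3 j (Finset.mem_range.1 hj), mul_assoc, Finset.mul_sum (a := D ^ 2)]
    refine add_le_add le_rfl (mul_le_mul_of_nonneg_left (Finset.sum_le_sum fun j hj => ?_) two_pos.le)
    have hj := Finset.mem_range.1 hj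
    have hMA : MA hT (u n (j + 1)) fun p => ev T hT p.2 (u n (j + 1) p) - ev T hT p.2 (u n j p) :=
      (MA.ev2 (hus n _ hj)).sub ((MA.ev2 (hus n j hj.le)).mono fun p => hmon p n j)
    have en := energy hT hN h1 h2 (hus n _ hj) hβ (fun p => huβ p n _) hβR hMA (C := 2 * |R|)
      fun p => dv ((hus n j hj.le).nn p) (hmon p n j) (huβ p n _)
    rw [← en, ← integral_const_mul]
    refine integral_mono_ae ?_ ((i3 j hj).const_mul _) ?_
    · exact bdd_int (((em _ (hus n _ hj)).sub (em _ (hus n j hj.le))).mul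
        (((em1 _ hβ).sub (em1 _ (hus n _ hj))).pow_const 2))
        (C := (2 * |R|) * (2 * |R|) ^ 2) fun p => by
          rw [abs_mul, abs_pow]
          exact mul_le_mul (dv ((hus n j hj.le).nn p) (hmon p n j) (huβ p n _))
            (pow_le_pow_left₀ (abs_nonneg _) (dv1 ((hus n _ hj).nn p) (huβ p n _) le_rfl) 2) (by positivity) hR2
    · filter_upwards [hV] with p hp
      rw [mul_comm]
      refine mul_le_mul_of_nonneg_right ?_ (V_le hT hp (hmon p n j))
      rw [← sq_abs]
      exact pow_le_pow_left₀ (abs_nonneg _) (hD p _ (huα p n _) (huβ p n _)) 2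
  have := ge_of_tendsto' (hW.add_const _) bound
  simpa using this

end Dual

section Dual2

variable {T : ℝ} (hT : 0 ≤ T) {Q : Measure (PathPair T)} [IsProbabilityMeasure Q]

lemma YY_ct (i : Bool) (R : ℝ) (p : PathPair T) : Continuous fun u => YY hT i R u p :=
  (YY_cont hT i R).comp (Continuous.prodMk_right p)

lemma YY_mt (i : Bool) (R : ℝ) {f : PathPair T → ℝ} (hf : Measurable f) :
    Measurable fun p => YY hT i R (f p) p :=
  (YY_cont hT i R).measurable.comp (measurable_id.prodMk hf)

lemma YY_d (i : Bool) (R a b : ℝ) (p : PathPair T) :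
    |YY hT i R a p - YY hT i R b p| ≤ bd (R + 1) + bd (R + 1) := by
  have h1 := YY_bdd hT i R a p
  have h2 := YY_bdd hT i R b p
  have := abs_sub (YY hT i R a p) (YY hT i R b p)
  linarith

variable (hL : ∀ ℓ ∈ LL hT, ∫ p, ℓ p ∂Q = 0)

include hL in
lemma mart_dy (i : Bool) (R m j : ℕ) (hj : j ≤ 2 ^ m) {g : PathPair T → ℝ} (hg : Measurable g)
    {C : ℝ} (hC : ∀ p, |g p| ≤ C) (hl : ∀ p, g (stp hT p (gr T m j)) = g p) :
    ∫ p, g p * (YY hT i R T p - YY hT i R (gr T m j) p) ∂Q = 0 := by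
  set s := gr T m j with hs
  set c : ℝ := bd (R + 1) + bd (R + 1) with hc
  have c0 : 0 ≤ c := add_nonneg (bd_nn _) (bd_nn _)
  set W : PathPair T → ℝ := fun p => YY hT i R T p - YY hT i R s p with hW
  have Wb : ∀ p, |W p| ≤ c := fun p => YY_d hT i R T s p
  have Wm : Measurable W := (YY_mt hT i R measurable_const).sub (YY_mt hT i R measurable_const)
  have sm : Measurable fun p => stp hT p s := (stp_cont_p hT s).measurable
  have key : ∀ (k : PathPair T → ℝ), Measurable k → (∀ p, 0 ≤ k p) → ∀ f : PathPair T → ℝ, Measurable f →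
      ∫ q, f q ∂((Q.withDensity fun p => ENNReal.ofReal (k p)).map fun p => stp hT p s) =
      ∫ p, k p * f (stp hT p s) ∂Q := by
    intro k hk hk0 f hf
    rw [integral_map sm.aemeasurable hf.aestronglyMeasurable,
      integral_withDensity_eq_integral_toReal_smul hk.ennreal_ofReal (ae_of_all _ fun p => ENNReal.ofReal_lt_top)]
    simp only [ENNReal.toReal_ofReal (hk0 _), smul_eq_mul]
  have fin : ∀ (k : PathPair T → ℝ), Measurable k → (∀ p, |k p| ≤ c + c) →
      IsFiniteMeasure ((Q.withDensity fun p => ENNReal.ofReal (k p)).map fun p => stp hT p s) := by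
    intro k hk hb
    have := isFiniteMeasure_withDensity_ofReal (bdd_int (Q := Q) hk hb).2
    infer_instance
  have W0 : ∀ p, 0 ≤ W p + c := fun p => by linarith [(abs_le.1 (Wb p)).1]
  have f1 := fin (fun p => W p + c) (Wm.add_const c) fun p => by
    rw [abs_of_nonneg (W0 p)]; linarith [(abs_le.1 (Wb p)).2]
  have f2 := fin (fun p => c) measurable_const fun p => by rw [abs_of_nonneg c0]; linarith
  have iW : ∀ (f : PathPair T → ℝ) (B : ℝ), Measurable f → (∀ p, |f p| ≤ B) → Integrable (fun p => f p * W p) Q :=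
    fun f B hf hB => bdd_int (hf.mul Wm) (C := B * c) fun p => by
      rw [abs_mul]; exact mul_le_mul (hB p) (Wb p) (abs_nonneg _) ((abs_nonneg _).trans (hB p))
  have spl : ∀ (f : PathPair T → ℝ) (B : ℝ), Measurable f → (∀ p, |f p| ≤ B) →
      ∫ p, (W p + c) * f p ∂Q = ∫ p, f p * W p ∂Q + ∫ p, c * f p ∂Q := fun f B hf hB => by
    rw [← integral_add (iW f B hf hB) ((bdd_int hf hB).const_mul c)]
    congr 1; ext p; ring
  have heq := ext_of_forall_integral_eq_of_IsFiniteMeasure (μ := (Q.withDensity fun p => ENNReal.ofReal (W p + c)).map fun p => stp hT p s)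
    (ν := (Q.withDensity fun p => ENNReal.ofReal c).map fun p => stp hT p s) (by
      intro G
      rw [key _ (Wm.add_const c) W0 G G.continuous.measurable, key _ measurable_const (fun _ => c0) G G.continuous.measurable,
        spl (fun p => G (stp hT p s)) ‖G‖ (G.continuous.measurable.comp sm) fun p => G.norm_coe_le_norm _]
      have := hL _ (Submodule.subset_span ⟨G, m, j, R, i, hj, rfl⟩)
      rw [show ∫ p, G (stp hT p s) * W p ∂Q = 0 from this, zero_add])
  have h3 := key _ (Wm.add_const c) W0 g hg
  rw [heq, key _ measurable_const (fun _ => c0) g hg] at h3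
  simp only [hl] at h3
  rw [spl g C hg hC] at h3
  change ∫ p, g p * W p ∂Q = 0
  linarith

include hL in
lemma mart_YY (i : Bool) (R : ℕ) (t : ℝ) (ht : t ∈ Icc (0:ℝ) T) (g : PathPair T → ℝ) (hg : Measurable g)
    (hC : ∃ C, ∀ p, |g p| ≤ C) (hl : ∀ p, g (stp hT p t) = g p) :
    ∫ p, g p * (YY hT i R T p - YY hT i R t p) ∂Q = 0 := by
  obtain ⟨C, hC⟩ := hC
  rcases hT.eq_or_lt with h0 | h0
  · have : t = T := le_antisymm ht.2 (h0 ▸ ht.1)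
    simp [this]
  have hex : ∀ n : ℕ, ∃ j ≤ 2 ^ n, t ≤ gr T n j ∧ gr T n j ≤ t + T / 2 ^ n := by
    intro n
    have h2 : (0:ℝ) < 2 ^ n := by positivity
    have hx : 0 ≤ t * 2 ^ n / T := div_nonneg (mul_nonneg ht.1 h2.le) hT
    refine ⟨⌈t * 2 ^ n / T⌉₊, ?_, ?_, ?_⟩
    · rw [Nat.ceil_le, div_le_iff₀ h0]
      push_cast
      nlinarith [ht.2]
    · have := Nat.le_ceil (t * 2 ^ n / T)
      unfold gr
      rw [le_div_iff₀ h2]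
      rwa [div_le_iff₀ h0] at this
    · have := (Nat.ceil_lt_add_one hx).le
      unfold gr
      rw [div_le_iff₀ h2, add_mul, div_mul_cancel₀ _ h2.ne']
      have h3 := mul_le_mul_of_nonneg_right this hT
      rwa [add_mul, div_mul_cancel₀ _ h0.ne', one_mul] at h3
  choose j hj hj1 hj2 using hex
  have hlim : Tendsto (fun n => gr T n (j n)) atTop (𝓝 t) := by
    refine tendsto_of_tendsto_of_tendsto_of_le_of_le tendsto_const_nhds ?_ hj1 hj2
    have := (tendsto_pow_atTop_nhds_zero_of_lt_one (r := (1/2:ℝ)) (by norm_num) (by norm_num)).const_mul T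
    have := this.const_add t
    simpa [div_eq_mul_inv] using this
  have h1 : Tendsto (fun n => ∫ p, g p * (YY hT i R T p - YY hT i R (gr T n (j n)) p) ∂Q) atTop
      (𝓝 (∫ p, g p * (YY hT i R T p - YY hT i R t p) ∂Q)) := by
    refine tendsto_integral_of_dominated_convergence (fun _ => C * (bd (R + 1) + bd (R + 1))) ?_
      (integrable_const _) ?_ ?_
    · intro n
      exact (hg.mul ((YY_mt hT i R measurable_const).sub (YY_mt hT i R measurable_const))).aestronglyMeasurable
    · intro n
      refine ae_of_all _ fun p => ?_
      rw [Real.norm_eq_abs, abs_mul]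
      exact mul_le_mul (hC p) (YY_d hT i R _ _ p) (abs_nonneg _) ((abs_nonneg _).trans (hC p))
    · exact ae_of_all _ fun p => (((((YY_ct hT i R p).tendsto t).comp hlim).const_sub _).const_mul _)
  have h2 : ∀ n, ∫ p, g p * (YY hT i R T p - YY hT i R (gr T n (j n)) p) ∂Q = 0 := fun n =>
    mart_dy hT hL i R n (j n) (hj n) hg hC fun p => by
      rw [← hl, stp_stp, ← hl p]
      congr 2
      have := hj1 n
      grind
  simp only [h2] at h1
  exact (tendsto_nhds_unique h1 tendsto_const_nhds)

include hL in
lemma LPx (i : Bool) (R : ℝ) {τ κ h : PathPair T → ℝ} {C : ℝ} (hτ : Stp hT τ) (hκ : Stp hT κ)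
    (hle : ∀ p, τ p ≤ κ p) (hκR : ∀ p, κ p ≤ kap hT R p) (hh : MA hT τ h) (hC : ∀ p, |h p| ≤ C) :
    ∫ p, h p * (fx hT i p (κ p) - fx hT i p (τ p)) ∂Q = 0 := by
  set N : ℕ := ⌈R⌉₊
  have hN : ∀ p, κ p ≤ kap hT N p := fun p => (hκR p).trans (kap_mono hT (Nat.le_ceil R) p)
  have := opt_stop2 hT (Q := Q) (Y := fun u p => YY hT i N u p) (D := fun _ => bd (N + 1)) (integrable_const _)
    (fun u _ p => YY_bdd hT i N u p) (fun p => YY_ct hT i N p) (fun u _ => YY_mt hT i N measurable_const)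
    (fun τ h => YY_mt hT i N h.meas) (mart_YY hT hL i N) hτ hκ hle hh hC
  rw [← this]
  congr 1; ext p
  rw [YY_eq hT i (hκ.nn p) (hN p), YY_eq hT i (hτ.nn p) ((hle p).trans (hN p))]
  ring

include hL in
lemma LP2_dual : LP2 hT Q := fun R τ κ h C hτ hκ hle hR hh hC =>
  LPx hT hL false R hτ hκ hle hR hh hC

include hL in
lemma LP1_dual (hN : Integrable (fun p : PathPair T => ‖p.1‖ + ‖p.2‖) Q) : LP1 hT Q := by
  intro τ κ h C hτ hκ hle hh hC
  have em : ∀ τ, Stp hT τ → Measurable fun p : PathPair T => ev T hT p.1 (τ p) := fun τ h =>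
    ev_meas hT measurable_fst h.meas
  have h1 : Tendsto (fun n : ℕ => ∫ p, (if τ p ≤ kap hT n p then h p else 0) *
      (ev T hT p.1 (min (κ p) (kap hT n p)) - ev T hT p.1 (min (τ p) (kap hT n p))) ∂Q) atTop
      (𝓝 (∫ p, h p * (ev T hT p.1 (κ p) - ev T hT p.1 (τ p)) ∂Q)) := by
    refine tendsto_integral_of_dominated_convergence (fun p => C * (2 * (‖p.1‖ + ‖p.2‖))) ?_
      ((hN.const_mul 2).const_mul C) ?_ ?_
    · intro n
      exact ((MA.ite_le hτ (kap_Stp hT n) hh).meas.mul ((em _ (hκ.min (kap_Stp hT n))).sub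
        (em _ (hτ.min (kap_Stp hT n))))).aestronglyMeasurable
    · intro n
      refine ae_of_all _ fun p => ?_
      have hC0 : 0 ≤ C := (abs_nonneg _).trans (hC p)
      rw [Real.norm_eq_abs, abs_mul]
      refine mul_le_mul ?_ ?_ (abs_nonneg _) hC0
      · split_ifs
        · exact hC p
        · simpa using hC0
      · have h1 := ev_abs_le hT p.1 (min (κ p) (kap hT n p))
        have h2 := ev_abs_le hT p.1 (min (τ p) (kap hT n p))
        have := abs_sub (ev T hT p.1 (min (κ p) (kap hT n p))) (ev T hT p.1 (min (τ p) (kap hT n p)))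
        linarith [norm_nonneg p.2]
    · refine ae_of_all _ fun p => tendsto_const_nhds.congr' ?_
      filter_upwards [kap_eventually hT p] with n hn
      rw [hn, if_pos (hτ.le p), min_eq_left (hκ.le p), min_eq_left (hτ.le p)]
  have h2 : ∀ n : ℕ, ∫ p, (if τ p ≤ kap hT n p then h p else 0) *
      (ev T hT p.1 (min (κ p) (kap hT n p)) - ev T hT p.1 (min (τ p) (kap hT n p))) ∂Q = 0 := fun n =>
    LPx hT hL true n (hτ.min (kap_Stp hT n)) (hκ.min (kap_Stp hT n)) (fun p => min_le_min_right _ (hle p))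
      (fun p => min_le_right _ _) (MA.ite_le hτ (kap_Stp hT n) hh) (C := C) fun p => by

        split_ifs
        · exact hC p
        · simpa using (abs_nonneg _).trans (hC p)
  simp only [h2] at h1
  exact tendsto_nhds_unique h1 tendsto_const_nhds

end Dual2

section Dual3

variable {T : ℝ} (hT : 0 ≤ T) {Q : Measure (PathPair T)} [IsProbabilityMeasure Q]
  (hN : Integrable (fun p : PathPair T => ‖p.1‖ + ‖p.2‖) Q) (h1 : LP1 hT Q) (h2 : LP2 hT Q)
  (hV : ∀ᵐ p ∂Q, Monotone p.2) (hV0 : ∀ᵐ p : PathPair T ∂Q, ev T hT p.2 0 = 0)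

include hT hN h1 h2 hV hV0 in
lemma Lm_L2 (m : ℕ) {κ : PathPair T → ℝ} (hκ : Stp hT κ) {R : ℝ} (hκR : ∀ p, κ p ≤ kap hT R p) :
    Integrable (fun p => Lm hT m (κ p) p ^ 2) Q ∧
    ∫ p, Lm hT m (κ p) p ^ 2 ∂Q ≤ 18 * ((2:ℝ) ^ (-(m:ℤ))) ^ 2 * (2 * |R|) := by
  set δ : ℝ := (2:ℝ) ^ (-(m:ℤ)) with hδ
  have δ0 : 0 ≤ δ := by positivity
  set σ : ℕ → PathPair T → ℝ := fun k p => min (sg hT m k p) (κ p) with hσ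
  have hs : ∀ k, Stp hT (σ k) := fun k => (sg_Stp hT m k).min hκ
  have hmon : ∀ k p, σ k p ≤ σ (k + 1) p := fun k p =>
    min_le_min_right _ (min_le_min_right _ (sig_le_succ hT m k p.1))
  have hσR : ∀ k p, σ k p ≤ kap hT R p := fun k p => (min_le_right _ _).trans (hκR p)
  have s0 : ∀ p, σ 0 p = 0 := fun p => by
    simp only [hσ, sg, sig]; rw [min_eq_left hT, min_eq_left (hκ.nn p)]
  have osc : ∀ k p u, σ k p ≤ u → u ≤ σ (k + 1) p → |ev T hT p.1 u - ev T hT p.1 (σ k p)| ≤ δ := by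
    intro k p u hu hu'
    rcases lt_or_ge (κ p) (sg hT m k p) with h | h
    · have e : u = σ k p := le_antisymm ((hu'.trans (min_le_right _ _)).trans (min_eq_right h.le).ge) hu
      rw [e]; simpa using δ0
    · have hκT := hκ.le p
      rcases sig_eq_or_le hT m k p.1 with h' | h'
      · have : sg hT m k p = T := by unfold sg; rw [h']; exact min_eq_right (by linarith)
        have e : u = σ k p := by
          refine le_antisymm ((hu'.trans (min_le_right _ _)).trans ?_) hu
          simp only [hσ]; rw [this]; exact le_min hκT le_rfl
        rw [e]; simpa using δ0
      · have e : σ k p = sig T hT m k p.1 := by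
          simp only [hσ]; rw [min_eq_left h]; unfold sg; exact min_eq_left h'
        rw [e] at hu ⊢
        exact sig_osc hT hu (hu'.trans ((min_le_left _ _).trans (min_le_left _ _)))
          (hu'.trans ((min_le_right _ _).trans hκT))
  have em : ∀ τ, Stp hT τ → Measurable fun p : PathPair T => ev T hT p.2 (τ p) := fun τ h =>
    ev_meas hT measurable_snd h.meas
  have em1 : ∀ τ, Stp hT τ → Measurable fun p : PathPair T => ev T hT p.1 (τ p) := fun τ h =>
    ev_meas hT measurable_fst h.meas
  set dS : ℕ → PathPair T → ℝ := fun k p => ev T hT p.1 (σ (k + 1) p) - ev T hT p.1 (σ k p) with hdS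
  set dV : ℕ → PathPair T → ℝ := fun k p => ev T hT p.2 (σ (k + 1) p) - ev T hT p.2 (σ k p) with hdV
  have mS : ∀ k, Measurable (dS k) := fun k => (em1 _ (hs _)).sub (em1 _ (hs _))
  have mV : ∀ k, Measurable (dV k) := fun k => (em _ (hs _)).sub (em _ (hs _))
  have bS : ∀ k p, |dS k p| ≤ 2 * |R| := fun k p => (S_diff_bdd hT ((hs k).nn p) (hmon k p) (hσR _ p)).1
  have bV : ∀ k p, |dV k p| ≤ 2 * |R| := fun k p => (S_diff_bdd hT ((hs k).nn p) (hmon k p) (hσR _ p)).2.1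
  have R0 : 0 ≤ 2 * |R| := by positivity
  have bS2 : ∀ k p, |dS k p ^ 2| ≤ (2 * |R|) ^ 2 := fun k p => by
    rw [abs_pow]; exact pow_le_pow_left₀ (abs_nonneg _) (bS k p) 2
  set N : ℕ → PathPair T → ℝ := fun k p => dS k p ^ 2 - dV k p with hNd
  set M : ℕ → PathPair T → ℝ := fun J p => ∑ k ∈ Finset.range J, N k p with hM
  set c : ℝ := (2 * |R|) ^ 2 + 2 * |R| with hc
  have c0 : 0 ≤ c := by positivity
  have mN : ∀ k, Measurable (N k) := fun k => ((mS k).pow_const 2).sub (mV k)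
  have bN : ∀ k p, |N k p| ≤ c := fun k p =>
    (abs_sub _ _).trans (add_le_add (bS2 k p) (bV k p))
  have hMA : ∀ J, MA hT (σ J) (M J) := by
    intro J
    induction J with
    | zero => simpa [hM] using MA.const (hT := hT) (τ := σ 0) (c := (0:ℝ))
    | succ J ih =>
      have e : M (J + 1) = fun p => M J p + (dS J p * dS J p - dV J p) := by
        ext p; simp only [hM, Finset.sum_range_succ, hNd]; ring
      rw [e]
      have a1 : MA hT (σ (J + 1)) (dS J) := (MA.ev1 (hs _)).sub ((MA.ev1 (hs J)).mono (hmon J))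
      have a2 : MA hT (σ (J + 1)) (dV J) := (MA.ev2 (hs _)).sub ((MA.ev2 (hs J)).mono (hmon J))
      exact (ih.mono (hmon J)).add ((a1.mul a1).sub a2)
  have bM : ∀ J p, |M J p| ≤ J * c := fun J p => by
    refine (Finset.abs_sum_le_sum_abs _ _).trans ((Finset.sum_le_sum fun k _ => bN k p).trans ?_)
    simp
  have iV : ∀ k, Integrable (dV k) Q := fun k => bdd_int (mV k) (bV k)
  have iS : ∀ k, Integrable (fun p => dS k p ^ 2) Q := fun k => bdd_int ((mS k).pow_const 2) (bS2 k)
  have iN2 : ∀ k, Integrable (fun p => N k p ^ 2) Q := fun k => bdd_int ((mN k).pow_const 2) (C := c ^ 2) fun p => by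
    rw [abs_pow]; exact pow_le_pow_left₀ (abs_nonneg _) (bN k p) 2
  have iV2 : ∀ k, Integrable (fun p => dV k p ^ 2) Q := fun k => bdd_int ((mV k).pow_const 2) (C := (2 * |R|) ^ 2) fun p => by
    rw [abs_pow]; exact pow_le_pow_left₀ (abs_nonneg _) (bV k p) 2
  have eN : ∀ k, ∫ p, N k p ^ 2 ∂Q ≤ 18 * δ ^ 2 * ∫ p, dV k p ∂Q := by
    intro k
    have e1 := energy2 hT hN h1 h2 hV (hs k) (hs (k + 1)) (hmon k) (hσR _) (D := 2 * δ) fun p u hu hu' => by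
      have a := osc k p u hu hu'
      have b := osc k p _ (hmon k p) le_rfl
      rw [abs_le] at a b ⊢
      constructor <;> linarith [a.1, a.2, b.1, b.2]
    have e2 := energy hT hN h1 h2 (hs k) (hs (k + 1)) (hmon k) (hσR _) (h := fun _ => 1) (MA.const _ _) (C := 1) (by simp)
    simp only [one_mul] at e2
    have e3 : ∫ p, N k p ^ 2 ∂Q ≤ ∫ p, (2 * δ ^ 2 * dS k p ^ 2 + 2 * dV k p ^ 2) ∂Q := by
      refine integral_mono (iN2 k) (((iS k).const_mul _).add ((iV2 k).const_mul 2)) fun p => ?_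
      have b : dS k p ^ 2 ≤ δ ^ 2 := by
        rw [← sq_abs]; exact pow_le_pow_left₀ (abs_nonneg _) (osc k p _ (hmon k p) le_rfl) 2
      have b2 := mul_le_mul_of_nonneg_right b (sq_nonneg (dS k p))
      simp only [hNd]
      nlinarith [sq_nonneg (dS k p ^ 2 + dV k p)]
    rw [integral_add ((iS k).const_mul _) ((iV2 k).const_mul 2), integral_const_mul, integral_const_mul] at e3
    change ∫ p, dV k p ^ 2 ∂Q ≤ 2 * (2 * δ) ^ 2 * ∫ p, dV k p ∂Q at e1
    change ∫ p, dS k p ^ 2 ∂Q = ∫ p, dV k p ∂Q at e2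
    rw [e2] at e3
    nlinarith
  have iM2 : ∀ J, Integrable (fun p => M J p ^ 2) Q := fun J => bdd_int ((hMA J).meas.pow_const 2) (C := (J * c) ^ 2) fun p => by
    rw [abs_pow]; exact pow_le_pow_left₀ (abs_nonneg _) (bM J p) 2
  have iMf : ∀ J (f : PathPair T → ℝ) (b : ℝ), Measurable f → (∀ p, |f p| ≤ b) → Integrable (fun p => M J p * f p) Q :=
    fun J f b hf hb => bdd_int ((hMA J).meas.mul hf) (C := J * c * b) fun p => by
      rw [abs_mul]; exact mul_le_mul (bM J p) (hb p) (abs_nonneg _) (by positivity)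
  have eM : ∀ J, ∫ p, M J p ^ 2 ∂Q ≤ 18 * δ ^ 2 * ∫ p, (ev T hT p.2 (σ J p) - ev T hT p.2 (σ 0 p)) ∂Q := by
    intro J
    induction J with
    | zero => simp [hM]
    | succ J ih =>
      have en := energy hT hN h1 h2 (hs J) (hs (J + 1)) (hmon J) (hσR _) (hMA J) (bM J)
      change ∫ p, M J p * dS J p ^ 2 ∂Q = ∫ p, M J p * dV J p ∂Q at en
      have e : ∀ p, M (J + 1) p ^ 2 = (M J p ^ 2 + N J p ^ 2) + 2 * (M J p * dS J p ^ 2 - M J p * dV J p) := fun p => by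
        simp only [hM, Finset.sum_range_succ, hNd]; ring
      have i1 := iMf J _ _ ((mS J).pow_const 2) (bS2 J)
      have i2 := iMf J _ _ (mV J) (bV J)
      have i3 : Integrable (fun p => M J p ^ 2 + N J p ^ 2) Q := (iM2 J).add (iN2 J)
      have i4 : Integrable (fun p => M J p * dS J p ^ 2 - M J p * dV J p) Q := i1.sub i2
      have i5 : Integrable (fun p => ev T hT p.2 (σ J p) - ev T hT p.2 (σ 0 p)) Q :=
        bdd_int ((em _ (hs _)).sub (em _ (hs _))) (C := 2 * |R|) fun p =>
          (S_diff_bdd hT ((hs 0).nn p) (by rw [s0]; exact (hs J).nn p) (hσR _ p)).2.1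
      have e' : ∀ p : PathPair T, ev T hT p.2 (σ (J + 1) p) - ev T hT p.2 (σ 0 p) =
        (ev T hT p.2 (σ J p) - ev T hT p.2 (σ 0 p)) + dV J p := fun p => by simp only [hdV]; ring
      simp only [e, e']
      rw [integral_add i3 (i4.const_mul 2), integral_add (iM2 J) (iN2 J), integral_const_mul, integral_sub i1 i2, en,
        integral_add i5 (iV J)]
      have := eN J
      nlinarith
  refine fatou_real (f := fun J p => M J p ^ 2) iM2 (fun J => ae_of_all _ fun p => sq_nonneg _) (fun J => ?_) ?_
  · refine (eM J).trans (mul_le_mul_of_nonneg_left ?_ (by positivity))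
    have := norm_integral_le_of_norm_le_const (μ := Q) (C := 2 * |R|)
      (f := fun p => ev T hT p.2 (σ J p) - ev T hT p.2 (σ 0 p)) (ae_of_all _ fun p =>
          (S_diff_bdd hT ((hs 0).nn p) (by rw [s0]; exact (hs J).nn p) (hσR _ p)).2.1)
    rw [probReal_univ, mul_one] at this
    exact (le_abs_self _).trans this
  · filter_upwards [hV0] with p hp
    refine tendsto_const_nhds.congr' ?_
    obtain ⟨n, hn⟩ := sig_eventually hT m p.1
    filter_upwards [eventually_ge_atTop n] with J hJ
    have hκT := hκ.le p
    have eσ : ∀ k, min (sig T hT m k p.1) (κ p) = σ k p := fun k => by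
      simp only [hσ, sg]; rw [min_assoc, min_eq_right hκT]
    have q := Sm_sq hT m J (hκ.nn p) p.1
    simp only [eσ] at q
    have ee : σ J p = κ p := by rw [← eσ, hn J hJ]; exact min_eq_right (by linarith)
    rw [min_comm, eσ, ee] at q
    have q2 := Finset.sum_range_sub (fun k => ev T hT p.2 (σ k p)) J
    simp only [ee, s0, hp, sub_zero] at q2
    have : M J p = Lm hT m (κ p) p := by
      simp only [hM, hNd, Finset.sum_sub_distrib]
      unfold Lm
      change ∑ k ∈ Finset.range J, dV k p = _ at q2
      change _ = ∑ k ∈ Finset.range J, dS k p ^ 2 at q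
      rw [q2, ← q]; ring
    rw [this]

include hT hN h1 h2 hV hV0 in
lemma BO_ae : ∀ᵐ p ∂Q, BO hT p := by
  set ε : ℕ → ℝ := fun m => (3 / 4) ^ m with hε
  have ε0 : ∀ m, 0 < ε m := fun m => by positivity
  have st : ∀ (R m : ℕ), Stp hT fun p => min (rho hT m (ε m) p) (kap hT R p) := fun R m =>
    (rho_Stp hT m (ε m)).min (kap_Stp hT R)
  have bc : ∀ R : ℕ, ∀ᵐ p ∂Q, ∀ᶠ m in atTop,
      p ∉ {p | ε m ^ 2 ≤ Lm hT m (min (rho hT m (ε m) p) (kap hT R p)) p ^ 2} := by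
    intro R
    refine ae_eventually_notMem ?_
    have hb : ∀ m : ℕ, Q {p | ε m ^ 2 ≤ Lm hT m (min (rho hT m (ε m) p) (kap hT R p)) p ^ 2} ≤
        ENNReal.ofReal (18 * (2 * |(R:ℝ)|) * (4 / 9) ^ m) := by
      intro m
      obtain ⟨i, hi⟩ := Lm_L2 hT hN h1 h2 hV hV0 m (st R m) (R := R) fun p => min_le_right _ _
      have mk := mul_meas_ge_le_integral_of_nonneg (ae_of_all _ fun p => sq_nonneg _) i (ε m ^ 2)
      have hle := mk.trans hi
      have he : 0 < ε m ^ 2 := by have := ε0 m; positivity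
      rw [mul_comm, ← le_div_iff₀ he] at hle
      refine (ENNReal.le_ofReal_iff_toReal_le (measure_ne_top _ _) (by positivity)).2 (hle.trans (le_of_eq ?_))
      rw [div_eq_iff he.ne']
      simp only [hε]
      rw [zpow_neg, zpow_natCast, ← inv_pow, ← pow_mul, ← pow_mul, mul_comm m 2, pow_mul, pow_mul]
      rw [mul_assoc (18 * (2 * |(R:ℝ)|)), ← mul_pow]
      norm_num
      ring
    refine ne_top_of_le_ne_top ?_ (ENNReal.tsum_le_tsum hb)
    refine Summable.tsum_ofReal_ne_top ?_
    exact (summable_geometric_of_lt_one (by norm_num) (by norm_num)).mul_left _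
  filter_upwards [ae_all_iff.2 bc, hV, hV0] with p hp hp1 hp2
  refine ⟨hp1, ?_⟩
  obtain ⟨R, hR⟩ := (kap_eventually hT p).exists
  rw [tendsto_iff_norm_sub_tendsto_zero]
  refine squeeze_zero' (Eventually.of_forall fun m => norm_nonneg _) ?_
    (tendsto_pow_atTop_nhds_zero_of_lt_one (r := (3/4:ℝ)) (by norm_num) (by norm_num))
  filter_upwards [hp R] with m hm
  have hm : Lm hT m (min (rho hT m (ε m) p) (kap hT R p)) p ^ 2 < ε m ^ 2 := not_le.1 hm
  have lc := (Lm_cont hT m p).abs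
  have hr : rho hT m (ε m) p = T := by
    refine le_antisymm ((rho_Stp hT m _).le p) (not_lt.1 fun h => ?_)
    have := ge_of_hit_lt hT (f := fun u p => |Lm hT m u p|) (c := ε m) (p := p) lc h
    change ε m ≤ |Lm hT m (rho hT m (ε m) p) p| at this
    rw [hR, min_eq_left h.le, ← sq_abs (Lm _ _ _ _)] at hm
    exact absurd hm (not_lt.2 (pow_le_pow_left₀ (ε0 m).le this 2))
  rw [norm_le_iff hT _ (ε0 m).le]
  intro t ht
  have hb : |Lm hT m t p| ≤ ε m := by
    rcases hT.eq_or_lt with h0 | h0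
    · have : t = 0 := le_antisymm (h0 ▸ ht.2) ht.1
      rw [this]; unfold Lm; rw [Sm_zero, hp2]; simpa using (ε0 m).le
    · exact le_of_le_hit hT (f := fun u p => |Lm hT m u p|) lc ht.1 (by
        change t ≤ rho hT m (ε m) p; rw [hr]; exact ht.2) (by change 0 < rho hT m (ε m) p; rw [hr]; exact h0)
  have e : ev T hT (SmP hT m p.1 - half hT p) t = - (Lm hT m t p) / 2 := by
    have : ev T hT (SmP hT m p.1 - half hT p) t = ev T hT (SmP hT m p.1) t - ev T hT (half hT p) t := rfl
    rw [this, ev_SmP hT m _ ht, ev_half hT p ht]; unfold Lm; ring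
  rw [e, abs_div, abs_neg, abs_two]
  linarith [abs_nonneg (Lm hT m t p)]

end Dual3

section Final

variable {T : ℝ} (hT : 0 ≤ T) {Ξ : Set (Path T)} {Zbar : PathPair T → ℝ≥0∞}

lemma exp_ge {α : Type*} [MeasurableSpace α] {Q : Measure α} {ξ : α → EReal} {f : α → ℝ}
    (hf : Integrable f Q) (h : ∀ᵐ x ∂Q, (f x : EReal) ≤ ξ x) : ((∫ x, f x ∂Q : ℝ) : EReal) ≤ expEReal Q ξ := by
  have fp := hf.lintegral_lt_top.ne
  have fn : ∫⁻ x, ENNReal.ofReal (-f x) ∂Q ≠ ⊤ := hf.neg.lintegral_lt_top.ne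
  have e : ((∫ x, f x ∂Q : ℝ) : EReal) = ((∫⁻ x, ENNReal.ofReal (f x) ∂Q : ℝ≥0∞) : EReal) -
      ((∫⁻ x, ENNReal.ofReal (-f x) ∂Q : ℝ≥0∞) : EReal) := by
    rw [integral_eq_lintegral_pos_part_sub_lintegral_neg_part hf, EReal.coe_sub,
      EReal.coe_ennreal_toReal fp, EReal.coe_ennreal_toReal fn]
  rw [e]
  unfold expEReal
  refine EReal.sub_le_sub ?_ ?_
  · refine EReal.coe_ennreal_le_coe_ennreal_iff.2 (lintegral_mono_ae ?_)
    filter_upwards [h] with x hx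
    unfold erealPos
    split_ifs with h1
    · exact le_top
    · have h2 : ξ x ≠ ⊥ := fun hb => by rw [hb] at hx; simp at hx
      refine ENNReal.ofReal_le_ofReal ?_
      rw [← EReal.coe_le_coe_iff, EReal.coe_toReal h1 h2]; exact hx
  · refine EReal.coe_ennreal_le_coe_ennreal_iff.2 (lintegral_mono_ae ?_)
    filter_upwards [h] with x hx
    have h2 : ξ x ≠ ⊥ := fun hb => by rw [hb] at hx; simp at hx
    unfold erealPos
    rw [if_neg (by simpa using h2)]
    by_cases h1 : ξ x = ⊤
    · simp [h1]
    · refine ENNReal.ofReal_le_ofReal ?_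
      rw [← EReal.coe_le_coe_iff, EReal.coe_toReal (by simpa using h2) (by simpa using h1), EReal.coe_neg]
      exact EReal.neg_le_neg_iff.2 hx

variable (hB : AssumptionB T hT Ξ Zbar)

include hB in
lemma dual_MZ {Q : Measure (PathPair T)} [IsProbabilityMeasure Q] (hZ : ∫⁻ p, Zbar p ∂Q ≠ ⊤)
    (hL : ∀ ℓ ∈ LL hT, ∫ p, ℓ p ∂Q = 0) :
    (∀ᵐ p ∂Q, ps hT p.1 = p) ∧ Q.map Prod.fst ∈ MZSet T hT Ξ (fun ω => Zbar (ω, qv T hT ω)) := by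
  have zm := Zmeas hT hB
  have zf : ∀ᵐ p ∂Q, Zbar p ≠ ⊤ := (ae_lt_top zm hZ).mono fun p h => h.ne
  have hN : Integrable (fun p : PathPair T => ‖p.1‖ + ‖p.2‖) Q := by
    refine Integrable.mono' (integrable_toReal_of_lintegral_ne_top zm.aemeasurable hZ) (by fun_prop) ?_
    filter_upwards [zf] with p hp
    rw [Real.norm_of_nonneg (by positivity)]
    exact normZ hT hB hp
  have hV : ∀ᵐ p ∂Q, Monotone p.2 := zf.mono fun p hp => (hB.B2 p hp).2
  have hV0 : ∀ᵐ p : PathPair T ∂Q, ev T hT p.2 0 = 0 := zf.mono fun p hp => by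
    have := (hB.B2 p hp).1
    unfold ev
    rwa [show clamp T hT 0 = t0 T hT from clamp_of_mem hT ⟨le_rfl, hT⟩]
  have h1 := LP1_dual hT hL hN
  have hBO := BO_ae hT hN h1 (LP2_dual hT hL) hV hV0
  have hps : ∀ᵐ p ∂Q, ps hT p.1 = p := hBO.mono fun p hp => Prod.ext rfl (hp.qv hT)
  have mf : Measurable (Prod.fst : PathPair T → Path T) := measurable_fst
  have hP : IsProbabilityMeasure (Q.map Prod.fst) := Measure.isProbabilityMeasure_map mf.aemeasurable
  refine ⟨hps, hP, ⟨fun m _ => m + T, ?_, ae_of_all _ fun ω => ⟨?_, ?_⟩, fun m => ?_⟩, ?_, ?_⟩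
  · intro m t _
    exact @MeasurableSet.const _ (Fraw T t) _
  · intro a b h
    simpa using h
  · exact tendsto_atTop_add_const_right _ _ tendsto_natCast_atTop_atTop
  · have e : ∀ t ∈ Icc (0:ℝ) T, (fun ω => Sproc T hT (min ((m:ℝ) + T) t) ω) = fun ω => ev T hT ω t := by
      intro t ht
      have : min ((m:ℝ) + T) t = t := min_eq_right (by linarith [ht.2, (Nat.cast_nonneg m : (0:ℝ) ≤ m)])
      rw [this]; rfl
    have em : ∀ t, Measurable fun ω : Path T => ev T hT ω t := fun t => ev_meas hT measurable_id measurable_const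
    have ei : ∀ t, Integrable (fun p : PathPair T => ev T hT p.1 t) Q := fun t =>
      Integrable.mono' hN ((em t).comp mf).aestronglyMeasurable (ae_of_all _ fun p =>
        (ev_abs_le hT p.1 t).trans (by linarith [norm_nonneg p.2]))
    refine ⟨fun t ht => ?_, fun s t hs ht hst A hA => ?_⟩
    · change Integrable (fun ω => Sproc T hT (min ((m:ℝ) + T) t) ω) _
      rw [e t ht]
      exact (integrable_map_measure (em t).aestronglyMeasurable mf.aemeasurable).2 (ei t)
    · have hA' : MeasurableSet A := Fraw_le s A hA
      obtain ⟨B, hBm, hBA⟩ := Fraw_le_sp hT s A hA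
      have mem : ∀ p : PathPair T, p.1 ∈ A ↔ sp hT p.1 s ∈ B := fun p => by rw [← hBA]; rfl
      have l := h1 (fun _ => s) (fun _ => t) (fun p => if p.1 ∈ A then 1 else 0) 1 (Stp.const hs.1 hs.2)
        (Stp.const ht.1 ht.2) (fun _ => hst) ⟨Measurable.ite (mf hA') measurable_const measurable_const, ?_⟩
        (fun p => by split_ifs <;> simp)
      · simp only [e t ht, e s hs]
        rw [setIntegral_map hA' (em t).aestronglyMeasurable mf.aemeasurable,
          setIntegral_map hA' (em s).aestronglyMeasurable mf.aemeasurable, ← sub_eq_zero,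
          ← integral_sub (ei t).integrableOn (ei s).integrableOn, ← integral_indicator (mf hA'), ← l]
        congr 1; ext p
        simp only [Set.indicator, Set.mem_preimage]
        split_ifs <;> simp
      · intro p q u e hu
        have := congrArg Prod.fst (agr_stp hT e hu.le)
        simp only [stp] at this
        simp only [mem, this]
  · rw [← mem_ae_iff_prob_eq_one (Xi_meas hT hB)]
    change ∀ᵐ ω ∂(Q.map Prod.fst), ω ∈ Ξ
    rw [ae_map_iff (p := fun ω => ω ∈ Ξ) mf.aemeasurable (Xi_meas hT hB)]
    filter_upwards [hBO, zf] with p hp hz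
    rw [hB.xi_eq]
    refine ⟨hp.mem hT, ?_⟩
    rwa [hp.qv hT]
  · change ∫⁻ ω, Zbar (ps hT ω) ∂(Q.map Prod.fst) ≠ ⊤
    rw [lintegral_map (f := fun ω => Zbar (ps hT ω)) (zm.comp (ps_measurable hT)) mf]
    rwa [lintegral_congr_ae (hps.mono fun p hp => by rw [hp])]

include hB in
lemma strong {ξ : Path T → EReal} {b : ℝ} (hb : ∀ ω, (b : EReal) ≤ ξ ω) {ξbar : ℕ → PathPair T → ℝ}
    (hbdd : ∀ n, ∃ C : ℝ, ∀ p, |ξbar n p| ≤ C)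
    (husc : ∀ n, UpperSemicontinuous (ξbar n))
    (hrep : ∀ ω : Path T, ξ ω = Filter.liminf (fun n => ((ξbar n (ps hT ω) : ℝ) : EReal)) Filter.atTop)
    {r : ℝ} (hr : ∀ Q ∈ MZSet T hT Ξ (fun ω => Zbar (ω, qv T hT ω)), expEReal Q ξ ≤ r) :
    r ∈ PhiZSet T hT Ξ (fun ω => Zbar (ω, qv T hT ω)) ξ := by
  set η : ℕ → PathPair T → ℝ := fun n p => ⨅ k : ℕ, max b (ξbar (n + k) p) with hη
  have bb : ∀ n p, BddBelow (range fun k : ℕ => max b (ξbar (n + k) p)) := fun n p =>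
    ⟨b, by rintro _ ⟨k, rfl⟩; exact le_max_left _ _⟩
  have ηb : ∀ n p, b ≤ η n p := fun n p => le_ciInf fun k => le_max_left _ _
  have ηle : ∀ n p, ∀ k ≥ n, η n p ≤ max b (ξbar k p) := fun n p k hk => by
    have := ciInf_le (bb n p) (k - n)
    rwa [Nat.add_sub_cancel' hk] at this
  have ηbd : ∀ n, ∃ C, ∀ p, |η n p| ≤ C := fun n => by
    obtain ⟨C, hC⟩ := hbdd n
    refine ⟨|b| + C, fun p => ?_⟩
    have h1 := ηb n p
    have h2 := ηle n p n le_rfl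
    have h3 := abs_le.1 (hC p)
    have h4 := neg_abs_le b
    have h5 := le_abs_self b
    rw [abs_le]
    refine ⟨by linarith, h2.trans (max_le ?_ ?_)⟩ <;> linarith [abs_nonneg b]
  have ηu : ∀ n, UpperSemicontinuous (η n) := fun n => upperSemicontinuous_ciInf (bb n) fun k =>
    upperSemicontinuous_const.sup (husc (n + k))
  have ηξ : ∀ n ω, ((η n (ps hT ω) : ℝ) : EReal) ≤ ξ ω := by
    intro n ω
    rcases le_or_gt (η n (ps hT ω)) b with h | h
    · exact (EReal.coe_le_coe_iff.2 h).trans (hb ω)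
    · rw [hrep]
      refine le_liminf_of_le (by isBoundedDefault) ?_
      filter_upwards [eventually_ge_atTop n] with k hk
      have := ηle n (ps hT ω) k hk
      rw [EReal.coe_le_coe_iff]
      rcases le_max_iff.1 this with h' | h'
      · linarith
      · exact h'
  set ε : ℕ → ℝ := fun n => 1 / ((n:ℝ) + 1) with hε
  have ε0 : ∀ n, 0 < ε n := fun n => by positivity
  have ε1 : ∀ n, ε n ≤ 1 := fun n => by
    simp only [hε]; rw [div_le_one (by positivity)]; linarith [(Nat.cast_nonneg n : (0:ℝ) ≤ n)]
  have step : ∀ n, ∃ ℓ ∈ LL hT, ∀ p, Zbar p ≠ ⊤ → η n p - ε n * (Zbar p).toReal - ℓ p ≤ r + ε n := by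
    intro n
    by_contra hcon
    push Not at hcon
    obtain ⟨C, hC⟩ := ηbd n
    obtain ⟨Q, hP, hZ, hL, ha⟩ := minimax hB.B1 hC (ηu n) (LL hT) (ε0 n) (r + ε n) hcon
    obtain ⟨hps, hM⟩ := dual_MZ hT hB hZ hL
    have hP' := hM.1
    have mη := (ηu n).measurable
    have mη' : Measurable fun ω => η n (ps hT ω) := mη.comp (ps_measurable hT)
    have i : Integrable (fun ω => η n (ps hT ω)) (Q.map Prod.fst) :=
      Integrable.mono' (integrable_const C) mη'.aestronglyMeasurable (ae_of_all _ fun ω => hC _)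
    have h3 := (exp_ge i (ae_of_all _ (ηξ n))).trans (hr _ hM)
    rw [EReal.coe_le_coe_iff, integral_map measurable_fst.aemeasurable mη'.aestronglyMeasurable,
      integral_congr_ae (g := η n) (hps.mono fun p hp => by simp only [hp])] at h3
    linarith [ε0 n]
  choose ℓ hℓ hℓb using step
  have step2 : ∀ n, ∃ A G : SimpleStrategy T, ∀ ω ∈ Ξ,
      |integ T A (Sproc T hT) T ω + integ T G (SS T hT) T ω - ℓ n (ps hT ω)| ≤ ε n * (Zbar (ps hT ω)).toReal := by
    intro n
    obtain ⟨B0, hB0⟩ := Hd_LL hT hB.one_le hB.B1 (hℓ n) (ε n) (ε0 n)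
    obtain ⟨n0, hn0⟩ := hB0 B0 le_rfl
    obtain ⟨H, hG, hH⟩ := hn0 n0 le_rfl
    obtain ⟨A, G, hAG⟩ := exists_hedge hT B0 n0 hG
    refine ⟨A, G, fun ω hω => ?_⟩
    rw [hAG ω (Xi_BO hT hB hω)]
    exact hH _ (Xi_Z hT hB hω)
  choose A G hAG using step2
  have low : ∀ n, ∀ ω ∈ Ξ, η n (ps hT ω) - ε n * (1 + 2 * (Zbar (ps hT ω)).toReal) ≤
      r + (integ T (A n) (Sproc T hT) T ω + integ T (G n) (SS T hT) T ω) := fun n ω hω => by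
    have h1 := hℓb n _ (Xi_Z hT hB hω)
    have h2 := (abs_le.1 (hAG n ω hω)).1
    linarith
  refine ⟨|b| + 3, by positivity, A, G, fun n ω hω => ?_, fun ω hω => ?_⟩
  · have h1 := low n ω hω
    have h2 := ηb n (ps hT ω)
    have z1 : 1 ≤ (Zbar (ps hT ω)).toReal := by
      have := (ENNReal.toReal_le_toReal ENNReal.one_ne_top (Xi_Z hT hB hω)).2 (hB.one_le _)
      simpa using this
    change -((|b| + 3) * (Zbar (ps hT ω)).toReal) ≤ _
    have h3 := mul_le_mul_of_nonneg_right (ε1 n) (by linarith : 0 ≤ 1 + 2 * (Zbar (ps hT ω)).toReal)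
    have h4 := mul_le_mul_of_nonneg_left z1 (abs_nonneg b)
    have h5 := neg_abs_le b
    nlinarith
  · refine le_of_forall_lt_imp_le_of_dense fun x hx => ?_
    obtain ⟨y, hxy, hy⟩ := EReal.lt_iff_exists_real_btwn.1 hx
    obtain ⟨w, hyw, hw⟩ := EReal.lt_iff_exists_real_btwn.1 hy
    have hyw : y < w := EReal.coe_lt_coe_iff.1 hyw
    rw [hrep] at hw
    obtain ⟨N, hN⟩ := eventually_atTop.1 (eventually_lt_of_lt_liminf hw (by isBoundedDefault))
    have hlim : Tendsto (fun n => ε n * (1 + 2 * (Zbar (ps hT ω)).toReal)) atTop (𝓝 0) := by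
      have := (tendsto_one_div_add_atTop_nhds_zero_nat (𝕜 := ℝ)).mul_const (1 + 2 * (Zbar (ps hT ω)).toReal)
      rwa [zero_mul] at this
    have : ((y - r : ℝ) : EReal) ≤ Filter.liminf (fun n =>
        ((integ T (A n) (Sproc T hT) T ω + integ T (G n) (SS T hT) T ω : ℝ) : EReal)) Filter.atTop := by
      refine le_liminf_of_le (by isBoundedDefault) ?_
      filter_upwards [eventually_ge_atTop N, hlim.eventually (gt_mem_nhds (sub_pos.2 hyw))] with n hn h1
      have h2 := low n ω hω
      have h3 : w ≤ η n (ps hT ω) := le_ciInf fun k =>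
        (EReal.coe_lt_coe_iff.1 (hN (n + k) (by omega))).le.trans (le_max_right _ _)
      rw [EReal.coe_le_coe_iff]
      linarith
    calc x ≤ (y : EReal) := hxy.le
      _ = (r : EReal) + ((y - r : ℝ) : EReal) := by rw [← EReal.coe_add]; congr 1; ring
      _ ≤ _ := add_le_add le_rfl this

end Final

theorem superhedging_duality_Z (T : ℝ) (hT : 0 ≤ T)
    (Ξ : Set (Path T)) (Zbar : PathPair T → ℝ≥0∞) (hB : AssumptionB T hT Ξ Zbar)
    (hMne : (MZSet T hT Ξ (fun ω => Zbar (ω, qv T hT ω))).Nonempty)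
    (ξ : Path T → EReal)
    (hbelow : ∃ b : ℝ, ∀ ω, (b : EReal) ≤ ξ ω)
    (ξbar : ℕ → PathPair T → ℝ)
    (hbdd : ∀ n, ∃ C : ℝ, ∀ p, |ξbar n p| ≤ C)
    (husc : ∀ n, UpperSemicontinuous (ξbar n))
    (hrep : ∀ ω : Path T, ξ ω =
      Filter.liminf (fun n => ((ξbar n (ω, qv T hT ω) : ℝ) : EReal)) Filter.atTop) :
    PhiZ T hT Ξ (fun ω => Zbar (ω, qv T hT ω)) ξ =
      (⨆ Q ∈ MZSet T hT Ξ (fun ω => Zbar (ω, qv T hT ω)), expEReal Q ξ) ∧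
    (PhiZ T hT Ξ (fun ω => Zbar (ω, qv T hT ω)) ξ ≠ ⊤ →
      ∃ lam ∈ PhiZSet T hT Ξ (fun ω => Zbar (ω, qv T hT ω)) ξ,
        (lam : EReal) = PhiZ T hT Ξ (fun ω => Zbar (ω, qv T hT ω)) ξ) := by
  obtain ⟨b, hb⟩ := hbelow
  obtain ⟨Q0, hQ0⟩ := hMne
  have weak : (⨆ Q ∈ MZSet T hT Ξ (fun ω => Zbar (ω, qv T hT ω)), expEReal Q ξ) ≤
      PhiZ T hT Ξ (fun ω => Zbar (ω, qv T hT ω)) ξ := by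
    refine iSup₂_le fun Q hQ => le_sInf ?_
    rintro _ ⟨lam, hl, rfl⟩
    exact weak_duality hT hB hQ hb hl
  have hMle : ∀ Q ∈ MZSet T hT Ξ (fun ω => Zbar (ω, qv T hT ω)), expEReal Q ξ ≤
      ⨆ Q ∈ MZSet T hT Ξ (fun ω => Zbar (ω, qv T hT ω)), expEReal Q ξ := fun Q hQ =>
    le_iSup₂ (f := fun Q (_ : Q ∈ MZSet T hT Ξ (fun ω => Zbar (ω, qv T hT ω))) => expEReal Q ξ) Q hQ
  generalize (⨆ Q ∈ MZSet T hT Ξ (fun ω => Zbar (ω, qv T hT ω)), expEReal Q ξ) = M at weak hMle ⊢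
  by_cases hM : M = ⊤
  · rw [hM] at weak ⊢
    have := top_le_iff.1 weak
    exact ⟨this, fun h => absurd this h⟩
  have hMb : M ≠ ⊥ := by
    intro h
    have hP := hQ0.1
    have h1 := (exp_ge (integrable_const (μ := Q0) b) (ae_of_all _ hb)).trans (hMle Q0 hQ0)
    rw [h] at h1
    simp at h1
  lift M to ℝ using ⟨hM, hMb⟩
  have hr := strong hT hB hb hbdd husc hrep hMle
  have e : PhiZ T hT Ξ (fun ω => Zbar (ω, qv T hT ω)) ξ = M := le_antisymm (sInf_le ⟨M, hr, rfl⟩) weak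
  exact ⟨e, fun _ => ⟨M, hr, e.symm⟩⟩

end PathwiseSuperhedging
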